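/- For every integer j ≥ 79 and every positive integer m, the number m + j is the sum of exactly j positive sixth powers if and only if m + 79 is the sum of exactly 79 positive sixth powers. -/

import Mathlib

/-- A positive integer `n` is `(j,k)`-representable if it is a sum of exactly `j`
positive `k`-th powers. -/
def IsRepr (n j k : ℕ) : Prop :=
  ∃ a : Fin j → ℕ, (∀ i, 0 < a i) ∧ ∑ i, (a i) ^ k = n

theorem IsRepr.add {a b i j k : ℕ} (ha : IsRepr a i k) (hb : IsRepr b j k) :
    IsRepr (a + b) (i + j) k := by
  obtain ⟨f, hf, rfl⟩ := ha
  obtain ⟨g, hg, rfl⟩ := hb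
  refine ⟨Fin.append f g, fun x => ?_, by simp [Fin.sum_univ_add]⟩
  induction x using Fin.addCases with
  | left x => simpa using hf x
  | right x => simpa using hg x

theorem IsRepr.pow {a k : ℕ} (ha : 0 < a) : IsRepr (a ^ k) 1 k :=
  ⟨fun _ => a, fun _ => ha, by simp⟩

theorem isRepr_succ_iff {n j k : ℕ} :
    IsRepr n (j + 1) k ↔ ∃ a m, 0 < a ∧ IsRepr m j k ∧ n = m + a ^ k := by
  constructor
  · rintro ⟨f, hf, rfl⟩
    exact ⟨f 0, ∑ i : Fin j, f i.succ ^ k, hf 0, ⟨fun i => f i.succ, fun i => hf _, rfl⟩,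
      by rw [Fin.sum_univ_succ]; ring⟩
  · rintro ⟨a, m, ha, hm, rfl⟩
    exact hm.add (.pow ha)

theorem isRepr_ones (j k : ℕ) : IsRepr j j k := ⟨fun _ => 1, by simp, by simp⟩

theorem IsRepr.le {n j k : ℕ} (h : IsRepr n j k) : j ≤ n := by
  obtain ⟨f, hf, rfl⟩ := h
  calc j = ∑ i : Fin j, 1 := by simp
    _ ≤ _ := Finset.sum_le_sum fun i _ => Nat.one_le_pow _ _ (hf i)

theorem IsRepr.mono {m j j' k : ℕ} (h : IsRepr (m + j) j k) (hj : j ≤ j') :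
    IsRepr (m + j') j' k := by
  obtain ⟨d, rfl⟩ := Nat.exists_eq_add_of_le hj
  simpa [add_assoc] using h.add (isRepr_ones d k)

def maskRound (w S : ℕ) : ℕ :=
  (S ||| S <<< 63 ||| S <<< 728 ||| S <<< 4095 ||| S <<< 15624 ||| S <<< 46655
  ||| S <<< 117648 ||| S <<< 262143 ||| S <<< 531440 ||| S <<< 999999 ||| S <<< 1771560
  ||| S <<< 2985983 ||| S <<< 4826808 ||| S <<< 7529535 ||| S <<< 11390624) &&& (1 <<< w - 1)

def mask (w : ℕ) : ℕ → ℕ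
  | 0 => 1
  | k + 1 => maskRound w (mask w k)

theorem testBit_maskRound {w S m : ℕ} : (maskRound w S).testBit m = true ↔
    m < w ∧ (S.testBit m ∨ ∃ a ∈ Finset.Icc 2 15, a ^ 6 - 1 ≤ m ∧ S.testBit (m - (a ^ 6 - 1))) := by
  have h : Finset.Icc 2 15 = {2,3,4,5,6,7,8,9,10,11,12,13,14,15} := rfl
  rw [h, maskRound, Nat.shiftLeft_eq 1 w, one_mul, Nat.testBit_and, Nat.testBit_two_pow_sub_one,
    Bool.and_comm]
  simp [Nat.testBit_shiftLeft, or_assoc]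

theorem isRepr_of_testBit_mask {w k m : ℕ} (h : (mask w k).testBit m = true) :
    IsRepr (m + k) k 6 := by
  induction k generalizing m with
  | zero =>
    have : m = 0 := by
      rw [mask] at h
      exact Nat.testBit_one_eq_true_iff_self_eq_zero.1 h
    subst this; exact isRepr_ones 0 6
  | succ k ih =>
    obtain ⟨-, h | ⟨a, ha, ham, h⟩⟩ := testBit_maskRound.1 h
    · exact (ih h).mono k.le_succ
    · have ha := (Finset.mem_Icc.1 ha).1
      have := (ih h).add (.pow (k := 6) (by omega : 0 < a))
      have h1 : 1 ≤ a ^ 6 := Nat.one_le_pow _ _ (by omega)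
      rwa [show m - (a ^ 6 - 1) + k + a ^ 6 = m + (k + 1) by omega] at this

theorem testBit_of_isRepr {w S : ℕ} (h0 : S.testBit 0 = true) (hS : maskRound w S = S)
    (hw : w ≤ 16 ^ 6 - 1) {m j : ℕ} (hm : m < w) (h : IsRepr (m + j) j 6) :
    S.testBit m = true := by
  induction j generalizing m with
  | zero =>
    obtain ⟨f, -, hf⟩ := h
    have : m = 0 := by simpa using hf.symm
    rwa [this]
  | succ j ih =>
    obtain ⟨a, n, ha, hn, e⟩ := isRepr_succ_iff.1 h
    have h1 : 1 ≤ a ^ 6 := Nat.one_le_pow _ _ ha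
    have hjn := hn.le
    have ha' : a ^ 6 - 1 ≤ m := by omega
    have key := ih (m := m - (a ^ 6 - 1)) (by omega) (by convert hn using 1; omega)
    rcases Nat.lt_or_ge a 2 with h2 | h2
    · have : a = 1 := by omega
      subst this; simpa using key
    · rw [← hS, testBit_maskRound]
      refine ⟨hm, .inr ⟨a, Finset.mem_Icc.2 ⟨h2, ?_⟩, ha', key⟩⟩
      by_contra hc
      have : 16 ^ 6 ≤ a ^ 6 := Nat.pow_le_pow_left (by omega) 6
      omega

theorem mask_stable : maskRound 16500000 (mask 16500000 78) = mask 16500000 78 := by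
  decide +kernel

theorem mask_zero : (mask 16500000 78).testBit 0 = true := by decide +kernel

theorem mask_full :
    mask 16500000 24 >>> 10436302 = 2 ^ (16500000 - 10436302) - 1 := by decide +kernel

theorem isRepr_small {m j : ℕ} (hm : m < 16500000) (h : IsRepr (m + j) j 6) :
    IsRepr (m + 79) 79 6 :=
  (isRepr_of_testBit_mask (testBit_of_isRepr mask_zero mask_stable (by norm_num) hm h)).mono
    (by norm_num)

theorem isRepr_base {m : ℕ} (h1 : 10436302 ≤ m) (h2 : m < 16500000) : IsRepr (m + 24) 24 6 := by
  obtain ⟨d, rfl⟩ := Nat.exists_eq_add_of_le h1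
  refine isRepr_of_testBit_mask (w := 16500000) ?_
  rw [← Nat.testBit_shiftRight, mask_full, Nat.testBit_two_pow_sub_one]
  simp; omega

theorem succ_pow_six_sub_mono {a X : ℕ} (h : a ≤ X) :
    (a + 1) ^ 6 + X ^ 6 ≤ (X + 1) ^ 6 + a ^ 6 := by
  have h2 := Nat.pow_le_pow_left h 2
  have h3 := Nat.pow_le_pow_left h 3
  have h4 := Nat.pow_le_pow_left h 4
  have h5 := Nat.pow_le_pow_left h 5
  ring_nf
  omega

/-- Adding one sixth power to a block of representable integers. -/
theorem isRepr_ascent {A len k X : ℕ} (h : ∀ m, A ≤ m → m ≤ A + len → IsRepr (m + k) k 6)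
    (hX0 : 0 < X) (hX : (X + 1) ^ 6 ≤ X ^ 6 + len + 1) {m : ℕ} (h1 : A ≤ m)
    (h2 : m ≤ A + ((X + 1) ^ 6 - 2)) : IsRepr (m + (k + 1)) (k + 1) 6 := by
  have hX1 : 2 ^ 6 ≤ (X + 1) ^ 6 := Nat.pow_le_pow_left (by omega) 6
  obtain ⟨d, rfl⟩ := Nat.exists_eq_add_of_le h1
  let P : ℕ → Prop := fun a => a ^ 6 ≤ d + 1
  have hP1 : P (Nat.findGreatest P X) :=
    Nat.findGreatest_spec (P := P) (m := 0) (Nat.zero_le _) (by simp [P])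
  have hP2 : ∀ b, Nat.findGreatest P X < b → b ≤ X → ¬ P b :=
    fun b => Nat.findGreatest_is_greatest
  have ha1 : 1 ≤ Nat.findGreatest P X := Nat.le_findGreatest (by omega) (by simp [P])
  have haX : Nat.findGreatest P X ≤ X := Nat.findGreatest_le _
  generalize Nat.findGreatest P X = a at *
  have hlt : d + 1 < (a + 1) ^ 6 := by
    rcases haX.lt_or_eq with h | rfl
    · simpa [P] using hP2 (a + 1) (by omega) h
    · omega
  have hmono := succ_pow_six_sub_mono haX
  simp only [P] at hP1
  have ha6 : 1 ≤ a ^ 6 := Nat.one_le_pow _ _ ha1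
  have := (h (A + d - (a ^ 6 - 1)) (by omega) (by omega)).add (.pow (k := 6) ha1)
  convert this using 1
  omega

/-- Iterates `isRepr_ascent` along a list of pairs `(x, e)`, each standing for the base
`x * 2 ^ e`; returns the final block length, or `0` if some step is not admissible. -/
def ascentLength : List (ℕ × ℕ) → ℕ → ℕ
  | [], len => len
  | (x, e) :: l, len =>
    if 0 < x * 2 ^ e ∧ (x * 2 ^ e + 1) ^ 6 ≤ (x * 2 ^ e) ^ 6 + len + 1 then
      ascentLength l ((x * 2 ^ e + 1) ^ 6 - 2) else 0

theorem isRepr_ascentLength (l : List (ℕ × ℕ)) {A len k : ℕ}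
    (h : ∀ m, A ≤ m → m ≤ A + len → IsRepr (m + k) k 6) {m : ℕ} (h1 : A < m)
    (h2 : m ≤ A + ascentLength l len) : IsRepr (m + (k + l.length)) (k + l.length) 6 := by
  induction l generalizing len k with
  | nil => exact h m h1.le h2
  | cons p l ih =>
    obtain ⟨x, e⟩ := p
    rw [ascentLength] at h2
    split_ifs at h2 with hc
    · have := ih (k := k + 1) (fun m h1 h2 => isRepr_ascent h hc.1 hc.2 h1 h2) h2
      simpa [add_assoc, add_comm 1] using this
    · omega

def ascentBases : List (ℕ × ℕ) :=
  [(15, 0), (18, 0), (23, 0), (31, 0), (44, 0), (66, 0), (108, 0), (194, 0), (390, 0), (901, 0),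
  (2457, 0), (8185, 0), (34677, 0), (196080, 0), (1567805, 0), (9499276, 1), (11849073, 5),
  (13448412, 10), (15655068, 16), (10789758, 24), (10463038, 33), (8778637, 44), (16337525, 56),
  (11356625, 72), (8432006, 91), (10270057, 113), (8584701, 140), (9135240, 172), (12987504, 210),
  (15013453, 256), (10261302, 312), (14931544, 378), (13451274, 458), (11867353, 554),
  (11729200, 669), (11565537, 807), (8618481, 973), (13911842, 1171), (9364559, 1410),
  (10139920, 1696), (12814368, 2039), (12861167, 2451), (8522406, 2946), (10402325, 3539),
  (10013831, 4251), (12623392, 5105), (14509787, 6130), (8574583, 7361), (10478795, 8837),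
  (15312121, 10608), (13863733, 12734), (14135135, 15285), (16619184, 18346), (11591974, 22020),
  (13099015, 26428)]

theorem two_pow_le_ascentLength :
    2 ^ 158000 ≤ ascentLength ascentBases (16500000 - 1 - 10436302) := by decide +kernel

theorem isRepr_medium {m : ℕ} (h1 : 10436302 < m) (h2 : m ≤ 2 ^ 158000) :
    IsRepr (m + 79) 79 6 :=
  isRepr_ascentLength ascentBases (k := 24) (fun m h1 h2 => isRepr_base h1 (by omega)) h1
    (h2.trans (two_pow_le_ascentLength.trans (Nat.le_add_left _ _)))

open scoped Classical in
/-- The `m ≤ X` such that `m + t` is a sum of `t` positive sixth powers. -/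
noncomputable def sixthShiftsUpTo (t X : ℕ) : Finset ℕ :=
  (Finset.range (X + 1)).filter fun m => IsRepr (m + t) t 6

theorem mem_sixthShiftsUpTo {t X m : ℕ} :
    m ∈ sixthShiftsUpTo t X ↔ m ≤ X ∧ IsRepr (m + t) t 6 := by
  simp [sixthShiftsUpTo]

theorem card_sixthShiftsUpTo_succ {t P X : ℕ} (hP : 0 < P) (hX : (2 * P) ^ 6 ≤ X) :
    P * (sixthShiftsUpTo t (P ^ 5)).card ≤ (sixthShiftsUpTo (t + 1) X).card := by
  have hcard : (Finset.Ico P (2 * P)).card = P := by simp; omega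
  rw [← hcard, ← Finset.card_product, hcard]
  have hgap : ∀ x, P ≤ x → x ^ 6 + P ^ 5 + 1 < (x + 1) ^ 6 := by
    intro x hx
    have h1 : P ^ 5 ≤ x ^ 5 := Nat.pow_le_pow_left hx 5
    have h2 : (x + 1) ^ 6 = x ^ 6 + 6 * x ^ 5 + 15 * x ^ 4 + 20 * x ^ 3 + 15 * x ^ 2 + 6 * x + 1 := by
      ring
    have : 0 < x ^ 4 := Nat.pow_pos (by omega)
    rw [h2]
    nlinarith
  refine Finset.card_le_card_of_injOn (fun w => w.1 ^ 6 - 1 + w.2) ?_ ?_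
  · rintro ⟨x, m⟩ hw
    simp only [Finset.coe_product, Set.mem_prod, Finset.mem_coe, Finset.mem_Ico,
      mem_sixthShiftsUpTo] at hw ⊢
    obtain ⟨⟨h1, h2⟩, h3, h4⟩ := hw
    have h5 := hgap x h1
    have h6 : (x + 1) ^ 6 ≤ (2 * P) ^ 6 := Nat.pow_le_pow_left h2 6
    have h7 : 0 < x ^ 6 := Nat.pow_pos (by omega)
    refine ⟨by omega, ?_⟩
    have := h4.add (IsRepr.pow (k := 6) (show 0 < x by omega))
    rwa [show x ^ 6 - 1 + m + (t + 1) = m + t + x ^ 6 by omega]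
  · rintro ⟨x, m⟩ hw ⟨x', m'⟩ hw' h
    simp only [Finset.coe_product, Set.mem_prod, Finset.mem_coe, Finset.mem_Ico,
      mem_sixthShiftsUpTo] at hw hw' h
    obtain ⟨⟨h1, h2⟩, h3, -⟩ := hw
    obtain ⟨⟨h1', h2'⟩, h3', -⟩ := hw'
    have h7 : 0 < x ^ 6 := Nat.pow_pos (by omega)
    have h7' : 0 < x' ^ 6 := Nat.pow_pos (by omega)
    have hxx : x = x' := by
      rcases lt_trichotomy x x' with hlt | heq | hlt
      · have h5 := hgap x h1
        have h6 : (x + 1) ^ 6 ≤ x' ^ 6 := Nat.pow_le_pow_left hlt 6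
        omega
      · exact heq
      · have h5 := hgap x' h1'
        have h6 : (x' + 1) ^ 6 ≤ x ^ 6 := Nat.pow_le_pow_left hlt 6
        omega
    subst hxx
    simp only [Prod.mk.injEq, true_and]
    omega

theorem rpow_le_card_sixthShiftsUpTo (t : ℕ) {X : ℕ} (hX : 1 ≤ X) :
    (X : ℝ) ^ (1 - (5 / 6 : ℝ) ^ t) ≤ 4 ^ (6 * t) * (sixthShiftsUpTo t X).card := by
  have hone : ∀ t X, 1 ≤ (sixthShiftsUpTo t X).card := fun t X =>
    Finset.card_pos.2 ⟨0, mem_sixthShiftsUpTo.2 ⟨Nat.zero_le _, by simpa using isRepr_ones t 6⟩⟩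
  induction t generalizing X with
  | zero => simpa using hone 0 X
  | succ t ih =>
    have hδ0 : (0 : ℝ) ≤ 1 - (5 / 6 : ℝ) ^ t := sub_nonneg.2 (pow_le_one₀ (by norm_num) (by norm_num))
    have hδ1 : 1 - (5 / 6 : ℝ) ^ t ≤ 1 := sub_le_self _ (by positivity)
    have hδ : 1 - (5 / 6 : ℝ) ^ (t + 1) = (1 + 5 * (1 - (5 / 6 : ℝ) ^ t)) / 6 := by
      rw [pow_succ]; ring
    rw [hδ]
    set δ : ℝ := 1 - (5 / 6 : ℝ) ^ t with hδd
    have hex : ∃ n, X < (2 * (n + 1)) ^ 6 := ⟨X, lt_of_lt_of_le (by omega : X < 2 * (X + 1))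
      (Nat.le_self_pow (by norm_num) _)⟩
    have hfind := Nat.find_spec hex
    rcases Nat.eq_zero_or_pos (Nat.find hex) with h0 | hpos
    · rw [h0] at hfind
      have hX64 : (X : ℝ) ≤ 64 := by exact_mod_cast (by omega : X ≤ 64)
      have h1 : (1 : ℝ) ≤ (sixthShiftsUpTo (t + 1) X).card := by exact_mod_cast hone _ _
      calc (X : ℝ) ^ ((1 + 5 * δ) / 6) ≤ (X : ℝ) ^ (1 : ℝ) :=
            Real.rpow_le_rpow_of_exponent_le (by exact_mod_cast hX) (by linarith)
        _ ≤ 4 ^ 6 * 1 := by rw [Real.rpow_one]; norm_num; linarith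
        _ ≤ _ := by
          gcongr
          · norm_num
          · omega
    · set P := Nat.find hex with hP
      have hlow : (2 * P) ^ 6 ≤ X := by
        have := Nat.find_min hex (m := P - 1) (by omega)
        rw [not_lt, Nat.sub_add_cancel hpos] at this
        exact this
      have hPR : (1 : ℝ) ≤ P := by exact_mod_cast hpos
      have hup : (X : ℝ) ≤ (4 * P) ^ 6 := by
        have : X ≤ (4 * P) ^ 6 := hfind.le.trans (Nat.pow_le_pow_left (by omega) 6)
        exact_mod_cast this
      have hrec : (P : ℝ) * (sixthShiftsUpTo t (P ^ 5)).card ≤ (sixthShiftsUpTo (t + 1) X).card := by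
        exact_mod_cast card_sixthShiftsUpTo_succ (t := t) hpos hlow
      have hih := ih (X := P ^ 5) (Nat.one_le_pow _ _ hpos)
      calc (X : ℝ) ^ ((1 + 5 * δ) / 6) ≤ (((4 * P) ^ 6 : ℝ)) ^ ((1 + 5 * δ) / 6) := by gcongr
        _ = (4 * P : ℝ) ^ (1 + 5 * δ) := by
          rw [← Real.rpow_natCast, ← Real.rpow_mul (by positivity)]
          congr 1; push_cast; ring
        _ = (4 : ℝ) ^ (1 + 5 * δ) * (P * ((P ^ 5 : ℕ) : ℝ) ^ δ) := by
          rw [Real.mul_rpow (by norm_num) (by positivity), Real.rpow_add (x := P) (by positivity),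
            Real.rpow_one, Real.rpow_mul (x := P) (by positivity), Nat.cast_pow,
            show (P : ℝ) ^ (5 : ℝ) = P ^ 5 by norm_cast]
        _ ≤ (4 : ℝ) ^ (6 : ℝ) * (P * (4 ^ (6 * t) * (sixthShiftsUpTo t (P ^ 5)).card)) := by
          gcongr
          · norm_num
          · linarith
        _ = 4 ^ (6 * (t + 1)) * (P * (sixthShiftsUpTo t (P ^ 5)).card) := by
          rw [show (4 : ℝ) ^ (6 : ℝ) = 4 ^ 6 by norm_cast]; ring
        _ ≤ _ := by gcongr

/-- Sums of eighteen sixth powers, restricted to a popular residue class modulo `36v`. -/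
theorem exists_finset_sums_eighteen {v z : ℕ} (hv : 0 < v) (hv2 : 6 * v ≤ 2 ^ 219) (hz : 0 < z) :
    ∃ (ρ : ℕ) (U : Finset ℕ), ρ < 36 * v ∧
      (∀ u ∈ U, u ≤ 1296 * v ^ 5 * z ^ 36 ∧ IsRepr (36 * v * u + ρ + 18) 18 6) ∧
      (1296 * v ^ 5 * z ^ 36 : ℝ) ≤ 2 ^ 289 * z ^ 2 * U.card := by
  set W : ℕ := 6 * v with hW
  set X : ℕ := (W * z ^ 6) ^ 6 with hX
  have hXT : X = 36 * v * (1296 * v ^ 5 * z ^ 36) := by rw [hX, hW]; ring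
  have hW0 : 0 < W := by omega
  have hX1 : 1 ≤ X := Nat.one_le_pow _ _ (by positivity)
  have hX1' : (1 : ℝ) ≤ X := by exact_mod_cast hX1
  have hcard := rpow_le_card_sixthShiftsUpTo 18 hX1
  have hlow : (X : ℝ) ≤ 2 ^ 73 * z ^ 2 * (4 ^ (6 * 18) * (sixthShiftsUpTo 18 X).card) := by
    have h1 : (X : ℝ) ^ (17 / 18 : ℝ) ≤ (X : ℝ) ^ (1 - (5 / 6 : ℝ) ^ 18) :=
      Real.rpow_le_rpow_of_exponent_le hX1' (by norm_num)
    have h2 : (X : ℝ) ^ (1 / 18 : ℝ) ≤ 2 ^ 73 * z ^ 2 := by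
      have : (X : ℝ) ≤ (2 ^ 73 * z ^ 2) ^ 18 := by
        have : X ≤ (2 ^ 73 * z ^ 2) ^ 18 := by
          calc X ≤ (2 ^ 219 * z ^ 6) ^ 6 := by rw [hX]; gcongr
            _ = _ := by ring
        exact_mod_cast this
      calc (X : ℝ) ^ (1 / 18 : ℝ) ≤ ((2 ^ 73 * z ^ 2 : ℝ) ^ 18) ^ (1 / 18 : ℝ) := by gcongr
        _ = _ := by
          rw [← Real.rpow_natCast, ← Real.rpow_mul (by positivity)]
          norm_num
    calc (X : ℝ) = (X : ℝ) ^ (1 / 18 : ℝ) * (X : ℝ) ^ (17 / 18 : ℝ) := by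
          rw [← Real.rpow_add (by positivity)]; norm_num
      _ ≤ _ := by gcongr; exact h1.trans hcard
  obtain ⟨ρ, hρ, hpop⟩ := Finset.exists_le_card_fiber_of_nsmul_le_card_of_maps_to
    (s := sixthShiftsUpTo 18 X) (t := Finset.range (36 * v)) (f := fun m => m % (36 * v))
    (fun m _ => Finset.mem_range.2 (Nat.mod_lt _ (by omega))) ⟨0, by simp; omega⟩
    (b := ((sixthShiftsUpTo 18 X).card : ℝ) / (36 * v)) (by
      rw [Finset.card_range, nsmul_eq_mul]
      push_cast
      exact le_of_eq (by field_simp))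
  refine ⟨ρ, ((sixthShiftsUpTo 18 X).filter fun m => m % (36 * v) = ρ).image fun m => m / (36 * v),
    Finset.mem_range.1 hρ, ?_, ?_⟩
  · intro u hu
    simp only [Finset.mem_image, Finset.mem_filter, mem_sixthShiftsUpTo] at hu
    obtain ⟨m, ⟨⟨h1, h2⟩, h3⟩, rfl⟩ := hu
    refine ⟨?_, ?_⟩
    · rw [hXT] at h1
      exact Nat.div_le_of_le_mul h1
    · rw [← h3, Nat.div_add_mod]
      exact h2
  · rw [Finset.card_image_of_injOn]
    · have hXR : (X : ℝ) = 36 * v * (1296 * v ^ 5 * z ^ 36) := by exact_mod_cast hXT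
      have hv' : (0 : ℝ) < 36 * v := by positivity
      rw [div_le_iff₀ hv'] at hpop
      refine le_of_mul_le_mul_left ?_ hv'
      rw [← hXR]
      have hlow' : (X : ℝ) ≤ 2 ^ 73 * 4 ^ (6 * 18) * (z ^ 2 * (sixthShiftsUpTo 18 X).card) :=
        hlow.trans_eq (by ring)
      refine hlow'.trans ?_
      have hK : (2 : ℝ) ^ 73 * 4 ^ (6 * 18) = 2 ^ 289 := by
        rw [show (4 : ℝ) = 2 ^ 2 by norm_num, ← pow_mul, ← pow_add]
      rw [← hK]
      have hK0 : (0 : ℝ) ≤ 2 ^ 73 * 4 ^ (6 * 18) := by positivity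
      generalize (2 : ℝ) ^ 73 * 4 ^ (6 * 18) = K at hK0 ⊢
      refine (le_of_eq (mul_assoc _ _ _).symm).trans ((mul_le_mul_of_nonneg_left hpop (by positivity : 0 ≤ K * (z : ℝ) ^ 2)).trans
        (le_of_eq ?_))
      ring_nf
    · intro m hm m' hm' h
      simp only [Finset.coe_filter, Set.mem_ofPred_eq] at hm hm' h
      rw [← Nat.div_add_mod m (36 * v), ← Nat.div_add_mod m' (36 * v), h, hm.2, hm'.2]

theorem card_pow_six_eq_le {p : ℕ} [Fact p.Prime] (c : ZMod p) :
    (Finset.univ.filter fun x : ZMod p => x ^ 6 = c).card ≤ 6 := by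
  classical
  calc (Finset.univ.filter fun x : ZMod p => x ^ 6 = c).card
      ≤ (Polynomial.nthRoots 6 c).toFinset.card :=
        Finset.card_le_card fun x hx => by
          simpa [Polynomial.mem_nthRoots] using hx
    _ ≤ Multiset.card (Polynomial.nthRoots 6 c) := Multiset.toFinset_card_le _
    _ ≤ 6 := Polynomial.card_nthRoots 6 c

open scoped Pointwise in
theorem exists_sum_pow_six_eq {p : ℕ} [Fact p.Prime] (n : ZMod p) :
    ∃ c : Fin 9 → ZMod p, ∑ i, c i ^ 6 = n := by
  classical
  have hp : p.Prime := Fact.out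
  set A : Finset (ZMod p) := Finset.univ.image fun x : ZMod p => x ^ 6 with hA
  have h0 : (0 : ZMod p) ∈ A := Finset.mem_image.2 ⟨0, by simp⟩
  have hcard : p ≤ 6 * (A.card - 1) + 1 := by
    have h1 : (Finset.univ.erase (0 : ZMod p)).card ≤ 6 * (A.erase 0).card := by
      refine Finset.card_le_mul_card_image_of_maps_to (f := fun x : ZMod p => x ^ 6) ?_ 6 ?_
      · intro x hx
        simp only [Finset.mem_erase, Finset.mem_univ, and_true] at hx
        exact Finset.mem_erase.2 ⟨pow_ne_zero 6 hx, Finset.mem_image_of_mem _ (Finset.mem_univ _)⟩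
      · intro b _
        exact (Finset.card_le_card (Finset.filter_subset_filter _ (Finset.subset_univ _))).trans
          (card_pow_six_eq_le b)
    rw [Finset.card_erase_of_mem (Finset.mem_univ _), Finset.card_erase_of_mem h0,
      Finset.card_univ, ZMod.card] at h1
    omega
  have key : ∀ k : ℕ, ∃ B : Finset (ZMod p), min p (k * (A.card - 1) + 1) ≤ B.card ∧
      ∀ x ∈ B, ∃ c : Fin k → ZMod p, ∑ i, c i ^ 6 = x := by
    intro k
    induction k with
    | zero => exact ⟨{0}, by simp, by simp⟩
    | succ k ih =>
      obtain ⟨B, hB, hB'⟩ := ih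
      refine ⟨A + B, ?_, ?_⟩
      · have hBne : B.Nonempty := by
          rw [← Finset.card_pos]; have := hp.pos; omega
        have := ZMod.cauchy_davenport hp ⟨0, h0⟩ hBne
        have hA1 : 0 < A.card := Finset.card_pos.2 ⟨0, h0⟩
        have e : (k + 1) * (A.card - 1) = k * (A.card - 1) + (A.card - 1) := by ring
        omega
      · intro x hx
        obtain ⟨a, ha, b, hb, rfl⟩ := Finset.mem_add.1 hx
        obtain ⟨y, -, rfl⟩ := Finset.mem_image.1 ha
        obtain ⟨c, rfl⟩ := hB' b hb
        exact ⟨Fin.cons y c, by simp [Fin.sum_univ_succ]⟩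
  obtain ⟨B, hB, hB'⟩ := key 9
  have : B = Finset.univ := by
    rw [← Finset.card_eq_iff_eq_univ, ZMod.card]
    have := Finset.card_le_univ B
    rw [ZMod.card] at this
    omega
  exact hB' n (by rw [this]; exact Finset.mem_univ n)

/-- Every residue class modulo `M` contains a sum of nine sixth powers. -/
def NineSixthPowersMod (M : ℕ) : Prop :=
  ∀ n : ℕ, ∃ c : Fin 9 → ℕ, ∑ i, c i ^ 6 ≡ n [MOD M]

theorem NineSixthPowersMod.mul {M N : ℕ} (hM : NineSixthPowersMod M) (hN : NineSixthPowersMod N)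
    (h : M.Coprime N) : NineSixthPowersMod (M * N) := by
  intro n
  obtain ⟨c, hc⟩ := hM n
  obtain ⟨d, hd⟩ := hN n
  have hsum : ∀ {f g : Fin 9 → ℕ} {K : ℕ}, (∀ i, f i ≡ g i [MOD K]) →
      ∑ i, f i ^ 6 ≡ ∑ i, g i ^ 6 [MOD K] := fun {f g K} hfg => by
    rw [← ZMod.natCast_eq_natCast_iff]
    push_cast
    exact Finset.sum_congr rfl fun i _ => by rw [(ZMod.natCast_eq_natCast_iff _ _ _).2 (hfg i)]
  refine ⟨fun i => Nat.chineseRemainder h (c i) (d i), ?_⟩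
  rw [← Nat.modEq_and_modEq_iff_modEq_mul h]
  exact ⟨(hsum fun i => (Nat.chineseRemainder h (c i) (d i)).2.1).trans hc,
    (hsum fun i => (Nat.chineseRemainder h (c i) (d i)).2.2).trans hd⟩

theorem nineSixthPowersMod_prime {p : ℕ} (hp : p.Prime) : NineSixthPowersMod p := by
  have := Fact.mk hp
  intro n
  obtain ⟨c, hc⟩ := exists_sum_pow_six_eq (n : ZMod p)
  exact ⟨fun i => (c i).val, by rw [← ZMod.natCast_eq_natCast_iff]; simpa using hc⟩

theorem nineSixthPowersMod_of_table {M w : ℕ} (hM : 0 < M)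
    (h : ∀ n < M, ∃ r < 9, ∃ x < M, (x ^ 6 + r * 1 + (8 - r) * w ^ 6) % M = n) :
    NineSixthPowersMod M := by
  intro n
  obtain ⟨r, hr, x, -, hx⟩ := h (n % M) (Nat.mod_lt _ hM)
  refine ⟨Fin.cons x fun j : Fin 8 => if (j : ℕ) < r then 1 else w, ?_⟩
  rw [Nat.ModEq, ← hx]
  congr 1
  rw [Fin.sum_univ_succ]
  simp only [Fin.cons_zero, Fin.cons_succ, Fin.sum_univ_eight]
  interval_cases r <;> simp <;> ring

theorem nineSixthPowersMod_sixteen : NineSixthPowersMod 16 :=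
  nineSixthPowersMod_of_table (w := 2) (by norm_num) (by decide +kernel)

theorem nineSixthPowersMod_eightyOne : NineSixthPowersMod 81 :=
  nineSixthPowersMod_of_table (w := 3) (by norm_num) (by decide +kernel)

def largePrimesProd : ℕ := ∏ p ∈ (Finset.range 167).filter (fun p => p.Prime ∧ 5 ≤ p), p

/-- The step `6 * V` of the progression `1 + 6 * V * y` carrying the main variables. -/
def V : ℕ := 36 * largePrimesProd

theorem V_le : V ≤ 2 ^ 215 := by decide +kernel

theorem V_pos : 0 < V := by
  rw [V, largePrimesProd]
  exact Nat.mul_pos (by norm_num) (Finset.prod_pos fun p hp => (Finset.mem_filter.1 hp).2.1.pos)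

theorem prime_dvd_V {p : ℕ} (hp : p.Prime) (h : p < 167) : p ∣ V := by
  by_cases h5 : 5 ≤ p
  · exact (Finset.dvd_prod_of_mem _
      (Finset.mem_filter.2 ⟨Finset.mem_range.2 h, hp, h5⟩)).mul_left 36
  · refine Dvd.dvd.mul_right ?_ largePrimesProd
    interval_cases p <;> first | (norm_num; done) | exact absurd hp (by norm_num)

theorem nineSixthPowersMod_V : NineSixthPowersMod (36 * V) := by
  have key : ∀ s : Finset ℕ, (∀ p ∈ s, p.Prime ∧ 5 ≤ p) →
      NineSixthPowersMod (16 * 81 * ∏ p ∈ s, p) := by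
    intro s
    induction s using Finset.induction_on with
    | empty =>
      intro _
      simpa using nineSixthPowersMod_sixteen.mul nineSixthPowersMod_eightyOne (by norm_num)
    | insert p s hps ih =>
      intro h
      obtain ⟨hp, hp5⟩ := h p (Finset.mem_insert_self _ _)
      have hs := fun q hq => h q (Finset.mem_insert_of_mem hq)
      rw [Finset.prod_insert hps, mul_left_comm]
      refine (nineSixthPowersMod_prime hp).mul (ih hs) ?_
      refine Nat.Coprime.mul_right ((Nat.Prime.coprime_iff_not_dvd hp).2 fun hd => ?_)
        (Nat.Coprime.prod_right fun q hq => (Nat.coprime_primes hp (hs q hq).1).2 ?_)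
      · have h6 : p ∣ 6 ^ 4 := by simpa using hd
        have := Nat.le_of_dvd (by norm_num) (hp.dvd_of_dvd_pow h6)
        interval_cases p <;> revert hp hd <;> norm_num
      · rintro rfl; exact hps hq
  have := key _ (fun p hp => (Finset.mem_filter.1 hp).2 :
    ∀ p ∈ (Finset.range 167).filter (fun p => p.Prime ∧ 5 ≤ p), p.Prime ∧ 5 ≤ p)
  rwa [← largePrimesProd, show 16 * 81 * largePrimesProd = 36 * V by rw [V]; ring] at this

/-- The additive character `x ↦ exp (2πix)`. -/
noncomputable def e (x : ℝ) : ℂ := Complex.exp (2 * Real.pi * x * Complex.I)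

theorem e_add (x y : ℝ) : e (x + y) = e x * e y := by
  rw [e, e, e, ← Complex.exp_add]; push_cast; ring_nf

theorem norm_e (x : ℝ) : ‖e x‖ = 1 := by
  rw [e, show (2 * Real.pi * x * Complex.I : ℂ) = ((2 * Real.pi * x : ℝ) : ℂ) * Complex.I by
    push_cast; ring, Complex.norm_exp_ofReal_mul_I]

theorem e_zero : e 0 = 1 := by simp [e]

theorem e_int (n : ℤ) : e n = 1 := by
  rw [e, Complex.exp_eq_one_iff]; exact ⟨n, by push_cast; ring⟩

theorem e_neg (x : ℝ) : e (-x) = starRingEnd ℂ (e x) := by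
  rw [e, e, ← Complex.exp_conj]; simp [Complex.conj_ofNat]

theorem e_natCast_mul (n : ℕ) (x : ℝ) : e (n * x) = e x ^ n := by
  rw [e, e, ← Complex.exp_nat_mul]; push_cast; ring_nf

theorem e_add_int (x : ℝ) (n : ℤ) : e (x + n) = e x := by rw [e_add, e_int, mul_one]

theorem norm_e_sub_one (x : ℝ) : ‖e x - 1‖ = 2 * |Real.sin (Real.pi * x)| := by
  have h := Complex.norm_exp_I_mul_ofReal_sub_one (2 * Real.pi * x)
  rw [show (Complex.I * ((2 * Real.pi * x : ℝ) : ℂ)) = 2 * Real.pi * x * Complex.I by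
    push_cast; ring] at h
  rw [e, h, Real.norm_eq_abs, abs_mul, abs_two]
  ring_nf

theorem norm_e_sub_one_le (x : ℝ) : ‖e x - 1‖ ≤ 2 * Real.pi * |x| := by
  rw [norm_e_sub_one]
  have := Real.abs_sin_le_abs (x := Real.pi * x)
  rw [abs_mul, abs_of_pos Real.pi_pos] at this
  linarith

/-- The distance to the nearest integer. -/
noncomputable def nd (x : ℝ) : ℝ := |x - round x|

theorem nd_nonneg (x : ℝ) : 0 ≤ nd x := abs_nonneg _

theorem nd_le_half (x : ℝ) : nd x ≤ 1 / 2 := abs_sub_round x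

theorem nd_neg (x : ℝ) : nd (-x) = nd x := by
  apply le_antisymm
  · have := round_le (-x) (-round x)
    rw [nd, nd]; push_cast at this
    rwa [← abs_neg (-x - -(round x : ℝ)), neg_sub, sub_neg_eq_add, add_comm, ← sub_eq_add_neg] at this
  · have := round_le x (-round (-x))
    rw [nd, nd]; push_cast at this
    rw [← abs_neg (-x - (round (-x) : ℝ)), neg_sub, sub_neg_eq_add, add_comm]
    rwa [sub_neg_eq_add] at this

theorem le_norm_e_sub_one (x : ℝ) : 4 * nd x ≤ ‖e x - 1‖ := by
  have h1 : ‖e x - 1‖ = ‖e (nd x) - 1‖ := by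
    have h : ‖e x - 1‖ = ‖e (x - round x) - 1‖ := by
      conv_lhs => rw [show x = (x - round x) + round x by ring, e_add_int]
    rw [h, norm_e_sub_one, norm_e_sub_one, nd]
    rcases abs_choice (x - round x) with h | h <;> rw [h]
    rw [mul_neg, Real.sin_neg, abs_neg]
  rw [h1, norm_e_sub_one]
  have h0 := nd_nonneg x
  have h2 := nd_le_half x
  have hpi := Real.pi_pos
  have := Real.mul_le_sin (x := Real.pi * nd x) (by positivity) (by nlinarith)
  rw [show 2 / Real.pi * (Real.pi * nd x) = 2 * nd x by field_simp] at this
  linarith [le_abs_self (Real.sin (Real.pi * nd x))]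

/-- `min Y (1 / (2 * nd x))`, read as `Y` when `nd x = 0`. -/
noncomputable def geomBound (Y : ℕ) (x : ℝ) : ℝ := Y / max 1 (2 * Y * nd x)

theorem geomBound_nonneg (Y : ℕ) (x : ℝ) : 0 ≤ geomBound Y x := by
  rw [geomBound]; positivity

theorem geomBound_le (Y : ℕ) (x : ℝ) : geomBound Y x ≤ Y :=
  div_le_self (Nat.cast_nonneg _) (le_max_left _ _)

theorem geomBound_neg (Y : ℕ) (x : ℝ) : geomBound Y (-x) = geomBound Y x := by
  rw [geomBound, geomBound, nd_neg]

theorem geomBound_le_of_le {Y : ℕ} {x δ : ℝ} (hδ : 0 < δ) (h : δ ≤ nd x) :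
    geomBound Y x ≤ 1 / (2 * δ) := by
  rw [geomBound, div_le_div_iff₀ (by positivity) (by positivity)]
  have : 2 * Y * nd x ≤ max 1 (2 * Y * nd x) := le_max_right _ _
  have h2 : (Y : ℝ) * (2 * δ) ≤ 2 * Y * nd x := by
    have : (Y : ℝ) * δ ≤ Y * nd x := mul_le_mul_of_nonneg_left h (Nat.cast_nonneg _)
    linarith
  linarith

theorem norm_sum_range_e_le {Y N : ℕ} (hN : N ≤ Y) (a x : ℝ) :
    ‖∑ i ∈ Finset.range N, e (a + i * x)‖ ≤ geomBound Y x := by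
  rcases Nat.eq_zero_or_pos Y with rfl | hY
  · obtain rfl : N = 0 := by omega
    simp [geomBound]
  have h1 : ‖∑ i ∈ Finset.range N, e (a + i * x)‖ ≤ Y := by
    refine (norm_sum_le _ _).trans ?_
    simp only [norm_e, Finset.sum_const, Finset.card_range, nsmul_eq_mul, mul_one]
    exact_mod_cast hN
  rw [geomBound, le_div_iff₀ (by positivity)]
  rcases max_choice (1 : ℝ) (2 * Y * nd x) with h | h <;> rw [h]
  · simpa using h1
  · have h2 : (∑ i ∈ Finset.range N, e (a + i * x)) * (e x - 1) = e a * (e (N * x) - 1) := by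
      rw [e_natCast_mul, ← geom_sum_mul, ← mul_assoc, Finset.mul_sum]
      congr 1
      exact Finset.sum_congr rfl fun i _ => by rw [e_add, e_natCast_mul]
    have h3 : ‖∑ i ∈ Finset.range N, e (a + i * x)‖ * ‖e x - 1‖ ≤ 2 := by
      rw [← norm_mul, h2, norm_mul, norm_e, one_mul]
      refine (norm_sub_le _ _).trans ?_
      rw [norm_e, norm_one]; norm_num
    have h4 := mul_le_mul_of_nonneg_left (le_norm_e_sub_one x)
      (norm_nonneg (∑ i ∈ Finset.range N, e (a + i * x)))
    have hY' : (0 : ℝ) < Y := by exact_mod_cast hY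
    nlinarith

/-- `φ` behaves like a polynomial of degree at most `k + 1` whose `(k + 1)`-st difference is `c`. -/
def HasDifference : ℕ → (ℤ → ℝ) → ℝ → Prop
  | 0, φ, c => ∀ x, φ (x + 1) - φ x = c
  | k + 1, φ, c => ∀ h : ℤ, HasDifference k (fun x => φ (x + h) - φ x) (c * h)

/-- The iterated sum that bounds an exponential sum after `k` Weyl differencing steps. -/
noncomputable def weylSum (Y : ℕ) : ℕ → ℝ → ℝ
  | 0, c => geomBound Y c
  | k + 1, c => ∑ h ∈ Finset.Ioo (-Y : ℤ) Y, weylSum Y k (c * h)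

theorem normSq_sum_Ico_e_le {Y : ℕ} {a b : ℤ} (hab : b - a ≤ Y) (φ : ℤ → ℝ) :
    ‖∑ x ∈ Finset.Ico a b, e (φ x)‖ ^ 2 ≤ ∑ h ∈ Finset.Ioo (-Y : ℤ) Y,
      ‖∑ x ∈ Finset.Ico (max a (a - h)) (min b (b - h)), e (φ (x + h) - φ x)‖ := by
  have h1 : ((‖∑ x ∈ Finset.Ico a b, e (φ x)‖ ^ 2 : ℝ) : ℂ) = ∑ h ∈ Finset.Ioo (-Y : ℤ) Y,
      ∑ x ∈ Finset.Ico (max a (a - h)) (min b (b - h)), e (φ (x + h) - φ x) := by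
    push_cast
    rw [← Complex.mul_conj', map_sum, Finset.sum_mul_sum, ← Finset.sum_product',
      Finset.sum_sigma']
    refine Finset.sum_bij' (fun p _ => ⟨p.1 - p.2, p.2⟩) (fun p _ => (p.2 + p.1, p.2)) ?_ ?_ ?_ ?_ ?_
    · intro p hp
      simp only [Finset.mem_product, Finset.mem_Ico, Finset.mem_sigma, Finset.mem_Ioo] at hp ⊢
      omega
    · intro p hp
      simp only [Finset.mem_product, Finset.mem_Ico, Finset.mem_sigma, Finset.mem_Ioo] at hp ⊢
      omega
    · intro p _; simp
    · intro p _; simp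
    · intro p _
      simp only
      rw [sub_eq_add_neg (φ _), e_add, e_neg, add_sub_cancel]
  have h2 : ‖∑ x ∈ Finset.Ico a b, e (φ x)‖ ^ 2 =
      ‖((‖∑ x ∈ Finset.Ico a b, e (φ x)‖ ^ 2 : ℝ) : ℂ)‖ := by
    rw [Complex.norm_real, Real.norm_of_nonneg (by positivity)]
  rw [h2, h1]
  exact norm_sum_le _ _

theorem weyl_inequality {Y : ℕ} (hY : 0 < Y) (k : ℕ) {a b : ℤ} (hab : b - a ≤ Y) {φ : ℤ → ℝ} {c : ℝ}
    (hφ : HasDifference k φ c) :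
    ‖∑ x ∈ Finset.Ico a b, e (φ x)‖ ^ 2 ^ k ≤ (2 * Y) ^ (2 ^ k - (k + 1)) * weylSum Y k c := by
  induction k generalizing a b φ c with
  | zero =>
    rcases le_or_gt b a with h | h
    · simp [Finset.Ico_eq_empty_of_le h, weylSum, geomBound_nonneg]
    · have hlin : ∀ i : ℕ, φ (a + i) = φ a + i * c := by
        intro i
        induction i with
        | zero => simp
        | succ i ih =>
          have := hφ (a + i)
          push_cast
          rw [← add_assoc, eq_add_of_sub_eq this, ih]; ring
      have hsum : ∑ x ∈ Finset.Ico a b, e (φ x) =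
          ∑ i ∈ Finset.range (b - a).toNat, e (φ a + i * c) := by
        refine (Finset.sum_bij (fun (i : ℕ) _ => a + i) ?_ ?_ ?_ ?_).symm
        · intro i hi; simp only [Finset.mem_range, Finset.mem_Ico] at *; omega
        · intro i _ j _ h; simpa using h
        · intro x hx
          simp only [Finset.mem_Ico] at hx
          exact ⟨(x - a).toNat, by simp only [Finset.mem_range]; omega, by omega⟩
        · intro i _; rw [hlin]
      simp only [pow_zero, pow_one, zero_add, Nat.sub_self, one_mul, weylSum]
      rw [hsum]
      exact norm_sum_range_e_le (by omega) _ _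
  | succ k ih =>
    have hexp : ∀ k : ℕ, k + 1 ≤ 2 ^ k := fun k => Nat.lt_two_pow_self
    obtain ⟨n, hn⟩ : ∃ n, 2 ^ k = n + 1 := ⟨2 ^ k - 1, by have := hexp k; omega⟩
    set S := fun h : ℤ => ‖∑ x ∈ Finset.Ico (max a (a - h)) (min b (b - h)), e (φ (x + h) - φ x)‖
    have hcard : ((Finset.Ioo (-Y : ℤ) Y).card : ℝ) ≤ 2 * Y := by
      rw [Int.card_Ioo]
      have : ((Y : ℤ) - -Y - 1).toNat ≤ 2 * Y := by omega
      exact_mod_cast this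
    have hpos : 0 < ((Finset.Ioo (-Y : ℤ) Y).card : ℝ) := by
      rw [Int.card_Ioo]
      have : 0 < ((Y : ℤ) - -Y - 1).toNat := by omega
      exact_mod_cast this
    have hJ := pow_sum_div_card_le_sum_pow (s := Finset.Ioo (-Y : ℤ) Y) (f := S)
      (fun i _ => norm_nonneg _) n
    rw [div_le_iff₀ (by positivity), ← hn] at hJ
    have hS : ∀ h : ℤ, S h ^ 2 ^ k ≤ (2 * Y) ^ (2 ^ k - (k + 1)) * weylSum Y k (c * h) :=
      fun h => ih (by omega) (hφ h)
    calc ‖∑ x ∈ Finset.Ico a b, e (φ x)‖ ^ 2 ^ (k + 1)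
        = (‖∑ x ∈ Finset.Ico a b, e (φ x)‖ ^ 2) ^ 2 ^ k := by rw [← pow_mul, pow_succ']
      _ ≤ (∑ h ∈ Finset.Ioo (-Y : ℤ) Y, S h) ^ 2 ^ k := by
          gcongr; exact normSq_sum_Ico_e_le hab φ
      _ ≤ (∑ h ∈ Finset.Ioo (-Y : ℤ) Y, S h ^ 2 ^ k) * ((Finset.Ioo (-Y : ℤ) Y).card : ℝ) ^ n := hJ
      _ ≤ (∑ h ∈ Finset.Ioo (-Y : ℤ) Y, (2 * Y) ^ (2 ^ k - (k + 1)) * weylSum Y k (c * h)) *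
            (2 * Y) ^ n := by
          gcongr with h
          · exact Finset.sum_nonneg fun h _ => (pow_nonneg (norm_nonneg _) _).trans (hS h)
          · exact hS h
      _ = (2 * Y) ^ (2 ^ (k + 1) - (k + 1 + 1)) * weylSum Y (k + 1) c := by
          rw [← Finset.mul_sum, weylSum, mul_right_comm, ← pow_add]
          congr 2
          have := hexp k
          rw [pow_succ]; omega

theorem HasDifference.congr {k : ℕ} {φ ψ : ℤ → ℝ} {c d : ℝ} (hφ : HasDifference k φ c)
    (h : ∀ x, ψ x = φ x) (hcd : d = c) : HasDifference k ψ d := by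
  rwa [hcd, funext h]

theorem hasDifference_linear (c₀ c₁ : ℝ) : HasDifference 0 (fun x => c₀ + c₁ * x) c₁ := by
  intro x; push_cast; ring

theorem hasDifference_quadratic (c₀ c₁ c₂ : ℝ) :
    HasDifference 1 (fun x => c₀ + c₁ * x + c₂ * x ^ 2) (2 * c₂) := by
  intro h
  refine HasDifference.congr (hasDifference_linear (c₁ * h + c₂ * h ^ 2) (2 * c₂ * h)) (fun x => by push_cast; ring) rfl

theorem hasDifference_cubic (c₀ c₁ c₂ c₃ : ℝ) :
    HasDifference 2 (fun x => c₀ + c₁ * x + c₂ * x ^ 2 + c₃ * x ^ 3) (6 * c₃) := by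
  intro h
  refine HasDifference.congr (hasDifference_quadratic (c₁ * h + c₂ * h ^ 2 + c₃ * h ^ 3) (2 * c₂ * h + 3 * c₃ * h ^ 2)
    (3 * c₃ * h)) (fun x => by push_cast; ring) (by ring)

theorem hasDifference_quartic (c₀ c₁ c₂ c₃ c₄ : ℝ) :
    HasDifference 3 (fun x => c₀ + c₁ * x + c₂ * x ^ 2 + c₃ * x ^ 3 + c₄ * x ^ 4) (24 * c₄) := by
  intro h
  refine HasDifference.congr (hasDifference_cubic (c₁ * h + c₂ * h ^ 2 + c₃ * h ^ 3 + c₄ * h ^ 4)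
    (2 * c₂ * h + 3 * c₃ * h ^ 2 + 4 * c₄ * h ^ 3) (3 * c₃ * h + 6 * c₄ * h ^ 2)
    (4 * c₄ * h)) (fun x => by push_cast; ring) (by ring)

theorem hasDifference_quintic (c₀ c₁ c₂ c₃ c₄ c₅ : ℝ) :
    HasDifference 4 (fun x => c₀ + c₁ * x + c₂ * x ^ 2 + c₃ * x ^ 3 + c₄ * x ^ 4 + c₅ * x ^ 5)
      (120 * c₅) := by
  intro h
  refine HasDifference.congr (hasDifference_quartic (c₁ * h + c₂ * h ^ 2 + c₃ * h ^ 3 + c₄ * h ^ 4 + c₅ * h ^ 5)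
    (2 * c₂ * h + 3 * c₃ * h ^ 2 + 4 * c₄ * h ^ 3 + 5 * c₅ * h ^ 4)
    (3 * c₃ * h + 6 * c₄ * h ^ 2 + 10 * c₅ * h ^ 3)
    (4 * c₄ * h + 10 * c₅ * h ^ 2) (5 * c₅ * h)) (fun x => by push_cast; ring) (by ring)

theorem hasDifference_sextic (c₀ c₁ c₂ c₃ c₄ c₅ c₆ : ℝ) :
    HasDifference 5 (fun x => c₀ + c₁ * x + c₂ * x ^ 2 + c₃ * x ^ 3 + c₄ * x ^ 4 + c₅ * x ^ 5 +
      c₆ * x ^ 6) (720 * c₆) := by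
  intro h
  refine HasDifference.congr (hasDifference_quintic
    (c₁ * h + c₂ * h ^ 2 + c₃ * h ^ 3 + c₄ * h ^ 4 + c₅ * h ^ 5 + c₆ * h ^ 6)
    (2 * c₂ * h + 3 * c₃ * h ^ 2 + 4 * c₄ * h ^ 3 + 5 * c₅ * h ^ 4 + 6 * c₆ * h ^ 5)
    (3 * c₃ * h + 6 * c₄ * h ^ 2 + 10 * c₅ * h ^ 3 + 15 * c₆ * h ^ 4)
    (4 * c₄ * h + 10 * c₅ * h ^ 2 + 20 * c₆ * h ^ 3) (5 * c₅ * h + 15 * c₆ * h ^ 2)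
    (6 * c₆ * h)) (fun x => by push_cast; ring) (by ring)

/-- `tau k n` is the number of ways to write `n` as an ordered product of `k` factors. -/
def tau : ℕ → ℕ → ℕ
  | 0, n => if n = 1 then 1 else 0
  | k + 1, n => ∑ d ∈ n.divisors, tau k d

theorem tau_one (k : ℕ) : tau k 1 = 1 := by
  induction k with
  | zero => rfl
  | succ k ih => simp [tau, ih]

theorem tau_mul_le (k : ℕ) (a b : ℕ) : tau k (a * b) ≤ tau k a * tau k b := by
  induction k generalizing a b with
  | zero =>
    simp only [tau]
    by_cases h : a * b = 1
    · obtain ⟨rfl, rfl⟩ := mul_eq_one.1 h; simp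
    · simp [h]
  | succ k ih =>
    rcases eq_or_ne (a * b) 0 with h | h
    · simp [h, tau]
    have ha : a ≠ 0 := left_ne_zero_of_mul h
    have hb : b ≠ 0 := right_ne_zero_of_mul h
    have hsub : (a * b).divisors ⊆ (a.divisors ×ˢ b.divisors).image fun p => p.1 * p.2 := by
      intro d hd
      obtain ⟨x, y, hx, hy, rfl⟩ := exists_dvd_and_dvd_of_dvd_mul (Nat.dvd_of_mem_divisors hd)
      exact Finset.mem_image.2 ⟨(x, y), by simp [hx, hy, ha, hb], rfl⟩
    simp only [tau]
    calc ∑ d ∈ (a * b).divisors, tau k d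
        ≤ ∑ d ∈ (a.divisors ×ˢ b.divisors).image fun p => p.1 * p.2, tau k d :=
          Finset.sum_le_sum_of_subset hsub
      _ ≤ ∑ p ∈ a.divisors ×ˢ b.divisors, tau k (p.1 * p.2) :=
          Finset.sum_image_le_of_nonneg fun _ _ => Nat.zero_le _
      _ ≤ ∑ p ∈ a.divisors ×ˢ b.divisors, tau k p.1 * tau k p.2 :=
          Finset.sum_le_sum fun p _ => ih _ _
      _ = _ := by rw [Finset.sum_mul_sum, Finset.sum_product]

theorem sum_sum_divisors (F : ℕ → ℕ → ℝ) (H : ℕ) :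
    ∑ n ∈ Finset.Icc 1 H, ∑ d ∈ n.divisors, F d n =
      ∑ d ∈ Finset.Icc 1 H, ∑ m ∈ Finset.Icc 1 (H / d), F d (d * m) := by
  rw [Finset.sum_sigma', Finset.sum_sigma']
  refine Finset.sum_bij' (fun p _ => ⟨p.2, p.1 / p.2⟩) (fun p _ => ⟨p.1 * p.2, p.1⟩) ?_ ?_ ?_ ?_ ?_
  · rintro ⟨n, d⟩ hp
    simp only [Finset.mem_sigma, Finset.mem_Icc, Nat.mem_divisors] at hp ⊢
    obtain ⟨⟨h1, h2⟩, h3, h4⟩ := hp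
    have h5 := Nat.le_of_dvd (by omega) h3
    have h6 : 0 < d := Nat.pos_of_dvd_of_pos h3 h1
    exact ⟨⟨h6, h5.trans h2⟩, Nat.div_pos h5 h6, Nat.div_le_div_right h2⟩
  · rintro ⟨d, m⟩ hp
    simp only [Finset.mem_sigma, Finset.mem_Icc, Nat.mem_divisors] at hp ⊢
    obtain ⟨⟨h1, h2⟩, h3, h4⟩ := hp
    have h5 : 0 < d * m := Nat.mul_pos h1 h3
    exact ⟨⟨h5, by rw [mul_comm]; exact (Nat.le_div_iff_mul_le h1).1 h4⟩, dvd_mul_right _ _, h5.ne'⟩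
  · rintro ⟨n, d⟩ hp
    simp only [Finset.mem_sigma, Nat.mem_divisors] at hp
    simp [Nat.mul_div_cancel' hp.2.1]
  · rintro ⟨d, m⟩ hp
    simp only [Finset.mem_sigma, Finset.mem_Icc] at hp
    simp [Nat.mul_div_cancel_left _ hp.1.1]
  · rintro ⟨n, d⟩ hp
    simp only [Finset.mem_sigma, Nat.mem_divisors] at hp
    simp [Nat.mul_div_cancel' hp.2.1]

theorem sum_inv_le {H N : ℕ} (hN : H ≤ N) :
    ∑ n ∈ Finset.Icc 1 H, (1 / n : ℝ) ≤ 1 + Real.log N := by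
  have h := harmonic_le_one_add_log H
  rw [harmonic_eq_sum_Icc] at h
  push_cast at h
  simp only [one_div]
  refine h.trans ?_
  gcongr 1 + ?_
  rcases Nat.eq_zero_or_pos H with rfl | hH
  · simpa using Real.log_natCast_nonneg N
  · exact Real.log_le_log (by exact_mod_cast hH) (by exact_mod_cast hN)

theorem sum_tau_div_le (k : ℕ) {H N : ℕ} (hN : H ≤ N) :
    ∑ n ∈ Finset.Icc 1 H, (tau k n / n : ℝ) ≤ (1 + Real.log N) ^ k := by
  have hL : 0 ≤ 1 + Real.log N := by have := Real.log_natCast_nonneg N; linarith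
  induction k with
  | zero =>
    refine (Finset.sum_le_sum (g := fun n => if n = 1 then (1 : ℝ) else 0) fun n _ => ?_).trans ?_
    · rw [tau]; split_ifs with h <;> simp [h]
    · rw [Finset.sum_ite_eq']; split_ifs <;> simp
  | succ k ih =>
    calc ∑ n ∈ Finset.Icc 1 H, (tau (k + 1) n / n : ℝ)
        = ∑ n ∈ Finset.Icc 1 H, ∑ d ∈ n.divisors, (tau k d / n : ℝ) :=
          Finset.sum_congr rfl fun n _ => by rw [tau]; push_cast; rw [Finset.sum_div]
      _ = ∑ d ∈ Finset.Icc 1 H, ∑ m ∈ Finset.Icc 1 (H / d), (tau k d / (d * m : ℕ) : ℝ) :=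
          sum_sum_divisors (fun d n => (tau k d / n : ℝ)) H
      _ = ∑ d ∈ Finset.Icc 1 H, (tau k d / d : ℝ) * ∑ m ∈ Finset.Icc 1 (H / d), (1 / m : ℝ) := by
          refine Finset.sum_congr rfl fun d _ => ?_
          rw [Finset.mul_sum]
          refine Finset.sum_congr rfl fun m _ => ?_
          push_cast; rw [div_mul_div_comm, mul_one]
      _ ≤ ∑ d ∈ Finset.Icc 1 H, (tau k d / d : ℝ) * (1 + Real.log N) := by
          gcongr with d
          exact sum_inv_le ((Nat.div_le_self _ _).trans hN)
      _ ≤ (1 + Real.log N) ^ k * (1 + Real.log N) := by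
          rw [← Finset.sum_mul]; gcongr
      _ = _ := (pow_succ _ _).symm

theorem sum_tau_mul_tau_le (j k : ℕ) {H N : ℕ} (hN : H ≤ N) :
    ∑ n ∈ Finset.Icc 1 H, (tau k n * tau j n : ℝ) ≤ H * (1 + Real.log N) ^ (k * j) := by
  have hL : 0 ≤ 1 + Real.log N := by have := Real.log_natCast_nonneg N; linarith
  induction j generalizing H with
  | zero =>
    rcases Nat.eq_zero_or_pos H with rfl | hH
    · simp
    refine (Finset.sum_le_sum (g := fun n => if n = 1 then (1 : ℝ) else 0) fun n _ => ?_).trans ?_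
    · rw [tau.eq_1]; split_ifs with h <;> simp [h, tau_one]
    · have : (1 : ℝ) ≤ H := by exact_mod_cast hH
      rw [Finset.sum_ite_eq']; split_ifs <;> simp [this]
  | succ j ih =>
    calc ∑ n ∈ Finset.Icc 1 H, (tau k n * tau (j + 1) n : ℝ)
        = ∑ n ∈ Finset.Icc 1 H, ∑ d ∈ n.divisors, (tau k n * tau j d : ℝ) :=
          Finset.sum_congr rfl fun n _ => by rw [tau.eq_2]; push_cast; rw [Finset.mul_sum]
      _ = ∑ n ∈ Finset.Icc 1 H, ∑ d ∈ n.divisors, (tau k n * tau j (n / d) : ℝ) :=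
          Finset.sum_congr rfl fun n _ => 
            (Nat.sum_div_divisors n fun d => (tau k n * tau j d : ℝ)).symm
      _ = ∑ d ∈ Finset.Icc 1 H, ∑ m ∈ Finset.Icc 1 (H / d),
            (tau k (d * m) * tau j (d * m / d) : ℝ) :=
          sum_sum_divisors (fun d n => (tau k n * tau j (n / d) : ℝ)) H
      _ ≤ ∑ d ∈ Finset.Icc 1 H, (tau k d : ℝ) *
            ∑ m ∈ Finset.Icc 1 (H / d), (tau k m * tau j m : ℝ) := by
          refine Finset.sum_le_sum fun d hd => ?_
          rw [Finset.mul_sum]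
          refine Finset.sum_le_sum fun m _ => ?_
          rw [Nat.mul_div_cancel_left _ (Finset.mem_Icc.1 hd).1, ← mul_assoc]
          gcongr
          exact_mod_cast tau_mul_le k d m
      _ ≤ ∑ d ∈ Finset.Icc 1 H, (tau k d : ℝ) * (H / d * (1 + Real.log N) ^ (k * j)) := by
          gcongr with d
          refine (ih ((Nat.div_le_self _ _).trans hN)).trans ?_
          gcongr
          exact Nat.cast_div_le
      _ = (∑ d ∈ Finset.Icc 1 H, (tau k d / d : ℝ)) * (H * (1 + Real.log N) ^ (k * j)) := by
          rw [Finset.sum_mul]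
          exact Finset.sum_congr rfl fun d _ => by ring
      _ ≤ (1 + Real.log N) ^ k * (H * (1 + Real.log N) ^ (k * j)) := by
          gcongr; exact sum_tau_div_le k hN
      _ = _ := by rw [mul_add, mul_one, pow_add]; ring

theorem weylSum_nonneg (Y k : ℕ) (c : ℝ) : 0 ≤ weylSum Y k c := by
  induction k generalizing c with
  | zero => exact geomBound_nonneg Y c
  | succ k ih => exact Finset.sum_nonneg fun h _ => ih _

theorem weylSum_neg (Y k : ℕ) (c : ℝ) : weylSum Y k (-c) = weylSum Y k c := by
  induction k generalizing c with
  | zero => exact geomBound_neg Y c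
  | succ k ih => exact Finset.sum_congr rfl fun h _ => by rw [neg_mul, ih]

theorem weylSum_le_trivial (Y k : ℕ) (c : ℝ) : weylSum Y k c ≤ 2 ^ k * Y ^ (k + 1) := by
  induction k generalizing c with
  | zero => simpa [weylSum] using geomBound_le Y c
  | succ k ih =>
    refine (Finset.sum_le_sum fun h _ => ih _).trans ?_
    rw [Finset.sum_const, nsmul_eq_mul, Int.card_Ioo]
    have : (((Y : ℤ) - -Y - 1).toNat : ℝ) ≤ 2 * Y := by
      have : ((Y : ℤ) - -Y - 1).toNat ≤ 2 * Y := by omega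
      exact_mod_cast this
    calc _ ≤ (2 * Y : ℝ) * (2 ^ k * Y ^ (k + 1)) := by gcongr
      _ = _ := by ring

theorem weylSum_succ_le (Y k : ℕ) (c : ℝ) : weylSum Y (k + 1) c ≤
    2 ^ k * Y ^ (k + 1) + 2 * ∑ h ∈ Finset.Icc 1 Y, weylSum Y k (c * h) := by
  have hsub : Finset.Ioo (-Y : ℤ) Y ⊆ insert 0 ((Finset.Icc 1 Y).image (fun h : ℕ => (h : ℤ)) ∪
      (Finset.Icc 1 Y).image (fun h : ℕ => -(h : ℤ))) := by
    intro h hh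
    simp only [Finset.mem_Ioo, Finset.mem_insert, Finset.mem_union, Finset.mem_image,
      Finset.mem_Icc] at hh ⊢
    rcases lt_trichotomy h 0 with h0 | h0 | h0
    · exact .inr (.inr ⟨h.natAbs, by omega, by omega⟩)
    · exact .inl h0
    · exact .inr (.inl ⟨h.natAbs, by omega, by omega⟩)
  have hnn : ∀ h : ℤ, 0 ≤ weylSum Y k (c * h) := fun h => weylSum_nonneg _ _ _
  rw [weylSum]
  refine (Finset.sum_le_sum_of_subset_of_nonneg hsub fun h _ _ => hnn h).trans ?_
  rw [Finset.sum_insert (by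
    simp only [Finset.mem_union, Finset.mem_image, Finset.mem_Icc]; rintro (⟨h, h1, h2⟩ | ⟨h, h1, h2⟩) <;> omega)]
  refine add_le_add (weylSum_le_trivial _ _ _) ?_
  rw [Finset.sum_union, Finset.sum_image (by simp), Finset.sum_image (by simp), two_mul]
  · refine add_le_add (le_of_eq (by push_cast; rfl)) (le_of_eq (Finset.sum_congr rfl fun h _ => ?_))
    push_cast; rw [mul_neg, weylSum_neg]
  · rw [Finset.disjoint_left]
    simp only [Finset.mem_image, Finset.mem_Icc]
    rintro _ ⟨h, h1, rfl⟩ ⟨h', h2, h3⟩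
    omega

theorem weylSum_le (Y k : ℕ) (c : ℝ) : weylSum Y k c ≤
    k * 2 ^ k * Y ^ k + 2 ^ k * ∑ n ∈ Finset.Icc 1 (Y ^ k), tau k n * geomBound Y (c * n) := by
  induction k generalizing c with
  | zero => simp [weylSum, tau]
  | succ k ih =>
    have hY : ∑ h ∈ Finset.Icc 1 Y, ∑ n ∈ Finset.Icc 1 (Y ^ k), tau k n * geomBound Y (c * h * n) ≤
        ∑ n ∈ Finset.Icc 1 (Y ^ (k + 1)), tau (k + 1) n * geomBound Y (c * n) := by
      calc _ = ∑ n ∈ Finset.Icc 1 (Y ^ k), ∑ h ∈ Finset.Icc 1 Y,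
              tau k n * geomBound Y (c * (n * h : ℕ)) := by
            rw [Finset.sum_comm]
            refine Finset.sum_congr rfl fun n _ => Finset.sum_congr rfl fun h _ => ?_
            push_cast; ring_nf
        _ ≤ ∑ n ∈ Finset.Icc 1 (Y ^ k), ∑ h ∈ Finset.Icc 1 (Y ^ (k + 1) / n),
              tau k n * geomBound Y (c * (n * h : ℕ)) := by
            refine Finset.sum_le_sum fun n hn => Finset.sum_le_sum_of_subset_of_nonneg
              (Finset.Icc_subset_Icc_right ?_)
              fun h _ _ => mul_nonneg (Nat.cast_nonneg _) (geomBound_nonneg _ _)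
            rw [Finset.mem_Icc] at hn
            rw [Nat.le_div_iff_mul_le hn.1, pow_succ']
            exact Nat.mul_le_mul_left _ hn.2
        _ ≤ ∑ n ∈ Finset.Icc 1 (Y ^ (k + 1)), ∑ h ∈ Finset.Icc 1 (Y ^ (k + 1) / n),
              tau k n * geomBound Y (c * (n * h : ℕ)) := by
            rcases Nat.eq_zero_or_pos Y with rfl | hY0
            · rcases k with _ | k <;> simp
            refine Finset.sum_le_sum_of_subset_of_nonneg (Finset.Icc_subset_Icc_right ?_)
              fun n _ _ => Finset.sum_nonneg fun h _ =>
                mul_nonneg (Nat.cast_nonneg _) (geomBound_nonneg _ _)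
            exact Nat.pow_le_pow_right hY0 (by omega)
        _ = ∑ n ∈ Finset.Icc 1 (Y ^ (k + 1)), ∑ d ∈ n.divisors, tau k d * geomBound Y (c * n) :=
            (sum_sum_divisors (fun d n => tau k d * geomBound Y (c * n)) _).symm
        _ = _ := Finset.sum_congr rfl fun n _ => by rw [tau.eq_2]; push_cast; rw [Finset.sum_mul]
    calc weylSum Y (k + 1) c
        ≤ 2 ^ k * Y ^ (k + 1) + 2 * ∑ h ∈ Finset.Icc 1 Y, weylSum Y k (c * h) :=
          weylSum_succ_le Y k c
      _ ≤ 2 ^ k * Y ^ (k + 1) + 2 * ∑ h ∈ Finset.Icc 1 Y, (k * 2 ^ k * Y ^ k +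
            2 ^ k * ∑ n ∈ Finset.Icc 1 (Y ^ k), tau k n * geomBound Y (c * h * n)) := by
          gcongr with h; exact ih _
      _ = 2 ^ k * Y ^ (k + 1) + k * 2 ^ (k + 1) * Y ^ (k + 1) + 2 ^ (k + 1) *
            ∑ h ∈ Finset.Icc 1 Y, ∑ n ∈ Finset.Icc 1 (Y ^ k), tau k n * geomBound Y (c * h * n) := by
          rw [Finset.sum_add_distrib, Finset.sum_const, Nat.card_Icc, nsmul_eq_mul,
            Nat.add_sub_cancel, ← Finset.mul_sum]
          ring
      _ ≤ 2 ^ (k + 1) * Y ^ (k + 1) + k * 2 ^ (k + 1) * Y ^ (k + 1) + 2 ^ (k + 1) *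
            ∑ n ∈ Finset.Icc 1 (Y ^ (k + 1)), tau (k + 1) n * geomBound Y (c * n) := by
          gcongr <;> norm_num
      _ = _ := by push_cast; ring

theorem nd_ge_of_mem_Icc {x y δ : ℝ} (hδ : δ ≤ y) (hδ' : y ≤ 1 - δ) {n : ℤ} (h : x = y + n) :
    δ ≤ nd x := by
  rw [nd]
  rcases le_or_gt (round x) n with h1 | h1
  · have h2 : ((round x : ℤ) : ℝ) ≤ n := by exact_mod_cast h1
    rw [le_abs]; left; linarith
  · have h2 : (n : ℝ) + 1 ≤ (round x : ℤ) := by exact_mod_cast h1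
    rw [le_abs]; right; linarith

theorem sum_geomBound_residues_le (Y : ℕ) {q : ℕ} (hq : 0 < q) {b : ℤ} (hb : IsCoprime b (q : ℤ))
    {α : ℝ} (hα : |α - b / q| ≤ 1 / q ^ 2) (θ : ℝ) :
    ∑ r ∈ Finset.range q, geomBound Y (θ + α * r) ≤ 4 * Y + 2 * q * (1 + Real.log q) := by
  have hq' : (0 : ℝ) < q := by exact_mod_cast hq
  have hqz : (0 : ℤ) < q := by exact_mod_cast hq
  set s := ⌊θ * q⌋ with hs
  set t : ℕ → ℕ := fun r => ((s + b * r) % q).toNat with ht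
  have htz : ∀ r, (t r : ℤ) = (s + b * r) % q := fun r =>
    Int.toNat_of_nonneg (Int.emod_nonneg _ hqz.ne')
  have htq : ∀ r, t r < q := fun r => by
    have := Int.emod_lt_of_pos (s + b * r) hqz
    rw [← htz] at this; exact_mod_cast this
  have hinj : Set.InjOn t (Finset.range q) := by
    intro r hr r' hr' h
    simp only [Finset.coe_range, Set.mem_Iio] at hr hr'
    have h1 : (s + b * r) % q = (s + b * r') % q := by rw [← htz, ← htz, h]
    have h2 : (q : ℤ) ∣ b * (r' - r) := by
      have := Int.ModEq.dvd h1
      rwa [show s + b * (r' : ℤ) - (s + b * r) = b * (r' - r) by ring] at this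
    have h3 := hb.symm.dvd_of_dvd_mul_left h2
    have h4 := Int.eq_zero_of_abs_lt_dvd h3 (by rw [abs_lt]; omega)
    omega
  have himg : (Finset.range q).image t = Finset.range q :=
    Finset.eq_of_subset_of_card_le
      (Finset.image_subset_iff.2 fun r _ => Finset.mem_range.2 (htq r))
      (by rw [Finset.card_image_of_injOn hinj])
  set v : ℕ → ℝ := fun t => (if t ≤ 1 then (Y : ℝ) else 0) + q * (1 / (t : ℝ)) with hv
  have hv0 : ∀ t, 0 ≤ v t := fun t => by
    simp only [hv]; split_ifs <;> positivity
  have hY : ∀ t ≤ 1, (Y : ℝ) ≤ v t := fun t h => by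
    simp only [hv, if_pos h]; have : 0 ≤ (q : ℝ) * (1 / t) := by positivity
    linarith
  have hkey : ∀ r ∈ Finset.range q, geomBound Y (θ + α * r) ≤ v (t r) + v (q - 1 - t r) := by
    intro r hr
    rw [Finset.mem_range] at hr
    have h1 := hv0 (t r)
    have h2 := hv0 (q - 1 - t r)
    rcases le_or_gt (t r) 1 with h | h
    · linarith [geomBound_le Y (θ + α * r), hY _ h]
    rcases le_or_gt (q - 1 - t r) 1 with h' | h'
    · linarith [geomBound_le Y (θ + α * r), hY _ h']
    have herr : |r * (α - b / q) * q| ≤ 1 := by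
      rw [abs_mul, abs_mul, Nat.abs_cast, Nat.abs_cast]
      have hr' : (r : ℝ) ≤ q := by exact_mod_cast hr.le
      calc (r : ℝ) * |α - b / q| * q ≤ q * (1 / q ^ 2) * q := by gcongr
        _ = 1 := by field_simp
    rw [abs_le] at herr
    have hfl := Int.floor_le (θ * q)
    have hfl' := Int.lt_floor_add_one (θ * q)
    rw [← hs] at hfl hfl'
    have hdiv := Int.mul_ediv_add_emod (s + b * r) q
    rw [← htz] at hdiv
    set y := (t r + (θ * q - s) + r * (α - b / q) * q) / q with hy
    have hx : θ + α * r = y + ((s + b * r) / q : ℤ) := by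
      have : ((q : ℝ) * ((s + b * r) / q : ℤ) + t r) = s + b * r := by exact_mod_cast hdiv
      rw [hy]
      field_simp
      linear_combination -this
    have hn : ∀ u : ℕ, 1 < u → ((u : ℝ) - 1) / q ≤ nd (θ + α * r) →
        geomBound Y (θ + α * r) ≤ v u := by
      intro u hu hle
      have hu' : (2 : ℝ) ≤ u := by exact_mod_cast hu
      have hu1 : (0 : ℝ) < u - 1 := by linarith
      refine (geomBound_le_of_le (by positivity) hle).trans ?_
      simp only [hv, if_neg (not_le.2 hu), zero_add]
      rw [show 1 / (2 * (((u : ℝ) - 1) / q)) = q * (1 / (2 * (u - 1))) by field_simp]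
      gcongr
      linarith
    have hcast : ((q - 1 - t r : ℕ) : ℝ) = q - 1 - t r := by
      rw [Nat.cast_sub (by omega), Nat.cast_sub (by omega)]; simp
    rcases le_total (t r) (q - 1 - t r) with hle | hle
    · have hle' : (t r : ℝ) ≤ q - 1 - t r := by rw [← hcast]; exact_mod_cast hle
      refine (hn (t r) h ?_).trans (by linarith)
      refine nd_ge_of_mem_Icc (y := y) ?_ ?_ hx
      · rw [hy]; gcongr; linarith
      · rw [hy, le_sub_iff_add_le, ← add_div, div_le_one hq']; linarith
    · have hle' : (q - 1 - t r : ℝ) ≤ t r := by rw [← hcast]; exact_mod_cast hle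
      refine (hn (q - 1 - t r) h' ?_).trans (by linarith)
      rw [hcast]
      refine nd_ge_of_mem_Icc (y := y) ?_ ?_ hx
      · rw [hy]; gcongr; linarith
      · rw [hy, le_sub_iff_add_le, ← add_div, div_le_one hq']; linarith
  have hsum : ∑ u ∈ Finset.range q, v u ≤ 2 * Y + q * (1 + Real.log q) := by
    simp only [hv]
    rw [Finset.sum_add_distrib, ← Finset.mul_sum]
    gcongr
    · rw [← Finset.sum_filter, Finset.sum_const, nsmul_eq_mul]
      gcongr
      have : (Finset.range q).filter (· ≤ 1) ⊆ Finset.range 2 := by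
        intro u hu; simp only [Finset.mem_filter, Finset.mem_range] at hu ⊢; omega
      exact_mod_cast (Finset.card_le_card this)
    · have h := harmonic_le_one_add_log q
      rw [harmonic] at h
      push_cast at h
      calc ∑ i ∈ Finset.range q, (1 / i : ℝ) ≤ ∑ i ∈ Finset.range (q + 1), (1 / i : ℝ) := by
            rw [Finset.sum_range_succ]; linarith [show (0 : ℝ) ≤ 1 / q by positivity]
        _ = ∑ i ∈ Finset.range q, ((i : ℝ) + 1)⁻¹ := by
            rw [Finset.sum_range_succ']; simp
        _ ≤ _ := h
  calc ∑ r ∈ Finset.range q, geomBound Y (θ + α * r)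
      ≤ ∑ r ∈ Finset.range q, (v (t r) + v (q - 1 - t r)) := Finset.sum_le_sum hkey
    _ = ∑ u ∈ (Finset.range q).image t, (v u + v (q - 1 - u)) := by
        rw [Finset.sum_image hinj]
    _ = ∑ u ∈ Finset.range q, v u + ∑ u ∈ Finset.range q, v u := by
        rw [himg, Finset.sum_add_distrib, Finset.sum_range_reflect v q]
    _ ≤ _ := by linarith

theorem sum_geomBound_le (Y : ℕ) {q : ℕ} (hq : 0 < q) {b : ℤ} (hb : IsCoprime b (q : ℤ))
    {α : ℝ} (hα : |α - b / q| ≤ 1 / q ^ 2) (H : ℕ) :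
    ∑ n ∈ Finset.Icc 1 H, geomBound Y (α * n) ≤
      (H / q + 1) * (4 * Y + 2 * q * (1 + Real.log q)) := by
  have hblocks : ∀ B : ℕ, ∑ n ∈ Finset.range (q * B), geomBound Y (α * n) ≤
      B * (4 * Y + 2 * q * (1 + Real.log q)) := by
    intro B
    induction B with
    | zero => simp
    | succ B ih =>
      rw [Nat.mul_succ, Finset.sum_range_add]
      have := sum_geomBound_residues_le Y hq hb hα (α * (q * B : ℕ))
      simp only [← mul_add] at this
      push_cast at this ih ⊢
      linarith
  have hlog : 0 ≤ Real.log q := Real.log_natCast_nonneg q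
  have hsub : Finset.Icc 1 H ⊆ Finset.range (q * (H / q + 1)) := by
    intro n hn
    rw [Finset.mem_Icc] at hn
    rw [Finset.mem_range]
    have := Nat.lt_mul_div_succ H hq
    omega
  refine (Finset.sum_le_sum_of_subset_of_nonneg hsub fun n _ _ => geomBound_nonneg _ _).trans
    ((hblocks _).trans ?_)
  push_cast
  gcongr
  exact Nat.cast_div_le

theorem weylSum_five_le {Y : ℕ} {q : ℕ} (hq : 0 < q) {b : ℤ} (hb : IsCoprime b (q : ℤ))
    {α : ℝ} (hα : |α - b / q| ≤ 1 / q ^ 2) {c : ℕ} (hc : 0 < c) :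
    ∃ S : ℝ, 0 ≤ S ∧ weylSum Y 5 (c * α) ≤ 160 * Y ^ 5 + 32 * S ∧
      S ^ 2 ≤ Y ^ 5 * (1 + Real.log (Y ^ 5)) ^ 25 *
        (Y * (((c * Y ^ 5 : ℕ) / q + 1) * (4 * Y + 2 * q * (1 + Real.log q)))) := by
  have h1 := weylSum_le Y 5 (c * α)
  have h2 := sum_tau_mul_tau_le 5 5 (le_refl (Y ^ 5))
  have h3 := sum_geomBound_le Y hq hb hα (c * Y ^ 5)
  refine ⟨∑ n ∈ Finset.Icc 1 (Y ^ 5), tau 5 n * geomBound Y (c * α * n),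
    Finset.sum_nonneg fun n _ => mul_nonneg (Nat.cast_nonneg _) (geomBound_nonneg _ _),
    h1.trans (le_of_eq ?_), (Finset.sum_mul_sq_le_sq_mul_sq _ _ _).trans ?_⟩
  · norm_num
  refine mul_le_mul (by simpa [sq] using h2) ?_ (Finset.sum_nonneg fun n _ => sq_nonneg _) ?_
  · calc ∑ n ∈ Finset.Icc 1 (Y ^ 5), geomBound Y (c * α * n) ^ 2
        ≤ ∑ n ∈ Finset.Icc 1 (Y ^ 5), Y * geomBound Y (c * α * n) :=
          Finset.sum_le_sum fun n _ => by
            rw [sq]; exact mul_le_mul_of_nonneg_right (geomBound_le _ _) (geomBound_nonneg _ _)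
      _ = Y * ∑ n ∈ (Finset.Icc 1 (Y ^ 5)).image (c * ·), geomBound Y (α * n) := by
          rw [← Finset.mul_sum, Finset.sum_image fun _ _ _ _ h => Nat.eq_of_mul_eq_mul_left hc h]
          congr 1
          exact Finset.sum_congr rfl fun n _ => by push_cast; ring_nf
      _ ≤ Y * ∑ n ∈ Finset.Icc 1 (c * Y ^ 5), geomBound Y (α * n) := by
          gcongr
          · intro n _ _; exact geomBound_nonneg _ _
          · intro n hn
            obtain ⟨m, hm, rfl⟩ := Finset.mem_image.1 hn
            rw [Finset.mem_Icc] at hm ⊢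
            exact ⟨Nat.mul_pos hc hm.1, Nat.mul_le_mul_left _ hm.2⟩
      _ ≤ _ := by gcongr
  · have := Real.log_natCast_nonneg (Y ^ 5)
    push_cast at this
    positivity

theorem sum_range_natCast (q : ℕ) [NeZero q] (f : ZMod q → ℂ) :
    ∑ x ∈ Finset.range q, f x = ∑ x, f x :=
  Finset.sum_bij' (fun x _ => (x : ZMod q)) (fun x _ => x.val) (fun _ _ => Finset.mem_univ _)
    (fun x _ => Finset.mem_range.2 (ZMod.val_lt x))
    (fun _ hx => ZMod.val_cast_of_lt (Finset.mem_range.1 hx)) (fun x _ => ZMod.natCast_zmod_val x)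
    (fun _ _ => rfl)

theorem stdAddChar_intCast (q : ℕ) [NeZero q] (n : ℤ) :
    ZMod.stdAddChar (n : ZMod q) = e (n / q) := by
  rw [ZMod.stdAddChar_coe, e]; push_cast; ring_nf

theorem norm_stdAddChar (q : ℕ) [NeZero q] (x : ZMod q) : ‖ZMod.stdAddChar x‖ = 1 := by
  obtain ⟨n, rfl⟩ := ZMod.intCast_surjective x
  rw [stdAddChar_intCast, norm_e]

/-- The complete exponential sum of `a * x ^ 6` modulo `q`. -/
noncomputable def sixthSum (q : ℕ) [NeZero q] (a : ZMod q) : ℂ :=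
  ∑ x, ZMod.stdAddChar (a * x ^ 6)

theorem exists_sixthSum_mul (q r : ℕ) [NeZero q] [NeZero r] [NeZero (q * r)] (h : q.Coprime r)
    (a : ZMod (q * r)) (ha : IsUnit a) : ∃ (b : ZMod q) (c : ZMod r), IsUnit b ∧ IsUnit c ∧
      sixthSum (q * r) a = sixthSum q b * sixthSum r c := by
  obtain ⟨v, u, huv⟩ := Nat.isCoprime_iff_coprime.2 h
  set E := ZMod.chineseRemainder h with hE
  have hψ : ∀ x, ZMod.stdAddChar x =
      ZMod.stdAddChar ((u : ZMod q) * (E x).1) * ZMod.stdAddChar ((v : ZMod r) * (E x).2) := by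
    intro x
    obtain ⟨n, rfl⟩ := ZMod.intCast_surjective x
    rw [map_intCast E n, Prod.fst_intCast, Prod.snd_intCast, ← Int.cast_mul, ← Int.cast_mul,
      stdAddChar_intCast, stdAddChar_intCast, stdAddChar_intCast, ← e_add]
    congr 1
    have hq : (q : ℝ) ≠ 0 := Nat.cast_ne_zero.2 (NeZero.ne q)
    have hr : (r : ℝ) ≠ 0 := Nat.cast_ne_zero.2 (NeZero.ne r)
    have : (v : ℝ) * q + u * r = 1 := by exact_mod_cast huv
    push_cast
    field_simp
    linear_combination -(n : ℝ) * this
  have hu : IsUnit (u : ZMod q) := by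
    refine IsUnit.of_mul_eq_one (r : ZMod q) ?_
    have := congrArg (Int.cast : ℤ → ZMod q) huv
    push_cast at this
    rwa [ZMod.natCast_self, mul_zero, zero_add] at this
  have hv : IsUnit (v : ZMod r) := by
    refine IsUnit.of_mul_eq_one (q : ZMod r) ?_
    have := congrArg (Int.cast : ℤ → ZMod r) huv
    push_cast at this
    rwa [ZMod.natCast_self, mul_zero, add_zero] at this
  have haE := ha.map E
  rw [Prod.isUnit_iff] at haE
  refine ⟨u * (E a).1, v * (E a).2, hu.mul haE.1, hv.mul haE.2, ?_⟩
  rw [sixthSum, sixthSum, sixthSum, Finset.sum_mul_sum, ← Finset.sum_product', Finset.univ_product_univ,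
    ← Equiv.sum_comp E.toEquiv]
  refine Finset.sum_congr rfl fun x _ => ?_
  rw [hψ]
  simp [mul_assoc]

theorem normSq_sixthSum_prime_le {p : ℕ} [Fact p.Prime] {a : ZMod p} (ha : a ≠ 0) :
    ‖sixthSum p a‖ ^ 2 ≤ 30 * p := by
  have hp : p.Prime := Fact.out
  have hsq : ∀ b : ZMod p, ((‖sixthSum p b‖ ^ 2 : ℝ) : ℂ) =
      ∑ x : ZMod p, ∑ y : ZMod p, ZMod.stdAddChar (b * (x ^ 6 - y ^ 6)) := by
    intro b
    push_cast
    rw [← Complex.mul_conj', sixthSum, map_sum, Finset.sum_mul_sum]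
    refine Finset.sum_congr rfl fun x _ => Finset.sum_congr rfl fun y _ => ?_
    rw [← AddChar.map_neg_eq_conj, ← AddChar.map_add_eq_mul, mul_sub, sub_eq_add_neg]
  have htot : ∑ b : ZMod p, ‖sixthSum p b‖ ^ 2 ≤ p * (6 * (p - 1) + 1) := by
    have h1 : ((∑ b : ZMod p, ‖sixthSum p b‖ ^ 2 : ℝ) : ℂ) =
        ((∑ x : ZMod p, p * (Finset.univ.filter fun y : ZMod p => y ^ 6 = x ^ 6).card : ℝ) : ℂ) := by
      rw [Complex.ofReal_sum, Complex.ofReal_sum]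
      simp only [hsq]
      rw [Finset.sum_comm]
      refine Finset.sum_congr rfl fun x _ => ?_
      rw [Finset.sum_comm]
      have : ∀ y : ZMod p, ∑ b : ZMod p, ZMod.stdAddChar (b * (x ^ 6 - y ^ 6)) =
          if y ^ 6 = x ^ 6 then (p : ℂ) else 0 := fun y => by
        rw [AddChar.sum_mulShift _ (ZMod.isPrimitive_stdAddChar p), ZMod.card]
        simp only [sub_eq_zero, eq_comm (a := x ^ 6)]
        split_ifs <;> simp
      simp only [this, ← Finset.sum_filter, Finset.sum_const, nsmul_eq_mul]
      push_cast
      ring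
    have h2 := Complex.ofReal_injective h1
    rw [h2, ← Finset.mul_sum]
    refine mul_le_mul_of_nonneg_left ?_ (Nat.cast_nonneg _)
    rw [← Finset.add_sum_erase _ _ (Finset.mem_univ (0 : ZMod p)), add_comm]
    refine add_le_add ?_ ?_
    · refine (Finset.sum_le_sum fun x _ => (Nat.cast_le (α := ℝ)).2
        (card_pow_six_eq_le (x ^ 6))).trans (le_of_eq ?_)
      rw [Finset.sum_const, Finset.card_erase_of_mem (Finset.mem_univ _), Finset.card_univ,
        ZMod.card, nsmul_eq_mul, Nat.cast_sub hp.one_le]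
      push_cast; ring
    · have : (Finset.univ.filter fun y : ZMod p => y ^ 6 = 0 ^ 6) = {0} := by
        ext y; simp
      rw [this]; simp
  have hscale : ∀ m : ZMod p, m ≠ 0 → sixthSum p (a * m ^ 6) = sixthSum p a := by
    intro m hm
    refine Fintype.sum_bijective (fun x => m * x) (mulLeft_bijective₀ m hm) _ _ fun x => ?_
    rw [mul_pow, mul_assoc]
  have hzero : sixthSum p 0 = p := by simp [sixthSum]
  have hnz : ∑ b ∈ Finset.univ.erase (0 : ZMod p), ‖sixthSum p b‖ ^ 2 ≤ 5 * p * (p - 1) := by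
    rw [← Finset.add_sum_erase _ _ (Finset.mem_univ (0 : ZMod p)), hzero] at htot
    simp only [RCLike.norm_natCast] at htot
    linarith
  have hfib : ∑ m ∈ Finset.univ.erase (0 : ZMod p), ‖sixthSum p (a * m ^ 6)‖ ^ 2 ≤
      6 * ∑ b ∈ Finset.univ.erase (0 : ZMod p), ‖sixthSum p b‖ ^ 2 := by
    rw [← Finset.sum_fiberwise_of_maps_to (s := Finset.univ.erase (0 : ZMod p))
      (t := Finset.univ.erase (0 : ZMod p)) (g := fun m => a * m ^ 6), Finset.mul_sum]
    · refine Finset.sum_le_sum fun b _ => ?_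
      rw [Finset.sum_congr rfl (g := fun _ => ‖sixthSum p b‖ ^ 2) fun m hm => by
        rw [(Finset.mem_filter.1 hm).2], Finset.sum_const, nsmul_eq_mul]
      gcongr
      have hsub : ((Finset.univ.erase (0 : ZMod p)).filter fun m => a * m ^ 6 = b) ⊆
          Finset.univ.filter fun m : ZMod p => m ^ 6 = a⁻¹ * b := by
        intro m hm
        simp only [Finset.mem_filter, Finset.mem_univ, true_and] at hm ⊢
        rw [← hm.2, inv_mul_cancel_left₀ ha]
      exact_mod_cast (Finset.card_le_card hsub).trans (card_pow_six_eq_le _)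
    · intro m hm
      simp only [Finset.mem_erase, Finset.mem_univ, and_true] at hm ⊢
      exact mul_ne_zero ha (pow_ne_zero _ hm)
  rw [Finset.sum_congr rfl (g := fun _ => ‖sixthSum p a‖ ^ 2) fun m hm => by
    rw [hscale m (Finset.mem_erase.1 hm).1], Finset.sum_const, nsmul_eq_mul,
    Finset.card_erase_of_mem (Finset.mem_univ _), Finset.card_univ, ZMod.card,
    Nat.cast_sub hp.one_le] at hfib
  have hp1 : (0 : ℝ) < (p : ℝ) - 1 := by
    have : (1 : ℝ) < p := by exact_mod_cast hp.one_lt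
    linarith
  refine le_of_mul_le_mul_left ?_ hp1
  push_cast at hfib
  linarith

theorem sum_range_mul_of_periodic {f : ℕ → ℂ} {q : ℕ} (hf : ∀ x, f (x + q) = f x) (r : ℕ) :
    ∑ x ∈ Finset.range (r * q), f x = r * ∑ x ∈ Finset.range q, f x := by
  induction r with
  | zero => simp
  | succ r ih =>
    have hr : ∀ x, f (r * q + x) = f x := by
      intro x
      clear ih
      induction r with
      | zero => simp
      | succ r ih => rw [show (r + 1) * q + x = (r * q + x) + q by ring, hf, ih]
    rw [Nat.succ_mul, Finset.sum_range_add, ih]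
    simp only [hr]
    push_cast; ring

theorem sixthSum_prime_pow_eq {p q m : ℕ} [Fact p.Prime] [NeZero q] (hp : 3 < p)
    (hq : q = p ^ (m + 2)) {a : ZMod q} (ha : IsUnit a) :
    sixthSum q a =
      ∑ y ∈ Finset.range (p ^ (m + 1)), ZMod.stdAddChar (a * ((p : ZMod q) * (y : ZMod q)) ^ 6) := by
  have hpp : p.Prime := Fact.out
  set t : ZMod q := (p : ZMod q) ^ (m + 1) with ht
  have hpt : (p : ZMod q) * t = 0 := by
    rw [ht, ← pow_succ', ← Nat.cast_pow, ← hq, ZMod.natCast_self]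
  have ht2 : t ^ 2 = 0 := by
    rw [sq]; nth_rewrite 1 [ht]; rw [pow_succ, mul_assoc, hpt, mul_zero]
  have ht0 : t ≠ 0 := by
    rw [ht, ← Nat.cast_pow, Ne, ZMod.natCast_eq_zero_iff, hq]
    exact fun h => absurd (Nat.pow_dvd_pow_iff_le_right hpp.one_lt |>.1 h) (by omega)
  have hunit : ∀ n : ℕ, IsUnit (n : ZMod q) ↔ ¬ p ∣ n := by
    intro n
    rw [ZMod.isUnit_iff_coprime, hq, Nat.coprime_pow_right_iff (by omega), Nat.coprime_comm,
      hpp.coprime_iff_not_dvd]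
  have h6 : IsUnit (6 : ZMod q) := by
    have := (hunit 6).2 fun h => by
      have h' : p ∣ 2 * 3 := h
      rcases hpp.dvd_mul.1 h' with h | h
      · exact absurd (Nat.le_of_dvd (by omega) h) (by omega)
      · exact absurd (Nat.le_of_dvd (by omega) h) (by omega)
    exact_mod_cast this
  have hnon : ∀ x : ZMod q, ¬ IsUnit x → x * t = 0 := by
    intro x hx
    rw [← ZMod.natCast_zmod_val x, hunit, not_not] at hx
    obtain ⟨k, hk⟩ := hx
    rw [← ZMod.natCast_zmod_val x, hk, Nat.cast_mul, mul_right_comm, hpt, zero_mul]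
  have hinner : ∀ x : ZMod q, ∑ z ∈ Finset.range p, ZMod.stdAddChar (a * (x + t * (z : ZMod q)) ^ 6) =
      if IsUnit x then 0 else (p : ℂ) * ZMod.stdAddChar (a * x ^ 6) := by
    intro x
    have hx : ∀ z : ℕ, ZMod.stdAddChar (a * (x + t * (z : ZMod q)) ^ 6) =
        ZMod.stdAddChar (a * x ^ 6) * ZMod.stdAddChar (6 * a * x ^ 5 * t) ^ z := by
      intro z
      rw [← AddChar.map_nsmul_eq_pow, ← AddChar.map_add_eq_mul, nsmul_eq_mul]
      congr 1
      linear_combination a * (15 * x ^ 4 * (z : ZMod q) ^ 2 + 20 * x ^ 3 * t * (z : ZMod q) ^ 3 +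
        15 * x ^ 2 * t ^ 2 * (z : ZMod q) ^ 4 + 6 * x * t ^ 3 * (z : ZMod q) ^ 5 +
        t ^ 4 * (z : ZMod q) ^ 6) * ht2
    simp only [hx, ← Finset.mul_sum]
    split_ifs with h
    · have h1 : ZMod.stdAddChar (6 * a * x ^ 5 * t) ≠ 1 := by
        rw [← AddChar.map_zero_eq_one (ZMod.stdAddChar (N := q))]
        refine fun h' => ht0 ?_
        have := ZMod.injective_stdAddChar h'
        exact ((h6.mul ha).mul (h.pow 5)).mul_right_eq_zero.1 this
      have h2 : ZMod.stdAddChar (6 * a * x ^ 5 * t) ^ p = 1 := by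
        rw [← AddChar.map_nsmul_eq_pow, nsmul_eq_mul,
          show (p : ZMod q) * (6 * a * x ^ 5 * t) = 6 * a * x ^ 5 * (p * t) by ring, hpt, mul_zero,
          AddChar.map_zero_eq_one]
      rw [geom_sum_eq h1, h2, sub_self, zero_div, mul_zero]
    · have : 6 * a * x ^ 5 * t = 0 := by
        rw [show 6 * a * x ^ 5 * t = 6 * a * x ^ 4 * (x * t) by ring, hnon x h, mul_zero]
      rw [this]
      simp [mul_comm]
  have hp0 : (p : ℂ) ≠ 0 := Nat.cast_ne_zero.2 hpp.ne_zero
  have hsum : (p : ℂ) * sixthSum q a =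
      p * ∑ x ∈ Finset.univ.filter fun x : ZMod q => ¬ IsUnit x, ZMod.stdAddChar (a * x ^ 6) := by
    calc (p : ℂ) * sixthSum q a = ∑ z ∈ Finset.range p, sixthSum q a := by simp
      _ = ∑ z ∈ Finset.range p, ∑ x : ZMod q, ZMod.stdAddChar (a * (x + t * (z : ZMod q)) ^ 6) := by
        refine Finset.sum_congr rfl fun z _ => ?_
        exact (Equiv.sum_comp (Equiv.addRight (t * (z : ZMod q)))
          fun x => ZMod.stdAddChar (a * x ^ 6)).symm
      _ = _ := by
        rw [Finset.sum_comm]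
        simp only [hinner, Finset.sum_filter, Finset.mul_sum]
        refine Finset.sum_congr rfl fun x _ => ?_
        split_ifs <;> simp_all
  rw [mul_left_cancel₀ hp0 hsum]
  have hlt : ∀ y < p ^ (m + 1), p * y < q := by
    intro y hy
    rw [hq, show m + 2 = (m + 1) + 1 from rfl, pow_succ']
    exact Nat.mul_lt_mul_of_pos_left hy hpp.pos
  refine Finset.sum_bij' (fun x _ => x.val / p) (fun y _ => ((p * y : ℕ) : ZMod q)) ?_ ?_ ?_ ?_ ?_
  · intro x _
    rw [Finset.mem_range, Nat.div_lt_iff_lt_mul hpp.pos, ← pow_succ]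
    exact (ZMod.val_lt x).trans_eq hq
  · intro y _
    simp only [Finset.mem_filter, Finset.mem_univ, true_and, hunit, not_not]
    exact dvd_mul_right _ _
  · intro x hx
    simp only [Finset.mem_filter, Finset.mem_univ, true_and] at hx
    rw [← ZMod.natCast_zmod_val x, hunit, not_not] at hx
    rw [Nat.mul_div_cancel' hx, ZMod.natCast_zmod_val]
  · intro y hy
    rw [ZMod.val_cast_of_lt (hlt y (Finset.mem_range.1 hy)), Nat.mul_div_cancel_left _ hpp.pos]
  · intro x hx
    simp only [Finset.mem_filter, Finset.mem_univ, true_and] at hx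
    rw [← ZMod.natCast_zmod_val x, hunit, not_not] at hx
    rw [← Nat.cast_mul, Nat.mul_div_cancel' hx, ZMod.natCast_zmod_val]

theorem norm_sixthSum_prime_pow_le {p : ℕ} [Fact p.Prime] (hp : 167 ≤ p) (l : ℕ)
    {a : ZMod (p ^ l)} (ha : IsUnit a) : ‖sixthSum (p ^ l) a‖ ^ 6 ≤ ((p ^ l : ℕ) : ℝ) ^ 5 := by
  have hpp : p.Prime := Fact.out
  have hpR : (167 : ℝ) ≤ p := by exact_mod_cast hp
  induction l using Nat.strong_induction_on with
  | _ l ih =>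
  have htriv : ∀ (n : ℕ) (f : ℕ → ZMod (p ^ l)),
      ‖∑ y ∈ Finset.range n, ZMod.stdAddChar (f y)‖ ≤ n := by
    intro n f
    refine (norm_sum_le _ _).trans (le_of_eq ?_)
    simp
  match l with
  | 0 =>
    have : ‖sixthSum (p ^ 0) a‖ ≤ 1 := by
      refine (norm_sum_le _ _).trans (le_of_eq ?_)
      simp only [norm_stdAddChar, Finset.sum_const, Finset.card_univ, ZMod.card]
      simp
    simpa using pow_le_pow_left₀ (norm_nonneg _) this 6
  | 1 =>
    have key : ∀ (n : ℕ) [NeZero n] (_ : n = p) (b : ZMod n), IsUnit b →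
        ‖sixthSum n b‖ ^ 2 ≤ 30 * p := by
      intro n _ hn b hb
      subst hn
      have := Fact.mk hpp
      have h := normSq_sixthSum_prime_le hb.ne_zero
      convert h
    have h := pow_le_pow_left₀ (by positivity) (key _ (pow_one p) a ha) 3
    rw [← pow_mul] at h
    refine h.trans ?_
    push_cast
    rw [pow_one]
    have : (27000 : ℝ) ≤ p ^ 2 := by nlinarith
    nlinarith [pow_pos (by linarith : (0 : ℝ) < p) 3]
  | m + 2 =>
    rw [sixthSum_prime_pow_eq (by omega) rfl ha]
    by_cases hm : m ≤ 4
    · refine (pow_le_pow_left₀ (norm_nonneg _) (htriv _ _) 6).trans ?_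
      push_cast
      rw [← pow_mul, ← pow_mul]
      exact pow_le_pow_right₀ (by linarith) (by omega)
    · obtain ⟨k, rfl⟩ : ∃ k, m = k + 4 := ⟨m - 4, by omega⟩
      obtain ⟨n, rfl⟩ := ZMod.natCast_zmod_surjective a
      have hn : IsUnit (n : ZMod (p ^ k)) := by
        rw [ZMod.isUnit_iff_coprime] at ha ⊢
        exact Nat.Coprime.coprime_dvd_right (pow_dvd_pow p (by omega)) ha
      have hval : ∀ y : ℕ, ZMod.stdAddChar ((n : ZMod (p ^ (k + 4 + 2))) *
          ((p : ZMod (p ^ (k + 4 + 2))) * (y : ZMod (p ^ (k + 4 + 2)))) ^ 6) =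
            ZMod.stdAddChar ((n : ZMod (p ^ k)) * (y : ZMod (p ^ k)) ^ 6) := by
        intro y
        have h1 := stdAddChar_intCast (p ^ (k + 4 + 2)) (n * (p * y) ^ 6)
        have h2 := stdAddChar_intCast (p ^ k) (n * y ^ 6)
        push_cast at h1 h2
        rw [h1, h2]
        congr 1
        have : (p : ℝ) ≠ 0 := by linarith
        field_simp
        ring
      simp only [hval]
      rw [show p ^ (k + 4 + 1) = p ^ 5 * p ^ k by ring, sum_range_mul_of_periodic (fun x => by
        rw [Nat.cast_add, ZMod.natCast_self, add_zero]),
        sum_range_natCast (p ^ k) fun x => ZMod.stdAddChar ((n : ZMod (p ^ k)) * x ^ 6)]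
      have hih := ih k (by omega) hn
      rw [sixthSum] at hih
      rw [norm_mul, mul_pow, RCLike.norm_natCast]
      refine (mul_le_mul_of_nonneg_left hih (by positivity)).trans (le_of_eq ?_)
      push_cast
      ring

theorem norm_sixthSum_le (q : ℕ) [NeZero q] (hq : ∀ p : ℕ, p.Prime → p ∣ q → 167 ≤ p)
    {a : ZMod q} (ha : IsUnit a) : ‖sixthSum q a‖ ^ 6 ≤ (q : ℝ) ^ 5 := by
  rename_i inst
  revert inst a
  induction q using Nat.recOnPosPrimePosCoprime with
  | prime_pow p n hp hn =>
    intro inst a ha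
    have := Fact.mk hp
    have h := norm_sixthSum_prime_pow_le (hq p hp (dvd_pow_self p hn.ne')) n ha
    convert h
  | zero => exact fun {inst} => absurd rfl inst.out
  | one =>
    intro inst a ha
    have : ‖sixthSum 1 a‖ ≤ 1 := by
      refine (norm_sum_le _ _).trans (le_of_eq ?_)
      simp only [norm_stdAddChar, Finset.sum_const, Finset.card_univ, ZMod.card]
      simp
    simpa using pow_le_pow_left₀ (norm_nonneg _) this 6
  | coprime q r hq1 hr1 h ihq ihr =>
    intro inst a ha
    have : NeZero q := ⟨by omega⟩
    have : NeZero r := ⟨by omega⟩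
    obtain ⟨b, c, hb, hc, hbc⟩ := exists_sixthSum_mul q r h a ha
    rw [hbc, norm_mul, mul_pow, Nat.cast_mul, mul_pow]
    exact mul_le_mul (ihq (fun p hp hd => hq p hp (hd.mul_right r)) hb)
      (ihr (fun p hp hd => hq p hp (hd.mul_left q)) hc) (by positivity) (by positivity)

/-- The polynomial `y ↦ ((1 + 6vy)⁶ - 1) / (36v)`. -/
def gPoly {R : Type*} [CommSemiring R] (v y : R) : R :=
  y + 15 * v * y ^ 2 + 120 * v ^ 2 * y ^ 3 + 540 * v ^ 3 * y ^ 4 + 1296 * v ^ 4 * y ^ 5 +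
    1296 * v ^ 5 * y ^ 6

theorem natCast_gPoly {R : Type*} [CommSemiring R] (v y : ℕ) :
    ((gPoly v y : ℕ) : R) = gPoly (v : R) (y : R) := by
  simp [gPoly]

theorem gPoly_spec {R : Type*} [CommSemiring R] (v y : R) : 36 * v * gPoly v y + 1 = (1 + 6 * v * y) ^ 6 := by
  rw [gPoly]; ring

/-- The complete exponential sum of `b * gPoly v y` modulo `q`. -/
noncomputable def gSum (v q : ℕ) (b : ℤ) : ℂ :=
  ∑ y ∈ Finset.range q, e (b * gPoly (v : ℝ) y / q)

theorem gSum_eq (v q : ℕ) [NeZero q] (b : ℤ) : gSum v q b =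
    ∑ x : ZMod q, ZMod.stdAddChar ((b : ZMod q) * gPoly (v : ZMod q) x) := by
  rw [← sum_range_natCast, gSum]
  refine Finset.sum_congr rfl fun y _ => ?_
  have := stdAddChar_intCast q (b * (gPoly v y : ℕ))
  rw [Int.cast_mul, Int.cast_natCast, Int.cast_mul, Int.cast_natCast, natCast_gPoly,
    natCast_gPoly] at this
  exact this.symm

theorem isUnit_intCast_of_isCoprime {q : ℕ} {b : ℤ} (hb : IsCoprime b (q : ℤ)) :
    IsUnit (b : ZMod q) := by
  obtain ⟨x, y, hxy⟩ := hb
  refine IsUnit.of_mul_eq_one (x : ZMod q) ?_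
  have := congrArg (Int.cast : ℤ → ZMod q) hxy
  rw [Int.cast_add, Int.cast_mul, Int.cast_mul, Int.cast_natCast, ZMod.natCast_self, mul_zero,
    add_zero, Int.cast_one] at this
  exact (mul_comm _ _).trans this

theorem gSum_eq_zero {v q p : ℕ} (hq : 0 < q) (hp : p.Prime) (hpq : p ∣ q) (hpv : p ∣ v) {b : ℤ}
    (hb : IsCoprime b (q : ℤ)) : gSum v q b = 0 := by
  have : NeZero q := ⟨hq.ne'⟩
  obtain ⟨k, rfl⟩ := hpq
  obtain ⟨w, rfl⟩ := hpv
  have hk0 : 0 < k := Nat.pos_of_mul_pos_left hq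
  rw [gSum_eq]
  have hvk : ((p * w : ℕ) : ZMod (p * k)) * k = 0 := by
    rw [← Nat.cast_mul, ZMod.natCast_eq_zero_iff]
    exact ⟨w, by ring⟩
  set u : ZMod (p * k) := ((p * w : ℕ) : ZMod (p * k)) with hu
  have hbu : IsUnit (b : ZMod (p * k)) := isUnit_intCast_of_isCoprime hb
  have hne : ZMod.stdAddChar ((b : ZMod (p * k)) * (k : ZMod (p * k))) ≠ 1 := by
    rw [← AddChar.map_zero_eq_one (ZMod.stdAddChar (N := p * k))]
    intro h
    have h := hbu.mul_right_eq_zero.1 (ZMod.injective_stdAddChar h)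
    rw [ZMod.natCast_eq_zero_iff] at h
    have h1 := Nat.le_of_dvd hk0 h
    have h2 := hp.two_le
    nlinarith
  set S := ∑ x : ZMod (p * k), ZMod.stdAddChar ((b : ZMod (p * k)) * gPoly u x) with hS
  have h : ZMod.stdAddChar ((b : ZMod (p * k)) * (k : ZMod (p * k))) * S = S := by
    conv_rhs => rw [hS, ← Equiv.sum_comp (Equiv.addRight (k : ZMod (p * k)))]
    rw [hS, Finset.mul_sum]
    refine Finset.sum_congr rfl fun x _ => ?_
    rw [← AddChar.map_add_eq_mul, Equiv.coe_addRight]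
    congr 1
    simp only [gPoly]
    have hd : ∀ n : ℕ, ∃ c, (x + (k : ZMod (p * k))) ^ n - x ^ n = k * c := fun n => by
      have h := sub_dvd_pow_sub_pow (x + (k : ZMod (p * k))) x n
      rwa [add_sub_cancel_left] at h
    obtain ⟨c2, h2⟩ := hd 2
    obtain ⟨c3, h3⟩ := hd 3
    obtain ⟨c4, h4⟩ := hd 4
    obtain ⟨c5, h5⟩ := hd 5
    obtain ⟨c6, h6⟩ := hd 6
    linear_combination -(b : ZMod (p * k)) * (15 * u * h2 + 120 * u ^ 2 * h3 + 540 * u ^ 3 * h4 +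
      1296 * u ^ 4 * h5 + 1296 * u ^ 5 * h6) - (b : ZMod (p * k)) * (15 * c2 + 120 * u * c3 +
      540 * u ^ 2 * c4 + 1296 * u ^ 3 * c5 + 1296 * u ^ 4 * c6) * hvk
  have : (ZMod.stdAddChar ((b : ZMod (p * k)) * (k : ZMod (p * k))) - 1) * S = 0 := by
    rw [sub_mul, h, one_mul, sub_self]
  exact (mul_eq_zero.1 this).resolve_left (sub_ne_zero.2 hne)

theorem norm_gSum_le {v q : ℕ} (hv : ∀ p : ℕ, p.Prime → p < 167 → p ∣ v) (hq : 1 < q) {b : ℤ}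
    (hb : IsCoprime b (q : ℤ)) : ‖gSum v q b‖ ^ 6 * max q 167 ≤ (q : ℝ) ^ 6 := by
  by_cases h : ∃ p : ℕ, p.Prime ∧ p ∣ q ∧ p ∣ v
  · obtain ⟨p, hp, hpq, hpv⟩ := h
    rw [gSum_eq_zero (by omega) hp hpq hpv hb]
    rw [norm_zero, zero_pow (by norm_num), zero_mul]
    positivity
  · push Not at h
    have : NeZero q := ⟨by omega⟩
    have hbig : ∀ p : ℕ, p.Prime → p ∣ q → 167 ≤ p := fun p hp hpq => by
      by_contra! hlt
      exact h p hp hpq (hv p hp hlt)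
    have hq167 : 167 ≤ q :=
      (hbig _ (Nat.minFac_prime hq.ne') (Nat.minFac_dvd q)).trans (Nat.minFac_le (by omega))
    have hcop : (6 * v).Coprime q := Nat.Coprime.symm <| by
      refine Nat.coprime_of_dvd fun p hp hpq hpv => ?_
      rcases hp.dvd_mul.1 hpv with h6 | h6
      · have h2 := hbig p hp hpq
        have h3 := Nat.le_of_dvd (by norm_num) h6
        omega
      · exact h p hp hpq h6
    have h6v : IsUnit (6 * v : ZMod q) := by
      have := (ZMod.isUnit_iff_coprime (6 * v) q).2 hcop
      exact_mod_cast this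
    have h36v : IsUnit (36 * v : ZMod q) := by
      have h6 : IsUnit (6 : ZMod q) := isUnit_of_mul_isUnit_left h6v
      have := h6.mul h6v
      rwa [← mul_assoc, show (6 * 6 : ZMod q) = 36 by norm_num] at this
    have hbu : IsUnit (b : ZMod q) := isUnit_intCast_of_isCoprime hb
    obtain ⟨w, hw⟩ := h36v.exists_right_inv
    have hwu : IsUnit w := IsUnit.of_mul_eq_one _ ((mul_comm _ _).trans hw)
    have hS : gSum v q b = ZMod.stdAddChar (-((b : ZMod q) * w)) * sixthSum q ((b : ZMod q) * w) := by
      have hbij : Function.Bijective fun x : ZMod q => 1 + 6 * v * x :=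
        ((Equiv.addLeft (1 : ZMod q)).bijective).comp (h6v.unit.mulLeft_bijective)
      rw [gSum_eq, sixthSum, ← hbij.sum_comp fun x : ZMod q => ZMod.stdAddChar ((b : ZMod q) * w * x ^ 6),
        Finset.mul_sum]
      refine Finset.sum_congr rfl fun x _ => ?_
      rw [← AddChar.map_add_eq_mul]
      congr 1
      rw [← gPoly_spec (v : ZMod q) x]
      linear_combination -(b : ZMod q) * gPoly (v : ZMod q) x * hw
    rw [hS, norm_mul, norm_stdAddChar, one_mul, max_eq_left (by exact_mod_cast hq167)]
    calc _ ≤ (q : ℝ) ^ 5 * q := by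
            gcongr
            exact norm_sixthSum_le q hbig (hbu.mul hwu)
      _ = _ := by ring

theorem sum_range_add_eq_gSum (v q : ℕ) [NeZero q] (b : ℤ) (s : ℕ) :
    ∑ x ∈ Finset.range q, e (b * gPoly (v : ℝ) (s + x : ℕ) / q) = gSum v q b := by
  have h : ∀ x : ℕ, e (b * gPoly (v : ℝ) (s + x : ℕ) / q) =
      ZMod.stdAddChar ((b : ZMod q) * gPoly (v : ZMod q) ((s : ZMod q) + (x : ZMod q))) := by
    intro x
    have := stdAddChar_intCast q (b * (gPoly v (s + x) : ℕ))
    rw [Int.cast_mul, Int.cast_natCast, Int.cast_mul, Int.cast_natCast, natCast_gPoly,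
      natCast_gPoly, Nat.cast_add (R := ZMod q)] at this
    exact this.symm
  simp only [h]
  rw [sum_range_natCast q fun x => ZMod.stdAddChar ((b : ZMod q) * gPoly (v : ZMod q) (s + x)),
    gSum_eq]
  exact Equiv.sum_comp (Equiv.addLeft (s : ZMod q))
    fun x => ZMod.stdAddChar ((b : ZMod q) * gPoly (v : ZMod q) x)

theorem norm_e_sub_e_le (x y : ℝ) : ‖e x - e y‖ ≤ 2 * Real.pi * |x - y| := by
  have : e x - e y = e y * (e (x - y) - 1) := by
    rw [mul_sub, ← e_add, add_sub_cancel, mul_one]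
  rw [this, norm_mul, norm_e, one_mul]
  exact norm_e_sub_one_le _

theorem norm_sum_le_gSum {v q Y : ℕ} (hq : 0 < q) {b : ℤ} {α δ D : ℝ} (hα : |α - b / q| ≤ δ)
    (hD0 : 0 ≤ D) (hD : ∀ y < 2 * Y, |gPoly (v : ℝ) (y + 1 : ℕ) - gPoly (v : ℝ) y| ≤ D) :
    ‖∑ y ∈ Finset.Ico Y (2 * Y), e (α * gPoly (v : ℝ) y)‖ ≤
      Y / q * (‖gSum v q b‖ + 2 * Real.pi * δ * D * q ^ 2) + q := by
  have : NeZero q := ⟨hq.ne'⟩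
  have hδ : 0 ≤ δ := (abs_nonneg _).trans hα
  set f : ℕ → ℂ := fun y => e (α * gPoly (v : ℝ) y) with hf
  set B : ℝ := ‖gSum v q b‖ + 2 * Real.pi * δ * D * q ^ 2 with hB
  have hB0 : 0 ≤ B := by have := Real.pi_pos; positivity
  have hvar : ∀ s x, s + x ≤ 2 * Y →
      |gPoly (v : ℝ) (s + x : ℕ) - gPoly (v : ℝ) s| ≤ D * x := by
    intro s x
    induction x with
    | zero => simp
    | succ x ih =>
      intro h
      have h1 := ih (by omega)
      have h2 := hD (s + x) (by omega)
      calc _ ≤ |gPoly (v : ℝ) (s + x + 1 : ℕ) - gPoly (v : ℝ) (s + x : ℕ)| +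
            |gPoly (v : ℝ) (s + x : ℕ) - gPoly (v : ℝ) s| := abs_sub_le _ _ _
        _ ≤ D * (x + 1 : ℕ) := by push_cast at h1 h2 ⊢; linarith
  have hblock : ∀ s, s + q ≤ 2 * Y → ‖∑ x ∈ Finset.range q, f (s + x)‖ ≤ B := by
    intro s hs
    have h1 : ∑ x ∈ Finset.range q, f (s + x) =
        e ((α - b / q) * gPoly (v : ℝ) s) * gSum v q b +
        ∑ x ∈ Finset.range q, e (b * gPoly (v : ℝ) (s + x : ℕ) / q) *
          (e ((α - b / q) * gPoly (v : ℝ) (s + x : ℕ)) - e ((α - b / q) * gPoly (v : ℝ) s)) := by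
      rw [← sum_range_add_eq_gSum v q b s, Finset.mul_sum, ← Finset.sum_add_distrib]
      refine Finset.sum_congr rfl fun x _ => ?_
      have hxe : f (s + x) = e (b * gPoly (v : ℝ) (s + x : ℕ) / q) *
          e ((α - b / q) * gPoly (v : ℝ) (s + x : ℕ)) := by
        rw [← e_add]
        simp only [hf]
        congr 1
        ring
      rw [hxe]
      ring
    rw [h1]
    refine (norm_add_le _ _).trans ?_
    rw [norm_mul, norm_e, one_mul, hB]
    gcongr
    refine (norm_sum_le_of_le (f := _) (n := fun _ => 2 * Real.pi * δ * D * q) _ fun x hx => ?_).trans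
      (le_of_eq ?_)
    · rw [norm_mul, norm_e, one_mul]
      have hx := Finset.mem_range.1 hx
      have h2 := hvar s x (by omega)
      refine (norm_e_sub_e_le _ _).trans ?_
      rw [← mul_sub, abs_mul, mul_assoc (2 * Real.pi), mul_assoc (2 * Real.pi), mul_assoc δ]
      have : (x : ℝ) ≤ q := by exact_mod_cast hx.le
      gcongr
      exact h2.trans (by gcongr)
    · rw [Finset.sum_const, Finset.card_range, nsmul_eq_mul]; ring
  have hblocks : ∀ m s, s + m * q ≤ 2 * Y → ‖∑ x ∈ Finset.range (m * q), f (s + x)‖ ≤ m * B := by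
    intro m
    induction m with
    | zero => simp
    | succ m ih =>
      intro s hs
      rw [Nat.succ_mul] at hs ⊢
      rw [Finset.sum_range_add]
      simp only [← add_assoc]
      refine (norm_add_le _ _).trans ?_
      have h1 := ih s (by omega)
      have h2 := hblock (s + m * q) (by omega)
      push_cast
      linarith
  rw [Finset.sum_Ico_eq_sum_range, show 2 * Y - Y = Y / q * q + Y % q by
    rw [Nat.div_add_mod']; omega, Finset.sum_range_add]
  refine (norm_add_le _ _).trans (add_le_add ?_ ?_)
  · have h := hblocks (Y / q) Y (by have := Nat.div_mul_le_self Y q; omega)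
    refine h.trans ?_
    gcongr
    exact Nat.cast_div_le
  · refine (norm_sum_le _ _).trans ?_
    simp only [norm_e, Finset.sum_const, Finset.card_range, nsmul_eq_mul, mul_one]
    exact_mod_cast (Nat.mod_lt Y hq).le

theorem sum_range_e_div (M : ℕ) [NeZero M] (n : ℤ) :
    ∑ a ∈ Finset.range M, e (a / M * n) = if (M : ℤ) ∣ n then (M : ℂ) else 0 := by
  have h : ∀ a : ℕ, e (a / M * n) = ZMod.stdAddChar ((a : ZMod M) * (n : ZMod M)) := by
    intro a
    have := stdAddChar_intCast M (a * n)
    rw [Int.cast_mul, Int.cast_natCast] at this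
    rw [this]
    congr 1
    push_cast; ring
  simp only [h]
  rw [sum_range_natCast M fun x => ZMod.stdAddChar (x * (n : ZMod M)),
    AddChar.sum_mulShift _ (ZMod.isPrimitive_stdAddChar M), ZMod.card]
  simp only [ZMod.intCast_zmod_eq_zero_iff_dvd]
  split_ifs <;> simp

theorem sum_range_normSq_le {ι : Type*} {M : ℕ} (hM : 0 < M) (s : Finset ι) (n : ι → ℤ) (c : ι → ℂ)
    (hc : ∀ i ∈ s, ‖c i‖ ≤ 1) :
    ∑ a ∈ Finset.range M, ‖∑ i ∈ s, c i * e (a / M * n i)‖ ^ 2 ≤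
      M * ((s ×ˢ s).filter fun w => (M : ℤ) ∣ n w.1 - n w.2).card := by
  have : NeZero M := ⟨hM.ne'⟩
  have h : ((∑ a ∈ Finset.range M, ‖∑ i ∈ s, c i * e (a / M * n i)‖ ^ 2 : ℝ) : ℂ) =
      ∑ w ∈ s ×ˢ s, c w.1 * starRingEnd ℂ (c w.2) *
        (if (M : ℤ) ∣ n w.1 - n w.2 then (M : ℂ) else 0) := by
    push_cast
    simp_rw [← sum_range_e_div, Finset.mul_sum]
    rw [Finset.sum_comm]
    refine Finset.sum_congr rfl fun a _ => ?_
    rw [← Complex.mul_conj', map_sum, Finset.sum_mul_sum, Finset.sum_product]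
    refine Finset.sum_congr rfl fun i _ => Finset.sum_congr rfl fun j _ => ?_
    rw [map_mul, ← e_neg, show (a / M * ((n i - n j : ℤ) : ℝ) : ℝ) = a / M * n i + -(a / M * n j) by
      push_cast; ring, e_add]
    ring
  have h2 : ‖((∑ a ∈ Finset.range M, ‖∑ i ∈ s, c i * e (a / M * n i)‖ ^ 2 : ℝ) : ℂ)‖ =
      ∑ a ∈ Finset.range M, ‖∑ i ∈ s, c i * e (a / M * n i)‖ ^ 2 := by
    rw [Complex.norm_real, Real.norm_of_nonneg (by positivity)]
  rw [← h2, h]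
  refine (norm_sum_le _ _).trans ?_
  rw [Finset.card_filter, Nat.cast_sum, Finset.mul_sum]
  refine Finset.sum_le_sum fun w hw => ?_
  rw [Finset.mem_product] at hw
  rw [norm_mul, norm_mul, RCLike.norm_conj]
  have h1 := hc _ hw.1
  have h2 := hc _ hw.2
  have h3 : ‖c w.1‖ * ‖c w.2‖ ≤ 1 := mul_le_one₀ h1 (norm_nonneg _) h2
  split_ifs
  · simp only [RCLike.norm_natCast, Nat.cast_one, mul_one]
    exact mul_le_of_le_one_left (Nat.cast_nonneg _) h3
  · simp

theorem half_le_norm_sum_e {L : ℕ} {θ : ℝ} (hθ : |θ| ≤ 1 / (7 * L)) :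
    (L : ℝ) / 2 ≤ ‖∑ l ∈ Finset.range L, e (l * θ)‖ := by
  rcases Nat.eq_zero_or_pos L with rfl | hL
  · simp
  have hL' : (0 : ℝ) < L := by exact_mod_cast hL
  have h1 : ‖∑ l ∈ Finset.range L, (e (l * θ) - 1)‖ ≤ L / 2 := by
    refine (norm_sum_le_of_le _ (n := fun l : ℕ => 2 * Real.pi * |θ| * l) fun l _ => ?_).trans ?_
    · refine (norm_e_sub_one_le _).trans (le_of_eq ?_)
      rw [abs_mul, Nat.abs_cast]; ring
    · rw [← Finset.mul_sum]
      have h2 : (∑ l ∈ Finset.range L, (l : ℝ)) ≤ L ^ 2 / 2 := by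
        have := Finset.sum_range_id_mul_two L
        have h3 : ((∑ l ∈ Finset.range L, l : ℕ) : ℝ) * 2 ≤ L ^ 2 := by
          rw [sq]
          exact_mod_cast this.le.trans (Nat.mul_le_mul_left _ (Nat.sub_le _ _))
        push_cast at h3
        linarith
      calc 2 * Real.pi * |θ| * ∑ l ∈ Finset.range L, (l : ℝ)
          ≤ 2 * 3.15 * (1 / (7 * L)) * (L ^ 2 / 2) := by
            have := Real.pi_lt_d2
            have := Real.pi_pos
            gcongr
        _ ≤ L / 2 := by field_simp; norm_num
  rw [Finset.sum_sub_distrib] at h1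
  simp only [Finset.sum_const, Finset.card_range, nsmul_eq_mul, mul_one] at h1
  have h2 := norm_sub_norm_le (L : ℂ) (∑ l ∈ Finset.range L, e (l * θ))
  rw [RCLike.norm_natCast, norm_sub_rev] at h2
  linarith

theorem sum_arc_normSq_le {ι : Type*} {M L : ℕ} (hM : 0 < M) (hL : 0 < L) (s : Finset ι) (n : ι → ℤ)
    (hn : ∀ i ∈ s, ∀ j ∈ s, |n i - n j| + L ≤ M) (α : ℝ) :
    ∑ a ∈ (Finset.range M).filter (fun a : ℕ => |(a : ℝ) / M - α| ≤ 1 / (7 * L)),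
      ‖∑ i ∈ s, e (a / M * n i)‖ ^ 2 ≤
      4 * M / L * ((s ×ˢ s).filter fun w => |n w.1 - n w.2| < L).card := by
  have hL' : (0 : ℝ) < L := by exact_mod_cast hL
  set P := (s ×ˢ s).filter fun w => |n w.1 - n w.2| < L with hP
  have h1 : ∀ a ∈ (Finset.range M).filter (fun a : ℕ => |(a : ℝ) / M - α| ≤ 1 / (7 * L)),
      ‖∑ i ∈ s, e (a / M * n i)‖ ^ 2 ≤ 4 / L ^ 2 *
        ‖∑ w ∈ s ×ˢ Finset.range L, e (-(w.2 * α)) * e (a / M * (n w.1 + w.2 : ℤ))‖ ^ 2 := by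
    intro a ha
    have hD := half_le_norm_sum_e (Finset.mem_filter.1 ha).2
    have : ∑ w ∈ s ×ˢ Finset.range L, e (-(w.2 * α)) * e (a / M * (n w.1 + w.2 : ℤ)) =
        (∑ i ∈ s, e (a / M * n i)) * ∑ l ∈ Finset.range L, e (l * (a / M - α)) := by
      rw [Finset.sum_mul_sum, Finset.sum_product]
      refine Finset.sum_congr rfl fun i _ => Finset.sum_congr rfl fun l _ => ?_
      rw [← e_add, ← e_add]
      congr 1
      push_cast; ring
    rw [this, norm_mul, mul_pow]
    have h2 : (L / 2 : ℝ) ^ 2 ≤ ‖∑ l ∈ Finset.range L, e (l * (a / M - α))‖ ^ 2 := by gcongr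
    calc ‖∑ i ∈ s, e (a / M * n i)‖ ^ 2
        = 4 / L ^ 2 * (‖∑ i ∈ s, e (a / M * n i)‖ ^ 2 * (L / 2) ^ 2) := by field_simp; norm_num
      _ ≤ _ := by gcongr
  refine (Finset.sum_le_sum h1).trans ?_
  rw [← Finset.mul_sum]
  have h2 := sum_range_normSq_le hM (s ×ˢ Finset.range L) (fun w => n w.1 + w.2)
    (fun w => e (-(w.2 * α))) (fun w _ => (norm_e _).le)
  have h3 : (((s ×ˢ Finset.range L) ×ˢ (s ×ˢ Finset.range L)).filter
      fun w => (M : ℤ) ∣ (n w.1.1 + w.1.2) - (n w.2.1 + w.2.2)).card ≤ P.card * L := by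
    rw [← Finset.card_range L, ← Finset.card_product, Finset.card_range]
    refine Finset.card_le_card_of_injOn (fun w => ((w.1.1, w.2.1), w.1.2)) ?_ ?_
    · rintro ⟨⟨i, l⟩, ⟨j, m⟩⟩ hw
      simp only [Finset.coe_filter, Finset.mem_product, Finset.mem_range, Set.mem_ofPred_eq, hP,
        Finset.coe_product, Set.mem_prod, Finset.coe_range, Set.mem_Iio] at hw ⊢
      obtain ⟨⟨⟨hi, hl⟩, ⟨hj, hm⟩⟩, hd⟩ := hw
      have hb := hn i hi j hj
      have h0 : n i + l - (n j + m) = 0 := by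
        refine Int.eq_zero_of_abs_lt_dvd hd ?_
        have : |(l : ℤ) - m| < L := abs_lt.2 ⟨by omega, by omega⟩
        have h4 := abs_add_le (n i - n j) ((l : ℤ) - m)
        rw [show n i + l - (n j + m) = n i - n j + (l - m) by ring]
        linarith
      exact ⟨⟨⟨hi, hj⟩, abs_lt.2 ⟨by omega, by omega⟩⟩, hl⟩
    · rintro ⟨⟨i, l⟩, ⟨j, m⟩⟩ hw ⟨⟨i', l'⟩, ⟨j', m'⟩⟩ hw' h
      simp only [Prod.mk.injEq] at h
      obtain ⟨⟨rfl, rfl⟩, rfl⟩ := h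
      simp only [Finset.coe_filter, Finset.mem_product, Finset.mem_range, Set.mem_ofPred_eq] at hw hw'
      have hb := hn i hw.1.1.1 j hw.1.2.1
      have : (M : ℤ) ∣ (m' : ℤ) - m := by
        have := dvd_sub hw.2 hw'.2
        rwa [show n i + l - (n j + m) - (n i + l - (n j + m')) = (m' : ℤ) - m by ring] at this
      have h0 := Int.eq_zero_of_abs_lt_dvd this (abs_lt.2 ⟨by
        have := abs_nonneg (n i - n j); omega, by have := abs_nonneg (n i - n j); omega⟩)
      simp only [Prod.mk.injEq, true_and]
      omega
  calc 4 / (L : ℝ) ^ 2 * _ ≤ 4 / (L : ℝ) ^ 2 * (M * (P.card * L : ℕ)) := by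
        refine mul_le_mul_of_nonneg_left ?_ (by positivity)
        refine le_trans (Finset.sum_le_sum_of_subset_of_nonneg (Finset.filter_subset _ _)
          fun _ _ _ => by positivity) (h2.trans ?_)
        gcongr
    _ = _ := by push_cast; field_simp

theorem mul_pow_six_le_gPoly (v y : ℕ) : 1296 * v ^ 5 * y ^ 6 ≤ gPoly v y := by
  rw [gPoly]; exact Nat.le_add_left _ _

theorem gPoly_le {v : ℕ} (hv : 0 < v) (y : ℕ) : gPoly v y ≤ 1296 * v ^ 5 * (y + 1) ^ 6 := by
  have h (k : ℕ) (hk : k ≤ 5) : v ^ k ≤ v ^ 5 := Nat.pow_le_pow_right hv hk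
  have h0 := h 0 (by norm_num)
  have h1 := h 1 (by norm_num)
  rw [pow_zero] at h0
  rw [pow_one] at h1
  calc gPoly v y = 1 * y + 15 * v * y ^ 2 + 120 * v ^ 2 * y ^ 3 + 540 * v ^ 3 * y ^ 4 +
        1296 * v ^ 4 * y ^ 5 + 1296 * v ^ 5 * y ^ 6 := by rw [gPoly, one_mul]
    _ ≤ v ^ 5 * y + 15 * v ^ 5 * y ^ 2 + 120 * v ^ 5 * y ^ 3 + 540 * v ^ 5 * y ^ 4 +
        1296 * v ^ 5 * y ^ 5 + 1296 * v ^ 5 * y ^ 6 := by gcongr <;> norm_num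
    _ ≤ 1296 * v ^ 5 * (y + 1) ^ 6 := by
      rw [show 1296 * v ^ 5 * (y + 1) ^ 6 = v ^ 5 * (1296 * (y + 1) ^ 6) by ring]
      rw [show v ^ 5 * y + 15 * v ^ 5 * y ^ 2 + 120 * v ^ 5 * y ^ 3 + 540 * v ^ 5 * y ^ 4 +
        1296 * v ^ 5 * y ^ 5 + 1296 * v ^ 5 * y ^ 6 = v ^ 5 * (y + 15 * y ^ 2 + 120 * y ^ 3 +
        540 * y ^ 4 + 1296 * y ^ 5 + 1296 * y ^ 6) by ring]
      gcongr
      ring_nf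
      omega

theorem gPoly_succ_le {v : ℕ} (hv : 0 < v) (y : ℕ) :
    gPoly v (y + 1) ≤ gPoly v y + 6 * (1296 * v ^ 5) * (y + 2) ^ 5 := by
  have h (k : ℕ) (hk : k ≤ 5) : v ^ k ≤ v ^ 5 := Nat.pow_le_pow_right hv hk
  have h0 := h 0 (by norm_num)
  have h1 := h 1 (by norm_num)
  rw [pow_zero] at h0
  rw [pow_one] at h1
  calc gPoly v (y + 1) = gPoly v y + (1 + 15 * v * (2 * y + 1) +
        120 * v ^ 2 * (3 * y ^ 2 + 3 * y + 1) + 540 * v ^ 3 * (4 * y ^ 3 + 6 * y ^ 2 + 4 * y + 1) +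
        1296 * v ^ 4 * (5 * y ^ 4 + 10 * y ^ 3 + 10 * y ^ 2 + 5 * y + 1) +
        1296 * v ^ 5 * (6 * y ^ 5 + 15 * y ^ 4 + 20 * y ^ 3 + 15 * y ^ 2 + 6 * y + 1)) := by
        rw [gPoly, gPoly]; ring
    _ ≤ gPoly v y + (v ^ 5 + 15 * v ^ 5 * (2 * y + 1) +
        120 * v ^ 5 * (3 * y ^ 2 + 3 * y + 1) + 540 * v ^ 5 * (4 * y ^ 3 + 6 * y ^ 2 + 4 * y + 1) +
        1296 * v ^ 5 * (5 * y ^ 4 + 10 * y ^ 3 + 10 * y ^ 2 + 5 * y + 1) +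
        1296 * v ^ 5 * (6 * y ^ 5 + 15 * y ^ 4 + 20 * y ^ 3 + 15 * y ^ 2 + 6 * y + 1)) := by
        gcongr <;> norm_num
    _ ≤ gPoly v y + 6 * (1296 * v ^ 5) * (y + 2) ^ 5 := by
      gcongr
      rw [show 6 * (1296 * v ^ 5) * (y + 2) ^ 5 = v ^ 5 * (7776 * (y + 2) ^ 5) by ring]
      rw [show v ^ 5 + 15 * v ^ 5 * (2 * y + 1) +
        120 * v ^ 5 * (3 * y ^ 2 + 3 * y + 1) + 540 * v ^ 5 * (4 * y ^ 3 + 6 * y ^ 2 + 4 * y + 1) +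
        1296 * v ^ 5 * (5 * y ^ 4 + 10 * y ^ 3 + 10 * y ^ 2 + 5 * y + 1) +
        1296 * v ^ 5 * (6 * y ^ 5 + 15 * y ^ 4 + 20 * y ^ 3 + 15 * y ^ 2 + 6 * y + 1) = v ^ 5 *
        (7776 * y ^ 5 + 25920 * y ^ 4 + 41040 * y ^ 3 + 36000 * y ^ 2 + 16806 * y + 3268) by ring]
      gcongr
      ring_nf
      omega

theorem gPoly_add_le (v y d : ℕ) :
    gPoly v y + 6 * (1296 * v ^ 5) * y ^ 5 * d ≤ gPoly v (y + d) := by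
  have h : y ^ 6 + 6 * y ^ 5 * d ≤ (y + d) ^ 6 := by
    calc _ ≤ y ^ 6 + 6 * y ^ 5 * d + (15 * y ^ 4 * d ^ 2 + 20 * y ^ 3 * d ^ 3 + 15 * y ^ 2 * d ^ 4 +
        6 * y * d ^ 5 + d ^ 6) := Nat.le_add_right _ _
      _ = _ := by ring
  calc gPoly v y + 6 * (1296 * v ^ 5) * y ^ 5 * d = y + 15 * v * y ^ 2 + 120 * v ^ 2 * y ^ 3 +
        540 * v ^ 3 * y ^ 4 + 1296 * v ^ 4 * y ^ 5 + 1296 * v ^ 5 * (y ^ 6 + 6 * y ^ 5 * d) := by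
        rw [gPoly]; ring
    _ ≤ y + d + 15 * v * (y + d) ^ 2 + 120 * v ^ 2 * (y + d) ^ 3 +
        540 * v ^ 3 * (y + d) ^ 4 + 1296 * v ^ 4 * (y + d) ^ 5 + 1296 * v ^ 5 * (y + d) ^ 6 := by
        gcongr <;> omega
    _ = _ := by rw [gPoly]

theorem gPoly_mono (v : ℕ) : Monotone (gPoly v) := by
  intro x y h
  obtain ⟨d, rfl⟩ := Nat.exists_eq_add_of_le h
  exact (Nat.le_add_right _ _).trans (gPoly_add_le v x d)

theorem card_gPoly_sub_lt_le {v Y L : ℕ} (hv : 0 < v) (hY : 0 < Y) :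
    ((Finset.Ico Y (2 * Y) ×ˢ Finset.Ico Y (2 * Y)).filter
      fun w => |((gPoly v w.1 : ℕ) : ℤ) - (gPoly v w.2 : ℕ)| < L).card ≤
      Y * (2 * (L / (6 * (1296 * v ^ 5) * Y ^ 5)) + 1) := by
  set K := L / (6 * (1296 * v ^ 5) * Y ^ 5) with hK
  have key : ∀ x y, Y ≤ x → x ≤ y → |((gPoly v x : ℕ) : ℤ) - (gPoly v y : ℕ)| < L → y ≤ x + K := by
    intro x y hx hxy h
    obtain ⟨d, rfl⟩ := Nat.exists_eq_add_of_le hxy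
    have h1 := gPoly_add_le v x d
    have h2 : d * (6 * (1296 * v ^ 5) * Y ^ 5) ≤ L := by
      have h3 : 6 * (1296 * v ^ 5) * Y ^ 5 * d ≤ 6 * (1296 * v ^ 5) * x ^ 5 * d := by gcongr
      rw [abs_lt] at h
      rw [mul_comm]
      omega
    have := (Nat.le_div_iff_mul_le (by positivity)).2 h2
    omega
  calc _ ≤ ((Finset.Ico Y (2 * Y)).sigma fun y => Finset.Icc (y - K) (y + K)).card := by
        refine Finset.card_le_card_of_injOn (fun w => ⟨w.1, w.2⟩) ?_ ?_
        · rintro ⟨x, y⟩ h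
          simp only [Finset.coe_filter, Finset.mem_product, Finset.mem_Ico, Set.mem_ofPred_eq] at h
          obtain ⟨⟨⟨h1, h2⟩, h3, h4⟩, h5⟩ := h
          simp only [Finset.coe_sigma, Set.mem_sigma_iff, Finset.mem_coe, Finset.mem_Ico,
            Finset.mem_Icc]
          rcases le_total x y with hxy | hxy
          · have := key x y h1 hxy h5
            omega
          · have := key y x h3 hxy (by rwa [abs_sub_comm])
            omega
        · rintro ⟨x, y⟩ - ⟨x', y'⟩ - h
          simp only [Sigma.mk.injEq, heq_eq_eq] at h
          exact Prod.ext h.1 h.2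
    _ ≤ ∑ y ∈ Finset.Ico Y (2 * Y), (2 * K + 1) := by
        rw [Finset.card_sigma]
        refine Finset.sum_le_sum fun y _ => ?_
        rw [Nat.card_Icc]
        omega
    _ = Y * (2 * K + 1) := by
        rw [Finset.sum_const, Nat.card_Ico, smul_eq_mul]
        congr 1
        omega

/-- The exponential sum of `α * gPoly v y` over `Y ≤ y < 2Y`. -/
noncomputable def ySum (v Y : ℕ) (α : ℝ) : ℂ :=
  ∑ y ∈ Finset.Ico Y (2 * Y), e (α * gPoly (v : ℝ) y)

theorem norm_ySum_pow_le {v Y : ℕ} (hY : 0 < Y) (α : ℝ) :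
    ‖ySum v Y α‖ ^ 32 ≤ (2 * Y) ^ 26 * weylSum Y 5 ((720 * (1296 * v ^ 5) : ℕ) * α) := by
  have h1 : HasDifference 5 (fun x : ℤ => α * gPoly (v : ℝ) x)
      ((720 * (1296 * v ^ 5) : ℕ) * α) := by
    refine (hasDifference_sextic 0 α (α * 15 * v) (α * 120 * v ^ 2) (α * 540 * v ^ 3)
      (α * 1296 * v ^ 4) (α * 1296 * v ^ 5)).congr (fun x => ?_) ?_
    · rw [gPoly]; ring
    · push_cast; ring
  have h2 := weyl_inequality hY 5 (a := Y) (b := 2 * Y) (by omega) h1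
  have h3 : ySum v Y α = ∑ x ∈ Finset.Ico (Y : ℤ) (2 * Y), e (α * gPoly (v : ℝ) x) := by
    rw [ySum]
    refine Finset.sum_nbij (fun y : ℕ => (y : ℤ)) ?_ ?_ ?_ ?_
    · intro y hy
      simp only [Finset.mem_Ico] at hy ⊢
      omega
    · exact Nat.cast_injective.injOn
    · intro x hx
      simp only [Finset.coe_Ico, Set.mem_Ico] at hx
      exact ⟨x.toNat, by simp; omega, by simp; omega⟩
    · intro y _
      rw [Int.cast_natCast]
  rw [h3]
  exact h2

theorem two_pow_mul_le {c z : ℝ} (hc : c ≤ 2 ^ 1086) (hz : 2 ^ 4300 ≤ z) : 2 ^ 200 * c ≤ z := by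
  calc 2 ^ 200 * c ≤ 2 ^ 200 * 2 ^ 1086 := mul_le_mul_of_nonneg_left hc (by norm_num)
    _ = 2 ^ 1286 := by rw [← pow_add]
    _ ≤ 2 ^ 4300 := pow_le_pow_right₀ one_le_two (by norm_num)
    _ ≤ z := hz

theorem minor_aux {z L c S : ℝ} (hc0 : 0 ≤ c) (hc : c ≤ 2 ^ 1086) (hz : 2 ^ 4300 ≤ z)
    (hL0 : 0 ≤ L) (hL : L ≤ 33 * Real.log z) (hS0 : 0 ≤ S)
    (hS : S ^ 2 ≤ 5000 * c * L ^ 26 * z ^ 67) : 2 ^ 333 * (160 * z ^ 30 + 32 * S) ≤ z ^ 34 := by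
  have hz0 : (0 : ℝ) < z := lt_of_lt_of_le (by positivity) hz
  obtain ⟨s, hs0, hs⟩ : ∃ s : ℝ, 0 < s ∧ s ^ 52 = z := ⟨z ^ (1 / 52 : ℝ), by positivity, by
    rw [← Real.rpow_natCast, ← Real.rpow_mul hz0.le]; norm_num⟩
  have hlog : Real.log z ≤ 52 * s := by
    rw [← hs, Real.log_pow]
    have := Real.log_le_sub_one_of_pos hs0
    push_cast
    linarith
  have hs26 : (2 : ℝ) ^ 2150 ≤ s ^ 26 := by
    refine (pow_le_pow_iff_left₀ (by positivity) (by positivity) two_ne_zero).1 ?_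
    rw [← pow_mul, ← pow_mul]
    exact hz.trans hs.ge
  have hL26 : L ^ 26 ≤ 2 ^ 280 * s ^ 26 := by
    calc L ^ 26 ≤ (33 * (52 * s)) ^ 26 := by gcongr; linarith
      _ = (33 * 52) ^ 26 * s ^ 26 := by ring
      _ ≤ 2 ^ 280 * s ^ 26 := by
        gcongr
        rw [show (280 : ℕ) = 140 + 140 by norm_num, pow_add]
        norm_num
  have h1 : S ^ 2 ≤ (z ^ 34 / 2 ^ 340) ^ 2 := by
    refine hS.trans ?_
    calc 5000 * c * L ^ 26 * z ^ 67 ≤ 2 ^ 13 * 2 ^ 1086 * (2 ^ 280 * s ^ 26) * z ^ 67 := by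
          gcongr
          norm_num
      _ = 2 ^ 1379 * s ^ 26 * z ^ 67 := by
          rw [show (1379 : ℕ) = 13 + 1086 + 280 by norm_num, pow_add, pow_add]; ring
      _ ≤ s ^ 26 * s ^ 26 * z ^ 67 / (2 ^ 340) ^ 2 := by
          rw [le_div_iff₀ (by positivity)]
          calc 2 ^ 1379 * s ^ 26 * z ^ 67 * (2 ^ 340) ^ 2 =
              2 ^ 2059 * s ^ 26 * z ^ 67 := by
                rw [show (2059 : ℕ) = 1379 + 340 * 2 by norm_num, pow_add, pow_mul]; ring
            _ ≤ _ := by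
              gcongr
              exact le_trans (pow_le_pow_right₀ (by norm_num) (by norm_num)) hs26
      _ = _ := by
        rw [div_pow, ← pow_add, ← pow_mul z, hs]
        congr 1
        ring
  have h2 : S ≤ z ^ 34 / 2 ^ 340 := (pow_le_pow_iff_left₀ hS0 (by positivity) two_ne_zero).1 h1
  have h3 : (2 : ℝ) ^ 345 ≤ z := le_trans (pow_le_pow_right₀ (by norm_num) (by norm_num)) hz
  have h4 : (2 : ℝ) ^ 345 * z ^ 30 ≤ z ^ 34 := by
    have h5 : 1 ≤ z := le_trans (one_le_pow₀ (by norm_num)) hz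
    calc (2 : ℝ) ^ 345 * z ^ 30 ≤ z ^ 4 * z ^ 30 := by
          gcongr
          exact h3.trans (le_self_pow₀ h5 (by norm_num))
      _ = z ^ 34 := by ring
  calc (2 : ℝ) ^ 333 * (160 * z ^ 30 + 32 * S) ≤
        2 ^ 333 * (2 ^ 8 * z ^ 30 + 2 ^ 5 * (z ^ 34 / 2 ^ 340)) := by
        gcongr <;> norm_num
    _ = 2 ^ 345 * z ^ 30 / 2 ^ 4 + z ^ 34 / 2 ^ 2 := by
      rw [show (345 : ℕ) = 333 + 8 + 4 by norm_num, show (340 : ℕ) = 333 + 7 by norm_num, pow_add,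
        pow_add, pow_add]
      have : (2 : ℝ) ^ 333 ≠ 0 := by positivity
      generalize (2 : ℝ) ^ 333 = a at this
      field_simp
    _ ≤ z ^ 34 := by
      have : 0 ≤ z ^ 34 := by positivity
      norm_num only
      linarith

theorem norm_ySum_minor_le {v z q : ℕ} (hv : 0 < v) (hc : 1296 * v ^ 5 ≤ 2 ^ 1086)
    (hz : 2 ^ 4300 ≤ z) (hq1 : z ^ 5 < q) (hq2 : q ≤ 7 * (1296 * v ^ 5) * z ^ 31)
    {b : ℤ} (hb : IsCoprime b (q : ℤ)) {α : ℝ} (hα : |α - b / q| ≤ 1 / q ^ 2) :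
    ‖ySum v (z ^ 6) α‖ ^ 32 * 2 ^ 307 ≤ (z : ℝ) ^ 190 := by
  have hz0 : 0 < z := lt_of_lt_of_le (pow_pos two_pos _) hz
  have hq : 0 < q := by omega
  obtain ⟨S, hS0, hS1, hS2⟩ := weylSum_five_le (Y := z ^ 6) hq hb hα
    (c := 720 * (1296 * v ^ 5)) (Nat.mul_pos (by norm_num) (Nat.mul_pos (by norm_num) (pow_pos hv 5)))
  have h1 := norm_ySum_pow_le (v := v) (Y := z ^ 6) (pow_pos hz0 6) α
  generalize hcd : 1296 * v ^ 5 = c at *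
  have hc0 : 0 < c := hcd ▸ Nat.mul_pos (by norm_num) (pow_pos hv 5)
  have hzR : (2 : ℝ) ^ 4300 ≤ z := by rw [← Nat.cast_ofNat, ← Nat.cast_pow, Nat.cast_le]; exact hz
  have hcR : (c : ℝ) ≤ 2 ^ 1086 := by rw [← Nat.cast_ofNat, ← Nat.cast_pow, Nat.cast_le]; exact hc
  have hz0R : (0 : ℝ) < z := Nat.cast_pos.2 hz0
  have hz1R : (1 : ℝ) ≤ z := Nat.one_le_cast.2 hz0
  have hc1R : (1 : ℝ) ≤ c := Nat.one_le_cast.2 hc0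
  have haux (L : ℝ) := minor_aux (L := L) (S := S) (zero_le_one.trans hc1R) hcR hzR
  have h7c : 7 * (c : ℝ) ≤ z :=
    (mul_le_mul_of_nonneg_right (by norm_num) (by linarith)).trans (two_pow_mul_le hcR hzR)
  have h4z : (2 : ℝ) ^ 2 ≤ z := le_trans (pow_le_pow_right₀ (by norm_num) (by norm_num)) hzR
  clear hz hc hzR hcR
  have hqR : (1 : ℝ) ≤ q := by exact_mod_cast hq
  have hq0R : (0 : ℝ) < q := by exact_mod_cast hq
  have hq1R : (z : ℝ) ^ 5 ≤ q := by exact_mod_cast hq1.le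
  have hq2R : (q : ℝ) ≤ 7 * c * z ^ 31 := by exact_mod_cast hq2
  have hlz : 1 ≤ Real.log z := by
    rw [Real.le_log_iff_exp_le hz0R]
    have := Real.exp_one_lt_d9
    linarith
  have hLq : 1 + Real.log q ≤ 33 * Real.log z := by
    have : Real.log q ≤ Real.log ((z : ℝ) ^ 32) := by
      refine Real.log_le_log hq0R (hq2R.trans ?_)
      calc 7 * (c : ℝ) * z ^ 31 ≤ z * z ^ 31 := by gcongr
        _ = _ := by ring
    rw [Real.log_pow] at this
    push_cast at this
    linarith
  have hLY : 1 + Real.log (((z ^ 6 : ℕ) : ℝ) ^ 5) ≤ 33 * Real.log z := by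
    push_cast
    rw [← pow_mul, Real.log_pow]
    push_cast
    linarith
  have hLY0 : 0 ≤ 1 + Real.log (((z ^ 6 : ℕ) : ℝ) ^ 5) := by
    push_cast
    rw [← pow_mul, Real.log_pow]
    push_cast
    linarith
  have hLq0 : 0 ≤ 1 + Real.log (q : ℝ) := by have := Real.log_nonneg hqR; linarith
  set L := 33 * Real.log z with hL
  have hL1 : 1 ≤ L := by linarith
  have h2 : 2 ^ 333 * (160 * (z : ℝ) ^ 30 + 32 * S) ≤ (z : ℝ) ^ 34 := by
    refine haux L (by linarith) le_rfl hS0 (hS2.trans ?_)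
    have h3 : (((720 * c * (z ^ 6) ^ 5 : ℕ) : ℝ) / q + 1) * (4 * (z ^ 6 : ℕ) +
        2 * q * (1 + Real.log q)) ≤ 5000 * c * z ^ 31 * L := by
      have e1 : ((720 * c * (z ^ 6) ^ 5 : ℕ) : ℝ) / q ≤ 720 * c * z ^ 25 := by
        rw [div_le_iff₀ hq0R]
        push_cast
        calc 720 * (c : ℝ) * (z ^ 6) ^ 5 = 720 * c * z ^ 25 * z ^ 5 := by ring
          _ ≤ _ := by gcongr
      have e2 : ((720 * c * (z ^ 6) ^ 5 : ℕ) : ℝ) / q * q = 720 * c * z ^ 30 := by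
        rw [div_mul_cancel₀ _ hq0R.ne']; push_cast; ring
      have e3 : (z : ℝ) ^ 30 ≤ z ^ 31 := pow_le_pow_right₀ hz1R (by norm_num)
      have e4 : (z : ℝ) ^ 6 ≤ z ^ 31 := pow_le_pow_right₀ hz1R (by norm_num)
      have e5 : (z : ℝ) ^ 31 ≤ c * z ^ 31 * L := by
        calc (z : ℝ) ^ 31 = 1 * z ^ 31 * 1 := by ring
          _ ≤ _ := by gcongr
      calc _ = ((720 * c * (z ^ 6) ^ 5 : ℕ) : ℝ) / q * (4 * z ^ 6) +
            2 * (((720 * c * (z ^ 6) ^ 5 : ℕ) : ℝ) / q * q) * (1 + Real.log q) +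
            4 * z ^ 6 + 2 * q * (1 + Real.log q) := by push_cast; ring
        _ ≤ 720 * c * z ^ 25 * (4 * z ^ 6) + 2 * (720 * c * z ^ 30) * L + 4 * z ^ 31 +
            2 * (7 * c * z ^ 31) * L := by rw [e2]; gcongr
        _ = 2880 * (c * z ^ 31) + 1440 * (c * z ^ 30 * L) + 4 * z ^ 31 + 14 * (c * z ^ 31 * L) := by
          ring
        _ ≤ 5000 * (c * z ^ 31 * L) := by
          have e6 : (c : ℝ) * z ^ 31 ≤ c * z ^ 31 * L := le_mul_of_one_le_right (by positivity) hL1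
          have e7 : (c : ℝ) * z ^ 30 * L ≤ c * z ^ 31 * L := by gcongr
          have e8 : 0 ≤ (c : ℝ) * z ^ 31 * L := by positivity
          linarith
        _ = _ := by ring
    calc _ ≤ ((z ^ 6 : ℕ) : ℝ) ^ 5 * L ^ 25 * ((z ^ 6 : ℕ) * (5000 * c * z ^ 31 * L)) := by
          gcongr
      _ = _ := by push_cast; ring
  have h0 : weylSum (z ^ 6) 5 ((720 * c : ℕ) * α) ≤ 160 * (z : ℝ) ^ 30 + 32 * S := by
    refine hS1.trans (le_of_eq ?_)
    push_cast; ring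
  calc ‖ySum v (z ^ 6) α‖ ^ 32 * 2 ^ 307 ≤
        (2 * ((z ^ 6 : ℕ) : ℝ)) ^ 26 * (160 * (z : ℝ) ^ 30 + 32 * S) * 2 ^ 307 := by
        refine mul_le_mul_of_nonneg_right (h1.trans ?_) (by positivity)
        gcongr
    _ = z ^ 156 * (2 ^ 333 * (160 * (z : ℝ) ^ 30 + 32 * S)) := by
      push_cast
      rw [show (333 : ℕ) = 26 + 307 by norm_num, pow_add]; ring
    _ ≤ z ^ 156 * z ^ 34 := by gcongr
    _ = _ := by rw [← pow_add]

theorem norm_ySum_major_le {v z q : ℕ} (hv : 0 < v) (hz : 10 ^ 30 * (1296 * v ^ 5) ≤ z)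
    (hq1 : 1 < q) (hqz : q ≤ z ^ 5) (hV : ∀ p : ℕ, p.Prime → p < 167 → p ∣ v)
    {b : ℤ} (hb : IsCoprime b (q : ℤ)) {α : ℝ}
    (hα : |α - b / q| ≤ 1 / (7 * (1296 * v ^ 5) * z ^ 31 * q)) :
    ‖ySum v (z ^ 6) α‖ ^ 30 * (max q 167 : ℕ) ^ 5 ≤ 1.35 * ((z : ℝ) ^ 6) ^ 30 := by
  have hv0 : (0 : ℝ) < v := by exact_mod_cast hv
  have hv5 : 0 < v ^ 5 := pow_pos hv 5
  have hz30 : 10 ^ 30 ≤ z := by omega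
  have hzR : (10 : ℝ) ^ 30 ≤ z := by exact_mod_cast hz30
  have hz0 : (0 : ℝ) < z := lt_of_lt_of_le (by positivity) hzR
  have hq0 : (0 : ℝ) < q := by exact_mod_cast hq1.le
  have hqzR : (q : ℝ) ≤ (z : ℝ) ^ 5 := by exact_mod_cast hqz
  set D : ℝ := 198 * (1296 * v ^ 5) * z ^ 30 with hD
  have h1 := norm_sum_le_gSum (Y := z ^ 6) (by omega) hα (D := D) (by positivity) (by
    intro y hy
    have h1 := gPoly_succ_le hv y
    have h2 := gPoly_mono v (Nat.le_add_right y 1)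
    have h3 : ((gPoly v (y + 1) : ℕ) : ℝ) ≤
        (gPoly v y : ℕ) + 6 * (1296 * v ^ 5) * (y + 2) ^ 5 := by exact_mod_cast h1
    have h4 : ((gPoly v y : ℕ) : ℝ) ≤ (gPoly v (y + 1) : ℕ) := by exact_mod_cast h2
    rw [← natCast_gPoly, ← natCast_gPoly, abs_of_nonneg (by linarith)]
    have h5 : (y + 2 : ℝ) ≤ 2.01 * z ^ 6 := by
      have h6 : (y + 2 : ℝ) ≤ 2 * z ^ 6 + 1 := by exact_mod_cast (by omega : y + 2 ≤ 2 * z ^ 6 + 1)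
      have h7 : (100 : ℝ) ≤ z ^ 6 :=
        le_trans (by linarith) (le_self_pow₀ (by linarith : (1 : ℝ) ≤ z) (by norm_num))
      linarith
    calc _ ≤ 6 * (1296 * (v : ℝ) ^ 5) * (y + 2) ^ 5 := by linarith
      _ ≤ 6 * (1296 * (v : ℝ) ^ 5) * (2.01 * z ^ 6) ^ 5 := by gcongr
      _ = 6 * 2.01 ^ 5 * ((1296 * (v : ℝ) ^ 5) * z ^ 30) := by ring
      _ ≤ 198 * ((1296 * (v : ℝ) ^ 5) * z ^ 30) := by gcongr; norm_num
      _ = D := by rw [hD]; ring)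
  have h2 := norm_gSum_le hV hq1 hb
  rw [← ySum] at h1
  have hm0 : (0 : ℝ) < (max q 167 : ℕ) := by positivity
  obtain ⟨t, ht0, ht⟩ : ∃ t : ℝ, 0 < t ∧ t ^ 6 = (max q 167 : ℕ) :=
    ⟨((max q 167 : ℕ) : ℝ) ^ (1 / 6 : ℝ), by positivity, by
      rw [← Real.rpow_natCast, ← Real.rpow_mul hm0.le]; norm_num⟩
  have hmz : ((max q 167 : ℕ) : ℝ) ≤ z ^ 5 := by
    have : max q 167 ≤ z ^ 5 := max_le hqz <|
      le_trans (by omega : 167 ≤ z) (Nat.le_self_pow (by norm_num) z)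
    exact_mod_cast this
  have htz : 18000 * t ≤ z := by
    refine (pow_le_pow_iff_left₀ (by positivity) hz0.le (by norm_num : 6 ≠ 0)).1 ?_
    calc (18000 * t) ^ 6 = 18000 ^ 6 * t ^ 6 := by ring
      _ ≤ 10 ^ 30 * (z : ℝ) ^ 5 := by rw [ht]; gcongr; norm_num
      _ ≤ z * (z : ℝ) ^ 5 := by gcongr
      _ = (z : ℝ) ^ 6 := by ring
  have hS : ‖gSum v q b‖ * t ≤ q := by
    refine (pow_le_pow_iff_left₀ (by positivity) hq0.le (by norm_num : 6 ≠ 0)).1 ?_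
    rw [mul_pow, ht]
    exact_mod_cast h2
  have h3 : ‖ySum v (z ^ 6) α‖ ≤ z ^ 6 / q * ‖gSum v q b‖ + 180 * z ^ 5 := by
    refine h1.trans ?_
    have h4 : 2 * Real.pi * (1 / (7 * (1296 * (v : ℝ) ^ 5) * z ^ 31 * q)) * D * q ^ 2 =
        396 / 7 * Real.pi * (q / z) := by
      rw [hD]
      field_simp
      ring
    rw [h4]
    have h5 := Real.pi_lt_d2
    have h6 := Real.pi_pos
    calc _ = (z : ℝ) ^ 6 / q * ‖gSum v q b‖ + 396 / 7 * Real.pi * z ^ 5 + q := by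
          push_cast
          field_simp
      _ ≤ (z : ℝ) ^ 6 / q * ‖gSum v q b‖ + 396 / 7 * 3.15 * z ^ 5 + z ^ 5 := by
          gcongr
      _ ≤ _ := by
        have : (0 : ℝ) < z ^ 5 := by positivity
        linarith
  have h4 : ‖ySum v (z ^ 6) α‖ * t ≤ 1.01 * z ^ 6 := by
    calc _ ≤ ((z : ℝ) ^ 6 / q * ‖gSum v q b‖ + 180 * z ^ 5) * t := by gcongr
      _ = (z : ℝ) ^ 6 / q * (‖gSum v q b‖ * t) + 0.01 * z ^ 5 * (18000 * t) := by ring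
      _ ≤ (z : ℝ) ^ 6 / q * q + 0.01 * z ^ 5 * z := by gcongr
      _ = 1.01 * (z : ℝ) ^ 6 := by field_simp; ring
  calc ‖ySum v (z ^ 6) α‖ ^ 30 * (max q 167 : ℕ) ^ 5 = (‖ySum v (z ^ 6) α‖ * t) ^ 30 := by
        rw [← ht]; ring
    _ ≤ (1.01 * (z : ℝ) ^ 6) ^ 30 := by gcongr
    _ = 1.01 ^ 30 * ((z : ℝ) ^ 6) ^ 30 := mul_pow _ _ _
    _ ≤ _ := by gcongr; norm_num

theorem ySum_eq (v Y M a : ℕ) :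
    ySum v Y (a / M) = ∑ y ∈ Finset.Ico Y (2 * Y), e (a / M * ((gPoly v y : ℕ) : ℤ)) := by
  rw [ySum]
  refine Finset.sum_congr rfl fun y _ => ?_
  rw [Int.cast_natCast, natCast_gPoly]

theorem gPoly_le_of_lt {v z y : ℕ} (hv : 0 < v) (hy : y < 2 * z ^ 6) :
    gPoly v y ≤ 64 * (1296 * v ^ 5 * z ^ 36) := by
  calc gPoly v y ≤ 1296 * v ^ 5 * (y + 1) ^ 6 := gPoly_le hv y
    _ ≤ 1296 * v ^ 5 * (2 * z ^ 6) ^ 6 := by gcongr; omega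
    _ = _ := by ring

theorem sum_arc_ySum_le {v z q : ℕ} (hv : 0 < v) (hz : 100 ≤ z) (hq : 0 < q) (hqz : q ≤ z ^ 5)
    (α : ℝ) {M : ℕ} (hM : M = 10 ^ 4 * (1296 * v ^ 5 * z ^ 36)) :
    ∑ a ∈ (Finset.range M).filter
        (fun a : ℕ => |(a : ℝ) / M - α| ≤ 1 / (7 * (1296 * v ^ 5) * z ^ 31 * q)),
      ‖ySum v (z ^ 6) (a / M)‖ ^ 2 ≤ 1.4 * M / (1296 * v ^ 5 * z ^ 24) := by
  have hz0 : 0 < z := by omega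
  have hv0 : (0 : ℝ) < v := by exact_mod_cast hv
  have hz0R : (0 : ℝ) < z := by exact_mod_cast hz0
  have hzR : (100 : ℝ) ≤ z := by exact_mod_cast hz
  have hq0 : (0 : ℝ) < q := by exact_mod_cast hq
  have hq1 : (1 : ℝ) ≤ q := by exact_mod_cast hq
  have hM0 : 0 < M := by rw [hM]; positivity
  have hM0R : (0 : ℝ) < M := by exact_mod_cast hM0
  set L := q * (1296 * v ^ 5) * z ^ 31 with hL
  have hL0 : 0 < L := by positivity
  have hLT : L ≤ 1296 * v ^ 5 * z ^ 36 := by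
    calc L ≤ z ^ 5 * (1296 * v ^ 5) * z ^ 31 := by rw [hL]; gcongr
      _ = _ := by ring
  have h1 := sum_arc_normSq_le hM0 hL0 (Finset.Ico (z ^ 6) (2 * z ^ 6))
    (fun y => ((gPoly v y : ℕ) : ℤ)) (by
      intro i hi j hj
      have h1 := gPoly_le_of_lt hv (Finset.mem_Ico.1 hi).2
      have h2 := gPoly_le_of_lt hv (Finset.mem_Ico.1 hj).2
      have h3 : |((gPoly v i : ℕ) : ℤ) - (gPoly v j : ℕ)| ≤
          ((64 * (1296 * v ^ 5 * z ^ 36) : ℕ) : ℤ) := by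
        rw [abs_le]; constructor <;> omega
      rw [hM]
      generalize 1296 * v ^ 5 * z ^ 36 = T at *
      push_cast at *
      omega) α
  simp only [← ySum_eq] at h1
  have hLe : (7 * (1296 * v ^ 5) * z ^ 31 * q : ℝ) = 7 * (L : ℝ) := by rw [hL]; push_cast; ring
  rw [hLe]
  refine h1.trans ?_
  have h2 := card_gPoly_sub_lt_le (L := L) hv (pow_pos hz0 6)
  have h3 : ((L / (6 * (1296 * v ^ 5) * (z ^ 6) ^ 5) : ℕ) : ℝ) ≤ q * z / 6 := by
    refine Nat.cast_div_le.trans (le_of_eq ?_)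
    rw [hL]
    push_cast
    field_simp
  have h4 := (Nat.cast_le (α := ℝ)).2 h2
  push_cast at h3 h4
  calc _ ≤ 4 * (M : ℝ) / L * (z ^ 6 * (2 * (q * z / 6) + 1)) := by
        gcongr
        exact h4.trans (by gcongr)
    _ = M / (1296 * v ^ 5 * z ^ 24) * (4 / 3 + 4 / (q * z)) := by
        rw [hL]; push_cast; field_simp; ring
    _ ≤ M / (1296 * v ^ 5 * z ^ 24) * 1.4 := by
        gcongr
        have : 4 / (q * z : ℝ) ≤ 4 / (1 * 100) := by gcongr
        linarith
    _ = _ := by ring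

theorem e_sum {ι : Type*} (s : Finset ι) (x : ι → ℝ) : e (∑ i ∈ s, x i) = ∏ i ∈ s, e (x i) := by
  classical
  induction s using Finset.induction_on with
  | empty => simp [e_zero]
  | insert i s hi ih => rw [Finset.sum_insert hi, Finset.prod_insert hi, e_add, ih]

theorem sum_product_e {ι κ : Type*} (s : Finset ι) (t : Finset κ) (m : ι → ℤ) (n : κ → ℤ) (α : ℝ) :
    ∑ w ∈ s ×ˢ t, e (α * (m w.1 + n w.2 : ℤ)) =
      (∑ i ∈ s, e (α * m i)) * ∑ j ∈ t, e (α * n j) := by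
  rw [Finset.sum_mul_sum, Finset.sum_product]
  refine Finset.sum_congr rfl fun i _ => Finset.sum_congr rfl fun j _ => ?_
  rw [← e_add]
  push_cast
  ring_nf

theorem sum_piFinset_e {ι : Type*} [DecidableEq ι] (k : ℕ) (s : Finset ι) (m : ι → ℤ) (α : ℝ) :
    ∑ x ∈ Fintype.piFinset fun _ : Fin k => s, e (α * (∑ i, m (x i) : ℤ)) =
      (∑ i ∈ s, e (α * m i)) ^ k := by
  have h := Finset.prod_univ_sum (fun _ : Fin k => s) fun _ i => e (α * m i)
  rw [Finset.prod_const, Finset.card_univ, Fintype.card_fin] at h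
  rw [h]
  refine Finset.sum_congr rfl fun x _ => ?_
  rw [← e_sum]
  push_cast
  rw [Finset.mul_sum]

theorem card_filter_le_sum_norm {ι : Type*} (W : Finset ι) (N : ι → ℤ) (n : ℤ) {M H : ℕ} (hM : 0 < M)
    (hN : ∀ w ∈ W, ∀ h < H, |N w + h - n| < M) (h0 : ∀ w ∈ W, N w ≠ n) :
    (M : ℝ) * (W.filter fun w => N w ≤ n ∧ n < N w + H).card ≤
      ∑ a ∈ Finset.range M, ‖∑ w ∈ W, e (a / M * N w)‖ *
        ‖∑ h ∈ Finset.range H, (e (a / M * h) - 1)‖ := by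
  have : NeZero M := ⟨hM.ne'⟩
  have h1 : ∀ w ∈ W, ∀ h < H, ∑ a ∈ Finset.range M, e (a / M * (N w + h - n : ℤ)) =
      if N w + h = n then (M : ℂ) else 0 := by
    intro w hw h hh
    rw [sum_range_e_div]
    refine if_congr ⟨fun hd => ?_, fun hd => ?_⟩ rfl rfl
    · have := Int.eq_zero_of_abs_lt_dvd hd (hN w hw h hh)
      omega
    · rw [hd, sub_self]; exact dvd_zero _
  have h2 : ∑ a ∈ Finset.range M, (∑ w ∈ W, e (a / M * N w)) * e (-(a / M * n)) *
      ∑ h ∈ Finset.range H, (e (a / M * h) - 1) =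
      M * (W.filter fun w => N w ≤ n ∧ n < N w + H).card := by
    calc _ = ∑ w ∈ W, ∑ h ∈ Finset.range H, ∑ a ∈ Finset.range M,
          (e (a / M * (N w + h - n : ℤ)) - e (a / M * (N w + (0 : ℕ) - n : ℤ))) := by
          simp_rw [Finset.sum_mul, Finset.mul_sum]
          rw [Finset.sum_comm]
          refine Finset.sum_congr rfl fun w _ => ?_
          rw [Finset.sum_comm]
          refine Finset.sum_congr rfl fun h _ => Finset.sum_congr rfl fun a _ => ?_
          rw [mul_sub, mul_one, ← e_add, ← e_add]
          push_cast
          ring_nf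
      _ = ∑ w ∈ W, ∑ h ∈ Finset.range H, if N w + h = n then (M : ℂ) else 0 := by
          refine Finset.sum_congr rfl fun w hw => Finset.sum_congr rfl fun h hh => ?_
          have hh := Finset.mem_range.1 hh
          rw [Finset.sum_sub_distrib, h1 w hw h hh, h1 w hw 0 (by omega),
            if_neg (c := N w + (0 : ℕ) = n), sub_zero]
          rw [Nat.cast_zero, add_zero]
          exact h0 w hw
      _ = ∑ w ∈ W, if N w ≤ n ∧ n < N w + H then (M : ℂ) else 0 := by
          refine Finset.sum_congr rfl fun w hw => ?_
          split_ifs with h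
          · rw [Finset.sum_eq_single (n - N w).toNat]
            · rw [if_pos (by omega)]
            · intro h' _ h''
              rw [if_neg (by omega)]
            · intro h'
              rw [Finset.mem_range] at h'
              omega
          · refine Finset.sum_eq_zero fun h' hh => ?_
            have hh := Finset.mem_range.1 hh
            rw [if_neg (by omega)]
      _ = _ := by
          rw [← Finset.sum_filter, Finset.sum_const, nsmul_eq_mul, mul_comm]
  calc (M : ℝ) * (W.filter fun w => N w ≤ n ∧ n < N w + H).card =
        ‖(M : ℂ) * (W.filter fun w => N w ≤ n ∧ n < N w + H).card‖ := by
        rw [norm_mul, RCLike.norm_natCast, RCLike.norm_natCast]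
    _ ≤ _ := by
      rw [← h2]
      refine (norm_sum_le _ _).trans (le_of_eq (Finset.sum_congr rfl fun a _ => ?_))
      rw [norm_mul, norm_mul, norm_e, mul_one]

theorem exists_gPoly_le_lt {v z m : ℕ} (hv : 0 < v) (hz : 10 ≤ z)
    (h1 : 64 * (1296 * v ^ 5 * z ^ 36) ≤ m) (h2 : m ≤ 4000 * (1296 * v ^ 5 * z ^ 36)) :
    ∃ y ∈ Finset.Icc 1 (4 * z ^ 6), gPoly v y ≤ m ∧ m < gPoly v y + 6200 * (1296 * v ^ 5) * z ^ 30 := by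
  classical
  have hz6 : 10 ^ 6 ≤ z ^ 6 := Nat.pow_le_pow_left hz 6
  have hv5 : 0 < 1296 * v ^ 5 := by positivity
  have hg1 : gPoly v 1 ≤ m := by
    refine (gPoly_le hv 1).trans (le_trans ?_ h1)
    have : 1 ≤ z ^ 36 := Nat.one_le_pow _ _ (by omega)
    calc 1296 * v ^ 5 * (1 + 1) ^ 6 = 64 * (1296 * v ^ 5 * 1) := by ring
      _ ≤ _ := by gcongr
  set y := Nat.findGreatest (fun y => gPoly v y ≤ m) (4 * z ^ 6) with hy
  have hy1 : 1 ≤ y := Nat.le_findGreatest (by omega) hg1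
  have hym : gPoly v y ≤ m :=
    Nat.findGreatest_spec (P := fun y => gPoly v y ≤ m) (by omega : 1 ≤ 4 * z ^ 6) hg1
  have hy4 : y < 4 * z ^ 6 := by
    by_contra! h
    have h3 := (mul_pow_six_le_gPoly v (4 * z ^ 6)).trans ((gPoly_mono v h).trans (hym.trans h2))
    have h4 : 1296 * v ^ 5 * (4 * z ^ 6) ^ 6 = 4096 * (1296 * v ^ 5 * z ^ 36) := by ring
    have h5 : 0 < 1296 * v ^ 5 * z ^ 36 := by positivity
    omega
  have hlt : m < gPoly v (y + 1) := by
    by_contra! h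
    have := Nat.le_findGreatest (P := fun y => gPoly v y ≤ m) (by omega : y + 1 ≤ 4 * z ^ 6) h
    omega
  refine ⟨y, Finset.mem_Icc.2 ⟨hy1, hy4.le⟩, hym, hlt.trans_le ((gPoly_succ_le hv y).trans ?_)⟩
  have h3 : 500 * (y + 2) ≤ 2001 * z ^ 6 := by omega
  have h4 : (500 * (y + 2)) ^ 5 ≤ (2001 * z ^ 6) ^ 5 := Nat.pow_le_pow_left h3 5
  have h5 : 6 * (y + 2) ^ 5 ≤ 6200 * z ^ 30 := by
    rw [mul_pow, mul_pow, ← pow_mul] at h4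
    norm_num at h4
    omega
  calc gPoly v y + 6 * (1296 * v ^ 5) * (y + 2) ^ 5 =
        gPoly v y + 1296 * v ^ 5 * (6 * (y + 2) ^ 5) := by ring
    _ ≤ gPoly v y + 1296 * v ^ 5 * (6200 * z ^ 30) := by gcongr
    _ = _ := by ring

/-- If `n` is not of the form `g(y) + g(x₁) + ⋯ + g(x₃₃) + u + u'`, then some exponential sum is
large on average. -/
theorem main_le_sum_norm {v z n M : ℕ} {U : Finset ℕ} (hv : 0 < v) (hz : 10 ^ 4 ≤ z)
    (hU : ∀ u ∈ U, u ≤ 1296 * v ^ 5 * z ^ 36) (hM : M = 10 ^ 4 * (1296 * v ^ 5 * z ^ 36))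
    (hn1 : 2200 * (1296 * v ^ 5 * z ^ 36) ≤ n) (hn2 : n ≤ 4000 * (1296 * v ^ 5 * z ^ 36))
    (h0 : ¬ ∃ (y : ℕ) (x : Fin 33 → ℕ), ∃ u ∈ U, ∃ u' ∈ U,
      gPoly v y + (∑ i, gPoly v (x i) + (u + u')) = n) :
    (M : ℝ) * ((z ^ 6) ^ 33 * U.card ^ 2) ≤ ∑ a ∈ Finset.range M,
      4 * z ^ 6 * ‖ySum v (z ^ 6) (a / M)‖ ^ 33 * ‖∑ u ∈ U, e (a / M * (u : ℤ))‖ ^ 2 *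
        ‖∑ h ∈ Finset.range (6200 * (1296 * v ^ 5) * z ^ 30), (e (a / M * h) - 1)‖ := by
  classical
  have hz6 : 10 ^ 6 ≤ z ^ 6 := Nat.pow_le_pow_left (by omega) 6
  have hM0 : 0 < M := by rw [hM]; positivity
  set H := 6200 * (1296 * v ^ 5) * z ^ 30 with hH
  have hHT : H ≤ 1296 * v ^ 5 * z ^ 36 := by
    calc H = 1296 * v ^ 5 * z ^ 30 * 6200 := by rw [hH]; ring
      _ ≤ 1296 * v ^ 5 * z ^ 30 * z ^ 6 := by gcongr; omega
      _ = _ := by ring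
  have hg4 : ∀ y ≤ 4 * z ^ 6, gPoly v y ≤ 4100 * (1296 * v ^ 5 * z ^ 36) := by
    intro y hy
    refine (gPoly_le hv y).trans ?_
    have h3 : 10 ^ 5 * (y + 1) ≤ 400001 * z ^ 6 := by omega
    have h4 : (10 ^ 5 * (y + 1)) ^ 6 ≤ (400001 * z ^ 6) ^ 6 := Nat.pow_le_pow_left h3 6
    have h5 : (y + 1) ^ 6 ≤ 4100 * z ^ 36 := by
      rw [mul_pow, mul_pow, ← pow_mul z] at h4
      norm_num at h4
      omega
    calc _ ≤ 1296 * v ^ 5 * (4100 * z ^ 36) := by gcongr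
      _ = _ := by ring
  set ms := Finset.Ico (z ^ 6) (2 * z ^ 6) with hms
  set R := (Fintype.piFinset fun _ : Fin 33 => ms) ×ˢ (U ×ˢ U) with hR
  set r : (Fin 33 → ℕ) × (ℕ × ℕ) → ℕ := fun w => ∑ i, gPoly v (w.1 i) + (w.2.1 + w.2.2) with hr
  set N : ℕ × ((Fin 33 → ℕ) × (ℕ × ℕ)) → ℤ := fun w => ((gPoly v w.1 : ℕ) : ℤ) + (r w.2 : ℤ) with hN
  have hrT : ∀ w ∈ R, r w ≤ 2114 * (1296 * v ^ 5 * z ^ 36) := by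
    rintro ⟨x, u, u'⟩ hw
    simp only [hR, Finset.mem_product, Fintype.mem_piFinset] at hw
    obtain ⟨hx, hu, hu'⟩ := hw
    have h1 : ∑ i, gPoly v (x i) ≤ ∑ _i : Fin 33, 64 * (1296 * v ^ 5 * z ^ 36) :=
      Finset.sum_le_sum fun i _ => gPoly_le_of_lt hv (Finset.mem_Ico.1 (hx i)).2
    rw [Finset.sum_const, Finset.card_univ, Fintype.card_fin, smul_eq_mul] at h1
    have h2 := hU u hu
    have h3 := hU u' hu'
    simp only [hr]
    omega
  have key := card_filter_le_sum_norm (Finset.Icc 1 (4 * z ^ 6) ×ˢ R) N n (H := H) hM0 (by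
    rintro ⟨y, w⟩ hw h hh
    rw [Finset.mem_product, Finset.mem_Icc] at hw
    have h1 := hg4 y hw.1.2
    have h2 := hrT w hw.2
    rw [hM, abs_lt]
    simp only [hN]
    have : 0 < 1296 * v ^ 5 * z ^ 36 := by positivity
    generalize 1296 * v ^ 5 * z ^ 36 = T at *
    push_cast
    constructor <;> omega) (by
    rintro ⟨y, x, u, u'⟩ hw h
    simp only [hR, Finset.mem_product] at hw
    refine h0 ⟨y, x, u, hw.2.2.1, u', hw.2.2.2, ?_⟩
    simp only [hN, hr] at h
    exact_mod_cast h)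
  have hcard : (z ^ 6) ^ 33 * U.card ^ 2 ≤
      ((Finset.Icc 1 (4 * z ^ 6) ×ˢ R).filter fun w => N w ≤ n ∧ n < N w + H).card := by
    have hRc : R.card = (z ^ 6) ^ 33 * U.card ^ 2 := by
      rw [hR, Finset.card_product, Fintype.card_piFinset_const, Finset.card_product, hms,
        Nat.card_Ico, show 2 * z ^ 6 - z ^ 6 = z ^ 6 by omega, sq]
    have hex : ∀ w ∈ R, ∃ y ∈ Finset.Icc 1 (4 * z ^ 6), gPoly v y ≤ n - r w ∧
        n - r w < gPoly v y + H := fun w hw => by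
      have h1 := hrT w hw
      exact exists_gPoly_le_lt hv (by omega) (by omega) (by omega)
    choose! Y hY1 hY2 hY3 using hex
    rw [← hRc]
    refine Finset.card_le_card_of_injOn (fun w => (Y w, w)) ?_ ?_
    · intro w hw
      have hw : w ∈ R := hw
      have h1 := hrT w hw
      have h2 := hY2 w hw
      have h3 := hY3 w hw
      refine Finset.mem_coe.2 (Finset.mem_filter.2 ⟨Finset.mem_product.2 ⟨hY1 w hw, hw⟩, ?_⟩)
      simp only [hN]
      omega
    · intro w _ w' _ h
      exact (Prod.ext_iff.1 h).2
  have hcardR := (Nat.cast_le (α := ℝ)).2 hcard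
  push_cast at hcardR
  refine (mul_le_mul_of_nonneg_left hcardR (Nat.cast_nonneg M)).trans (key.trans ?_)
  refine Finset.sum_le_sum fun a _ => mul_le_mul_of_nonneg_right ?_ (norm_nonneg _)
  have hfac : ∑ w ∈ Finset.Icc 1 (4 * z ^ 6) ×ˢ R, e (a / M * N w) =
      (∑ y ∈ Finset.Icc 1 (4 * z ^ 6), e (a / M * ((gPoly v y : ℕ) : ℤ))) *
      (ySum v (z ^ 6) (a / M) ^ 33 * ((∑ u ∈ U, e (a / M * (u : ℤ))) *
        ∑ u ∈ U, e (a / M * (u : ℤ)))) := by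
    rw [ySum_eq, ← sum_piFinset_e, ← sum_product_e, ← sum_product_e, ← sum_product_e]
    refine Finset.sum_congr rfl fun w _ => ?_
    simp only [hN, hr]
    push_cast
    rfl
  rw [hfac, norm_mul, norm_mul, norm_mul, norm_pow, ← sq, ← mul_assoc]
  gcongr
  refine (norm_sum_le _ _).trans (le_of_eq ?_)
  simp [norm_e]

/-- The total weight of the major arcs. -/
theorem sum_Icc_div_max_pow_le (R : ℕ) :
    ∑ q ∈ Finset.Icc 1 R, ((q : ℝ) + 1) / ((max q 167 : ℕ) : ℝ) ^ 5 ≤ 2 / 167 ^ 2 * (4 / 167) := by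
  have h : ∀ R : ℕ, ∑ q ∈ Finset.Icc 1 R, ((q : ℝ) + 1) / ((max q 167 : ℕ) : ℝ) ^ 5 ≤
      2 / 167 ^ 2 * (4 / 167 - 4 / ((R : ℝ) + 167)) := by
    intro R
    induction R with
    | zero => norm_num
    | succ R ih =>
      rw [Finset.sum_Icc_succ_top (by omega)]
      refine (add_le_add_left ih _).trans ?_
      have h1 : (R : ℝ) + 1 ≤ ((max (R + 1) 167 : ℕ) : ℝ) := by exact_mod_cast le_max_left _ _
      have h2 : (167 : ℝ) ≤ ((max (R + 1) 167 : ℕ) : ℝ) := by exact_mod_cast le_max_right _ _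
      generalize ((max (R + 1) 167 : ℕ) : ℝ) = x at *
      have hR : (0 : ℝ) ≤ R := Nat.cast_nonneg R
      have h3 : ((R + 1 : ℕ) + 1 : ℝ) / x ^ 5 ≤ 2 / 167 ^ 2 * (1 / x ^ 2) := by
        rw [show 2 / 167 ^ 2 * (1 / x ^ 2) = 2 * x * (x ^ 2 / 167 ^ 2) / x ^ 5 by field_simp]
        gcongr
        calc ((R + 1 : ℕ) + 1 : ℝ) ≤ 2 * x * 1 := by push_cast; linarith
          _ ≤ _ := by
            gcongr
            rw [one_le_div (by norm_num)]
            gcongr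
      have h4 : 1 / x ^ 2 ≤ 4 / (R + 167) - 4 / (R + 1 + 167) := by
        rw [div_sub_div _ _ (by positivity) (by positivity), div_le_div_iff₀ (by positivity)
          (by positivity)]
        nlinarith
      push_cast at *
      linarith
  refine (h R).trans ?_
  gcongr
  have : (0 : ℝ) ≤ 4 / ((R : ℝ) + 167) := by positivity
  linarith

theorem norm_sum_e_sub_one_le (H : ℕ) (α : ℝ) :
    ‖∑ h ∈ Finset.range H, (e (α * h) - 1)‖ ≤ 2 * H := by
  refine (norm_sum_le _ _).trans ((Finset.sum_le_card_nsmul _ _ 2 fun h _ => ?_).trans ?_)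
  · refine (norm_sub_le _ _).trans ?_
    rw [norm_e, norm_one]
    norm_num
  · rw [Finset.card_range, nsmul_eq_mul, mul_comm]

theorem norm_sum_e_sub_one_le_of_abs_le (H : ℕ) {α δ : ℝ} {b : ℤ} (h : |α - b| ≤ δ) :
    ‖∑ h ∈ Finset.range H, (e (α * h) - 1)‖ ≤ H * (2 * Real.pi * (δ * H)) := by
  refine (norm_sum_le _ _).trans ((Finset.sum_le_card_nsmul _ _ (2 * Real.pi * (δ * H))
    fun k hk => ?_).trans ?_)
  · have hk' : (k : ℝ) ≤ H := by exact_mod_cast (Finset.mem_range.1 hk).le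
    have h1 : e (α * k) = e ((α - b) * k) := by
      rw [show α * k = (α - b) * k + ((b * k : ℤ) : ℝ) by push_cast; ring, e_add_int]
    rw [h1]
    refine (norm_e_sub_one_le _).trans ?_
    rw [abs_mul, Nat.abs_cast]
    have : 0 ≤ δ := (abs_nonneg _).trans h
    gcongr
  · rw [Finset.card_range, nsmul_eq_mul]

/-- Parseval's identity, as an upper bound, for distinct frequencies below `M`. -/
theorem sum_range_normSq_le_card {M : ℕ} {U : Finset ℕ} (hM : ∀ u ∈ U, u < M) (hM0 : 0 < M) :
    ∑ a ∈ Finset.range M, ‖∑ u ∈ U, e (a / M * (u : ℤ))‖ ^ 2 ≤ M * (U.card : ℝ) := by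
  have h := sum_range_normSq_le hM0 U (fun u : ℕ => (u : ℤ)) (fun _ => 1) (by simp)
  simp only [one_mul] at h
  refine h.trans ?_
  gcongr
  refine Finset.card_le_card_of_injOn Prod.fst ?_ ?_
  · intro w hw
    simp only [Finset.coe_filter, Finset.mem_product, Set.mem_ofPred_eq] at hw
    exact hw.1.1
  · intro w hw w' hw' hh
    simp only [Finset.coe_filter, Finset.mem_product, Set.mem_ofPred_eq] at hw hw'
    have key : ∀ w : ℕ × ℕ, (w.1 ∈ U ∧ w.2 ∈ U) ∧ (M : ℤ) ∣ (w.1 : ℤ) - w.2 → w.1 = w.2 := by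
      rintro ⟨a, b⟩ ⟨⟨ha, hb⟩, hd⟩
      have := hM a ha
      have := hM b hb
      have := Int.eq_zero_of_abs_lt_dvd hd (by rw [abs_lt]; constructor <;> simp only <;> omega)
      simp only at this ⊢
      omega
    exact Prod.ext hh ((key w hw).symm.trans (hh.trans (key w' hw')))

theorem norm_ySum_le (v Y : ℕ) (α : ℝ) : ‖ySum v Y α‖ ≤ Y := by
  refine (norm_sum_le _ _).trans ?_
  simp only [norm_e, Finset.sum_const, Nat.card_Ico, nsmul_eq_mul, mul_one]
  exact_mod_cast (by omega : 2 * Y - Y ≤ Y)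

/-- The integrand, bounded by its contributions from the minor and the major arcs. -/
theorem integrand_le {v z : ℕ} (hv : 0 < v)
    (hzc : 10 ^ 30 * (1296 * v ^ 5) ≤ z) (hV : ∀ p : ℕ, p.Prime → p < 167 → p ∣ v) {α : ℝ}
    (hα0 : 0 ≤ α) (hα1 : α < 1)
    (hminor : ∀ q : ℕ, z ^ 5 < q → q ≤ 7 * (1296 * v ^ 5) * z ^ 31 → ∀ b : ℤ,
      IsCoprime b (q : ℤ) → |α - b / q| ≤ 1 / q ^ 2 →
        ‖ySum v (z ^ 6) α‖ ^ 32 * 2 ^ 307 ≤ (z : ℝ) ^ 190)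
    {X B C₁ C₂ : ℝ} {Hn : ℕ} {S K : ℂ} (hS : ‖S‖ ≤ X)
    (hK : K = ∑ h ∈ Finset.range Hn, (e (α * h) - 1))
    (hB : B = 4 * z ^ 6 * ((z : ℝ) ^ 190 / 2 ^ 307 * z ^ 6) * (2 * Hn))
    (hC₁ : C₁ = 4 * z ^ 6 * ((z : ℝ) ^ 6) ^ 31 * X ^ 2 *
      (Hn * (2 * Real.pi * (1 / (7 * (1296 * v ^ 5) * z ^ 31) * Hn))))
    (hC₂ : C₂ = 4 * z ^ 6 * (1.35 * ((z : ℝ) ^ 6) ^ 30 * z ^ 6) * X ^ 2 * (2 * Hn)) :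
    4 * z ^ 6 * ‖ySum v (z ^ 6) α‖ ^ 33 * ‖S‖ ^ 2 * ‖K‖ ≤ B * ‖S‖ ^ 2 +
      ∑ q ∈ Finset.Icc 1 (z ^ 5), ∑ b ∈ Finset.range (q + 1),
        if |α - (b : ℝ) / q| ≤ 1 / (7 * (1296 * v ^ 5) * z ^ 31 * q) then
          ((if q = 1 then C₁ else 0) + C₂ / ((max q 167 : ℕ) : ℝ) ^ 5) *
            ‖ySum v (z ^ 6) α‖ ^ 2 else 0 := by
  have hz0 : 0 < z := lt_of_lt_of_le (by positivity) hzc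
  have hX : 0 ≤ X := (norm_nonneg _).trans hS
  have hB0 : 0 ≤ B := by rw [hB]; positivity
  have hC₁0 : 0 ≤ C₁ := by rw [hC₁]; positivity
  have hC₂0 : 0 ≤ C₂ := by rw [hC₂]; positivity
  have hY : ‖ySum v (z ^ 6) α‖ ≤ (z : ℝ) ^ 6 := by
    have := norm_ySum_le v (z ^ 6) α
    push_cast at this
    exact this
  have hK2 : ‖K‖ ≤ 2 * Hn := by rw [hK]; exact norm_sum_e_sub_one_le _ _
  set F := ‖ySum v (z ^ 6) α‖ with hF
  have hF0 : 0 ≤ F := norm_nonneg _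
  set Q : ℕ := 7 * (1296 * v ^ 5) * z ^ 31 with hQ
  have hQ0 : 0 < Q := by positivity
  have hQr : (Q : ℝ) = 7 * (1296 * v ^ 5) * z ^ 31 := by rw [hQ]; push_cast; ring
  obtain ⟨r, hr1, hr2⟩ := Real.exists_rat_abs_sub_le_and_den_le α hQ0
  have hrd : (0 : ℝ) < r.den := by exact_mod_cast r.den_pos
  have hcop : IsCoprime r.num (r.den : ℤ) := by
    rw [Int.isCoprime_iff_gcd_eq_one]
    exact r.reduced
  have hrr : (r : ℝ) = (r.num : ℝ) / (r.den : ℝ) := by exact_mod_cast (Rat.num_div_den r).symm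
  rw [hrr] at hr1
  have hr3 : |α - r.num / r.den| ≤ 1 / (Q * r.den) := hr1.trans (by gcongr; linarith)
  have hterm : ∀ q ∈ Finset.Icc 1 (z ^ 5), ∀ b ∈ Finset.range (q + 1), 0 ≤
      if |α - (b : ℝ) / q| ≤ 1 / (7 * (1296 * v ^ 5) * z ^ 31 * q) then
          ((if q = 1 then C₁ else 0) + C₂ / ((max q 167 : ℕ) : ℝ) ^ 5) * F ^ 2 else 0 := by
    intro q _ b _
    split_ifs <;> positivity
  rcases lt_or_ge (z ^ 5) r.den with hlt | hle
  · have h1 := hminor r.den hlt hr2 _ hcop (hr3.trans (by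
      rw [sq]
      gcongr))
    refine le_add_of_le_of_nonneg ?_ (Finset.sum_nonneg fun q hq => Finset.sum_nonneg (hterm q hq))
    have h2 : F ^ 32 ≤ (z : ℝ) ^ 190 / 2 ^ 307 := by
      rw [le_div_iff₀ (by positivity)]
      exact h1
    calc 4 * (z : ℝ) ^ 6 * F ^ 33 * ‖S‖ ^ 2 * ‖K‖
        = 4 * (z : ℝ) ^ 6 * (F ^ 32 * F) * ‖S‖ ^ 2 * ‖K‖ := by ring
      _ ≤ 4 * (z : ℝ) ^ 6 * ((z : ℝ) ^ 190 / 2 ^ 307 * z ^ 6) * ‖S‖ ^ 2 * (2 * Hn) := by gcongr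
      _ = _ := by rw [hB]; ring
  · refine le_add_of_nonneg_of_le (by positivity) ?_
    have hnum0 : 0 ≤ r.num := by
      by_contra! h
      have h3 : (r.num : ℝ) ≤ -1 := by exact_mod_cast (by omega : r.num ≤ -1)
      have h4 : (r.num : ℝ) / r.den ≤ -(1 / r.den) := by
        rw [← neg_div]
        gcongr
      have h5 : 1 / (((Q : ℝ) + 1) * r.den) < 1 / r.den := by
        refine one_div_lt_one_div_of_lt hrd ?_
        have : (0 : ℝ) < Q := by exact_mod_cast hQ0
        nlinarith
      have := (abs_le.1 hr1).2
      linarith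
    have hnum1 : r.num ≤ r.den := by
      by_contra! h
      have h3 : (r.den : ℝ) + 1 ≤ r.num := by exact_mod_cast h
      have h4 : 1 + 1 / (r.den : ℝ) ≤ (r.num : ℝ) / r.den := by
        rw [le_div_iff₀ hrd, add_mul, one_div_mul_cancel hrd.ne', one_mul]
        exact h3
      have h5 : 1 / (((Q : ℝ) + 1) * r.den) < 1 / r.den := by
        refine one_div_lt_one_div_of_lt hrd ?_
        have : (0 : ℝ) < Q := by exact_mod_cast hQ0
        nlinarith
      have := (abs_le.1 hr1).1
      linarith
    obtain ⟨b, hb⟩ := Int.eq_ofNat_of_zero_le hnum0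
    set q := r.den with hq
    have hq0 : 0 < q := r.den_pos
    have hqm : q ∈ Finset.Icc 1 (z ^ 5) := Finset.mem_Icc.2 ⟨hq0, hle⟩
    have hbm : b ∈ Finset.range (q + 1) := Finset.mem_range.2 (by omega)
    refine le_trans ?_ (Finset.single_le_sum (fun q hq => Finset.sum_nonneg (hterm q hq)) hqm)
    refine le_trans ?_ (Finset.single_le_sum (hterm q hqm) hbm)
    have hbr : (r.num : ℝ) = b := by rw [hb]; simp
    rw [hQr] at hr3
    rw [if_pos (by rw [← hbr]; exact hr3)]
    have hS2 : ‖S‖ ^ 2 ≤ X ^ 2 := by gcongr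
    have hmax : (0 : ℝ) < ((max q 167 : ℕ) : ℝ) := by
      exact_mod_cast lt_of_lt_of_le (by norm_num) (le_max_right q 167)
    rcases Nat.lt_or_ge 1 q with h1 | h1
    · have h2 := norm_ySum_major_le hv hzc h1 hle hV hcop hr3
      rw [← hF, ← le_div_iff₀ (by positivity)] at h2
      rw [if_neg (by omega), zero_add]
      calc 4 * (z : ℝ) ^ 6 * F ^ 33 * ‖S‖ ^ 2 * ‖K‖
          = 4 * (z : ℝ) ^ 6 * (F ^ 30 * F) * ‖S‖ ^ 2 * ‖K‖ * F ^ 2 := by ring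
        _ ≤ 4 * (z : ℝ) ^ 6 * (1.35 * ((z : ℝ) ^ 6) ^ 30 / ((max q 167 : ℕ) : ℝ) ^ 5 * z ^ 6) *
            X ^ 2 * (2 * Hn) * F ^ 2 := by gcongr
        _ = _ := by rw [hC₂]; ring
    · have hq1 : q = 1 := by omega
      have h3 := hr3
      rw [hq1, Nat.cast_one, div_one, mul_one] at h3
      have h4 := norm_sum_e_sub_one_le_of_abs_le Hn h3
      rw [← hK] at h4
      rw [if_pos hq1]
      calc 4 * (z : ℝ) ^ 6 * F ^ 33 * ‖S‖ ^ 2 * ‖K‖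
          = 4 * (z : ℝ) ^ 6 * F ^ 31 * ‖S‖ ^ 2 * ‖K‖ * F ^ 2 := by ring
        _ ≤ 4 * (z : ℝ) ^ 6 * ((z : ℝ) ^ 6) ^ 31 * X ^ 2 *
            (Hn * (2 * Real.pi * (1 / (7 * (1296 * v ^ 5) * z ^ 31) * Hn))) * F ^ 2 := by gcongr
        _ = C₁ * F ^ 2 := by rw [hC₁]
        _ ≤ _ := by
          gcongr
          exact le_add_of_nonneg_right (by positivity)

set_option exponentiation.threshold 400 in
theorem sum_norm_lt {v z M : ℕ} {U : Finset ℕ} (hv : 0 < v)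
    (hzc : 10 ^ 30 * (1296 * v ^ 5) ≤ z) (hV : ∀ p : ℕ, p.Prime → p < 167 → p ∣ v)
    (hminor : ∀ q : ℕ, z ^ 5 < q → q ≤ 7 * (1296 * v ^ 5) * z ^ 31 → ∀ b : ℤ,
      IsCoprime b (q : ℤ) → ∀ α : ℝ, |α - b / q| ≤ 1 / q ^ 2 →
        ‖ySum v (z ^ 6) α‖ ^ 32 * 2 ^ 307 ≤ (z : ℝ) ^ 190)
    (hU : ∀ u ∈ U, u ≤ 1296 * v ^ 5 * z ^ 36)
    (hUc : (1296 * v ^ 5 * z ^ 36 : ℝ) ≤ 2 ^ 289 * z ^ 2 * U.card)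
    (hM : M = 10 ^ 4 * (1296 * v ^ 5 * z ^ 36)) :
    ∑ a ∈ Finset.range M,
      4 * z ^ 6 * ‖ySum v (z ^ 6) (a / M)‖ ^ 33 * ‖∑ u ∈ U, e (a / M * (u : ℤ))‖ ^ 2 *
        ‖∑ h ∈ Finset.range (6200 * (1296 * v ^ 5) * z ^ 30), (e (a / M * h) - 1)‖ <
      (M : ℝ) * ((z ^ 6) ^ 33 * U.card ^ 2) := by
  have hz0 : 0 < z := lt_of_lt_of_le (by positivity) hzc
  have hzr : (0 : ℝ) < z := by exact_mod_cast hz0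
  have hvr : (0 : ℝ) < v := by exact_mod_cast hv
  have hM0 : 0 < M := by rw [hM]; positivity
  have hMr : (0 : ℝ) < M := by exact_mod_cast hM0
  have hz10 : 10 ^ 20 ≤ z := by
    refine le_trans ?_ hzc
    have : 1 ≤ v ^ 5 := Nat.one_le_pow _ _ hv
    omega
  have hz10r : (10 : ℝ) ^ 20 ≤ z := by exact_mod_cast hz10
  have hX0 : (0 : ℝ) < U.card := by
    by_contra! h
    have h1 : (2 ^ 289 * z ^ 2 * U.card : ℝ) ≤ 0 := mul_nonpos_of_nonneg_of_nonpos (by positivity) h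
    have h2 : (0 : ℝ) < 1296 * v ^ 5 * z ^ 36 := by positivity
    linarith
  set X : ℝ := (U.card : ℝ) with hX
  set Hn : ℕ := 6200 * (1296 * v ^ 5) * z ^ 30 with hHn
  have hHr : (Hn : ℝ) = 6200 * (1296 * v ^ 5) * z ^ 30 := by rw [hHn]; push_cast; ring
  have hsum := Finset.sum_le_sum fun a (ha : a ∈ Finset.range M) =>
    integrand_le (z := z) (Hn := Hn) hv hzc hV (α := (a : ℝ) / M) (by positivity)
      (by rw [div_lt_one hMr]; exact_mod_cast Finset.mem_range.1 ha)
      (fun q h1 h2 b h3 h4 => hminor q h1 h2 b h3 _ h4) (X := X)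
      (S := ∑ u ∈ U, e (a / M * (u : ℤ)))
      ((norm_sum_le _ _).trans (by simp [norm_e, hX])) rfl rfl rfl rfl
  refine hsum.trans_lt ?_
  clear hsum hminor hV
  set c : ℝ := 1296 * v ^ 5 with hc
  have hc0 : 0 < c := by positivity
  generalize hB : 4 * (z : ℝ) ^ 6 * ((z : ℝ) ^ 190 / 2 ^ 307 * z ^ 6) * (2 * Hn) = B
  generalize hC₁ : 4 * (z : ℝ) ^ 6 * ((z : ℝ) ^ 6) ^ 31 * X ^ 2 *
      (Hn * (2 * Real.pi * (1 / (7 * c * z ^ 31) * Hn))) = C₁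
  generalize hC₂ : 4 * (z : ℝ) ^ 6 * (1.35 * ((z : ℝ) ^ 6) ^ 30 * z ^ 6) * X ^ 2 * (2 * Hn) = C₂
  have hB0 : 0 ≤ B := by rw [← hB]; positivity
  have hC₁0 : 0 ≤ C₁ := by rw [← hC₁]; positivity
  have hC₂0 : 0 ≤ C₂ := by rw [← hC₂]; positivity
  set A : ℝ := 1.4 * M / (c * z ^ 24) with hA
  have hA0 : 0 ≤ A := by rw [hA]; positivity
  rw [Finset.sum_add_distrib, ← Finset.mul_sum]
  have hmin : B * ∑ a ∈ Finset.range M, ‖∑ u ∈ U, e (a / M * (u : ℤ))‖ ^ 2 ≤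
      0.8 * (M * ((z ^ 6) ^ 33 * X ^ 2)) := by
    have h1 := sum_range_normSq_le_card (M := M) (U := U) (fun u hu => by
      have := hU u hu
      have h2 : 0 < 1296 * v ^ 5 * z ^ 36 := by positivity
      omega) hM0
    calc _ ≤ B * (M * X) := by gcongr
      _ = 49600 / 2 ^ 307 * (c * z ^ 36) * (M * z ^ 196 * X) := by
        rw [← hB, hHr]
        ring
      _ ≤ 49600 / 2 ^ 307 * (2 ^ 289 * z ^ 2 * X) * (M * z ^ 196 * X) := by gcongr
      _ = 49600 / 2 ^ 18 * (M * ((z ^ 6) ^ 33 * X ^ 2)) := by ring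
      _ ≤ _ := by
        gcongr
        norm_num
  have hmaj : ∑ a ∈ Finset.range M, ∑ q ∈ Finset.Icc 1 (z ^ 5), ∑ b ∈ Finset.range (q + 1),
        (if |(a : ℝ) / M - (b : ℝ) / q| ≤ 1 / (7 * c * z ^ 31 * q) then
          ((if q = 1 then C₁ else 0) + C₂ / ((max q 167 : ℕ) : ℝ) ^ 5) *
            ‖ySum v (z ^ 6) (a / M)‖ ^ 2 else 0) ≤
      2 * C₁ * A + C₂ * (2 / 167 ^ 2 * (4 / 167)) * A := by
    rw [Finset.sum_comm]
    have hq : ∀ q ∈ Finset.Icc 1 (z ^ 5), ∑ a ∈ Finset.range M, ∑ b ∈ Finset.range (q + 1),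
        (if |(a : ℝ) / M - (b : ℝ) / q| ≤ 1 / (7 * c * z ^ 31 * q) then
          ((if q = 1 then C₁ else 0) + C₂ / ((max q 167 : ℕ) : ℝ) ^ 5) *
            ‖ySum v (z ^ 6) (a / M)‖ ^ 2 else 0) ≤
        (if q = 1 then 2 * C₁ * A else 0) +
          C₂ * A * (((q : ℝ) + 1) / ((max q 167 : ℕ) : ℝ) ^ 5) := by
      intro q hq
      rw [Finset.mem_Icc] at hq
      rw [Finset.sum_comm]
      have hD : 0 ≤ (if q = 1 then C₁ else 0) + C₂ / ((max q 167 : ℕ) : ℝ) ^ 5 := by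
        split_ifs <;> positivity
      refine (Finset.sum_le_card_nsmul _ _
        (((if q = 1 then C₁ else 0) + C₂ / ((max q 167 : ℕ) : ℝ) ^ 5) * A) fun b _ => ?_).trans ?_
      · rw [← Finset.sum_filter, ← Finset.mul_sum]
        exact mul_le_mul_of_nonneg_left
          (sum_arc_ySum_le hv (by omega) (by omega) hq.2 ((b : ℝ) / q) hM) hD
      · rw [Finset.card_range, nsmul_eq_mul]
        push_cast
        apply le_of_eq
        split_ifs with h1
        · subst h1
          push_cast
          ring
        · ring
    refine (Finset.sum_le_sum hq).trans ?_
    rw [Finset.sum_add_distrib, Finset.sum_ite_eq' , ← Finset.mul_sum]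
    have h1 := sum_Icc_div_max_pow_le (z ^ 5)
    rw [if_pos (Finset.mem_Icc.2 ⟨le_rfl, Nat.one_le_pow _ _ hz0⟩)]
    calc _ ≤ 2 * C₁ * A + C₂ * A * (2 / 167 ^ 2 * (4 / 167)) := by gcongr
      _ = _ := by ring
  have hC₁A : 2 * C₁ * A ≤ 0.03 * (M * ((z ^ 6) ^ 33 * X ^ 2)) := by
    have hpi : Real.pi ≤ 3.15 := Real.pi_lt_d2.le
    calc 2 * C₁ * A = 123008000 * Real.pi * (M * z ^ 197 * X ^ 2) := by
          rw [← hC₁, hA, hHr]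
          field_simp
          ring
      _ ≤ 0.03 * z * (M * z ^ 197 * X ^ 2) := by
          refine mul_le_mul_of_nonneg_right ?_ (by positivity)
          linarith
      _ = _ := by ring
  have hC₂A : C₂ * (2 / 167 ^ 2 * (4 / 167)) * A ≤ 0.162 * (M * ((z ^ 6) ^ 33 * X ^ 2)) := by
    calc C₂ * (2 / 167 ^ 2 * (4 / 167)) * A =
        93744 * (2 / 167 ^ 2 * (4 / 167)) * (M * ((z ^ 6) ^ 33 * X ^ 2)) := by
          rw [← hC₂, hA, hHr]
          field_simp
          ring
      _ ≤ _ := by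
        gcongr
        norm_num
  have hpos : 0 < (M : ℝ) * ((z ^ 6) ^ 33 * X ^ 2) := by positivity
  linarith

theorem exists_gPoly_add_eq {v z n : ℕ} {U : Finset ℕ} (hv : 0 < v)
    (hzc : 10 ^ 30 * (1296 * v ^ 5) ≤ z) (hV : ∀ p : ℕ, p.Prime → p < 167 → p ∣ v)
    (hminor : ∀ q : ℕ, z ^ 5 < q → q ≤ 7 * (1296 * v ^ 5) * z ^ 31 → ∀ b : ℤ,
      IsCoprime b (q : ℤ) → ∀ α : ℝ, |α - b / q| ≤ 1 / q ^ 2 →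
        ‖ySum v (z ^ 6) α‖ ^ 32 * 2 ^ 307 ≤ (z : ℝ) ^ 190)
    (hU : ∀ u ∈ U, u ≤ 1296 * v ^ 5 * z ^ 36)
    (hUc : (1296 * v ^ 5 * z ^ 36 : ℝ) ≤ 2 ^ 289 * z ^ 2 * U.card)
    (hn1 : 2200 * (1296 * v ^ 5 * z ^ 36) ≤ n) (hn2 : n ≤ 4000 * (1296 * v ^ 5 * z ^ 36)) :
    ∃ (y : ℕ) (x : Fin 33 → ℕ), ∃ u ∈ U, ∃ u' ∈ U,
      gPoly v y + (∑ i, gPoly v (x i) + (u + u')) = n := by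
  by_contra h0
  refine absurd (sum_norm_lt hv hzc hV hminor hU hUc rfl)
    (not_lt.2 (main_le_sum_norm hv ?_ hU rfl hn1 hn2 h0))
  refine le_trans ?_ hzc
  have : 1 ≤ v ^ 5 := Nat.one_le_pow _ _ hv
  omega

theorem isRepr_sum_gPoly {v ρ y u u' : ℕ} {d : Fin 9 → ℕ} {x : Fin 33 → ℕ} (hd : ∀ i, 0 < d i)
    (hu : IsRepr (36 * v * u + ρ + 18) 18 6) (hu' : IsRepr (36 * v * u' + ρ + 18) 18 6) :
    IsRepr (∑ i, d i ^ 6 + 70 + 2 * ρ +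
      36 * v * (gPoly v y + (∑ i, gPoly v (x i) + (u + u')))) 79 6 := by
  have h33 : IsRepr (∑ i, (1 + 6 * v * x i) ^ 6) 33 6 :=
    ⟨fun i => 1 + 6 * v * x i, fun i => by positivity, rfl⟩
  have h9 : IsRepr (∑ i, d i ^ 6) 9 6 := ⟨d, hd, rfl⟩
  have h1 : IsRepr ((1 + 6 * v * y) ^ 6) 1 6 := .pow (by positivity)
  have hrep := (((h9.add h1).add h33).add hu).add hu'
  convert hrep using 1
  simp only [← gPoly_spec]
  rw [Finset.sum_add_distrib, ← Finset.mul_sum]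
  simp only [Finset.sum_const, Finset.card_univ, Fintype.card_fin, smul_eq_mul]
  ring

/-- The representation of `N` as a sum of `9 + 1 + 33 + 18 + 18` positive sixth powers. -/
theorem isRepr_of_minor_arcs {v z N : ℕ} (hv : 0 < v) (hv2 : 6 * v ≤ 2 ^ 219)
    (hzc : 10 ^ 30 * (1296 * v ^ 5) ≤ z) (hV : ∀ p : ℕ, p.Prime → p < 167 → p ∣ v)
    (hminor : ∀ q : ℕ, z ^ 5 < q → q ≤ 7 * (1296 * v ^ 5) * z ^ 31 → ∀ b : ℤ,
      IsCoprime b (q : ℤ) → ∀ α : ℝ, |α - b / q| ≤ 1 / q ^ 2 →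
        ‖ySum v (z ^ 6) α‖ ^ 32 * 2 ^ 307 ≤ (z : ℝ) ^ 190)
    (h9 : NineSixthPowersMod (36 * v))
    (hN1 : 2300 * (1296 * v ^ 5) * (36 * v) * z ^ 36 ≤ N)
    (hN2 : N < 2300 * (1296 * v ^ 5) * (36 * v) * (z + 1) ^ 36) : IsRepr N 79 6 := by
  have hv5 : 1 ≤ v ^ 5 := Nat.one_le_pow _ _ hv
  have hz0 : 0 < z := lt_of_lt_of_le (by positivity) hzc
  obtain ⟨ρ, U, hρ, hU, hUc⟩ := exists_finset_sums_eighteen hv hv2 hz0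
  clear hv2
  have hz4 : 10 ^ 4 ≤ z := le_trans (by omega) hzc
  have hz36 : z ≤ z ^ 36 := Nat.le_self_pow (by norm_num) z
  set T := 1296 * v ^ 5 * z ^ 36 with hT
  set W := 36 * v with hW
  have hW0 : 0 < W := by positivity
  have hTN : W * (2300 * T) ≤ N := le_trans (le_of_eq (by rw [hT]; ring)) hN1
  have hNT : N < W * (3400 * T) := by
    refine hN2.trans_le ?_
    have h1 : 2300 * (z + 1) ^ 36 ≤ 3400 * z ^ 36 := by
      have h2 : (100 * (z + 1)) ^ 36 ≤ (101 * z) ^ 36 := Nat.pow_le_pow_left (by omega) 36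
      rw [mul_pow, mul_pow] at h2
      generalize (z + 1) ^ 36 = s at *
      generalize z ^ 36 = t at *
      norm_num at h2
      omega
    calc 2300 * (1296 * v ^ 5) * W * (z + 1) ^ 36
        = 1296 * v ^ 5 * W * (2300 * (z + 1) ^ 36) := by ring
      _ ≤ 1296 * v ^ 5 * W * (3400 * z ^ 36) := by gcongr
      _ = _ := by rw [hT]; ring
  have hWT : 648 * W ^ 6 ≤ W * (100 * T) := by
    calc 648 * W ^ 6 = W * (648 * 46656 * (1296 * v ^ 5)) := by rw [hW]; ring
      _ ≤ W * (100 * (10 ^ 30 * (1296 * v ^ 5) * (1296 * v ^ 5))) := by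
        refine Nat.mul_le_mul_left _ ?_
        have h1 : 648 * 46656 ≤ 100 * (10 ^ 30 * (1296 * v ^ 5)) := by omega
        exact (Nat.mul_le_mul_right (1296 * v ^ 5) h1).trans (le_of_eq (mul_assoc _ _ _))
      _ ≤ W * (100 * (z ^ 36 * (1296 * v ^ 5))) := by
        gcongr
        exact hzc.trans hz36
      _ = _ := by rw [hT]; ring
  have hW6 : W ≤ W ^ 6 := Nat.le_self_pow (by norm_num) W
  obtain ⟨c, hc⟩ := h9 (N - (70 + 2 * ρ))
  set d : Fin 9 → ℕ := fun i => c i % W + W with hd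
  have hd0 : ∀ i, 0 < d i := fun i => by simp only [hd]; omega
  have hd2 : ∑ i, d i ^ 6 ≤ 576 * W ^ 6 := by
    refine (Finset.sum_le_card_nsmul _ _ ((2 * W) ^ 6) fun i _ => ?_).trans (le_of_eq ?_)
    · refine Nat.pow_le_pow_left ?_ 6
      have := Nat.mod_lt (c i) hW0
      simp only [hd]
      omega
    · rw [Finset.card_univ, Fintype.card_fin, smul_eq_mul]
      ring
  have hdc : ∑ i, d i ^ 6 ≡ N - (70 + 2 * ρ) [MOD W] := by
    refine Nat.ModEq.trans (Nat.ModEq.sum fun i _ => Nat.ModEq.pow 6 ?_) hc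
    simp only [hd]
    exact (Nat.add_modEq_right).trans (Nat.mod_modEq _ _)
  have h70 : 70 + 2 * ρ ≤ 72 * W ^ 6 := by omega
  have hle' : ∑ i, d i ^ 6 + (70 + 2 * ρ) ≤ N := by
    have : W * (100 * T) ≤ W * (2300 * T) := by gcongr; norm_num
    omega
  have hle : ∑ i, d i ^ 6 ≤ N - (70 + 2 * ρ) := by omega
  obtain ⟨n, hn⟩ := (Nat.modEq_iff_dvd' hle).1 hdc
  have hNe : N = ∑ i, d i ^ 6 + 70 + 2 * ρ + W * n := by
    rw [← hn]
    omega
  have hn1 : 2200 * T ≤ n := by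
    refine Nat.le_of_mul_le_mul_left ?_ hW0
    have : W * (2300 * T) = W * (2200 * T) + W * (100 * T) := by ring
    omega
  have hn2 : n ≤ 4000 * T := by
    refine Nat.le_of_mul_le_mul_left ?_ hW0
    have : W * (3400 * T) ≤ W * (4000 * T) := by gcongr; norm_num
    omega
  obtain ⟨y, x, u, hu, u', hu', h⟩ :=
    exists_gPoly_add_eq hv hzc hV hminor (fun u hu => (hU u hu).1) hUc hn1 hn2
  rw [hNe, ← h]
  exact isRepr_sum_gPoly hd0 (hU u hu).2 (hU u' hu').2

theorem exists_mul_pow_le_lt {K : ℕ} (hK : 0 < K) {k : ℕ} (hk : k ≠ 0) (N : ℕ) :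
    ∃ z, K * z ^ k ≤ N ∧ N < K * (z + 1) ^ k := by
  have hex : ∃ z, N < K * (z + 1) ^ k := by
    refine ⟨N, ?_⟩
    have h1 : N + 1 ≤ (N + 1) ^ k := Nat.le_self_pow hk _
    nlinarith
  classical
  refine ⟨Nat.find hex, ?_, Nat.find_spec hex⟩
  rcases h : Nat.find hex with _ | z
  · simp [zero_pow hk]
  · exact not_lt.1 (Nat.find_min hex (by omega : z < Nat.find hex))

theorem two_pow_le_of_lt_mul_pow {K N z : ℕ} (hK : K ≤ 2 ^ 1400) (hN : 2 ^ 158000 < N)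
    (h : N < K * (z + 1) ^ 36) : 2 ^ 4300 ≤ z := by
  by_contra hz
  have hz1 : z + 1 ≤ 2 ^ 4300 := Nat.lt_of_not_le hz
  refine absurd (hN.trans h) (not_lt.2 ?_)
  calc K * (z + 1) ^ 36 ≤ 2 ^ 1400 * (2 ^ 4300) ^ 36 :=
        Nat.mul_le_mul hK (Nat.pow_le_pow_left hz1 36)
    _ = 2 ^ (1400 + 4300 * 36) := by rw [← pow_mul, ← pow_add]
    _ ≤ 2 ^ 158000 := Nat.pow_le_pow_right two_pos (by norm_num)

theorem isRepr_of_modulus {v N : ℕ} (hv : 0 < v) (hvle : v ≤ 2 ^ 215)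
    (hvp : ∀ p : ℕ, p.Prime → p < 167 → p ∣ v) (h9 : NineSixthPowersMod (36 * v))
    (hN : 2 ^ 158000 < N) : IsRepr N 79 6 := by
  have hv5 : 1296 * v ^ 5 ≤ 2 ^ 1086 := by
    calc 1296 * v ^ 5 ≤ 2 ^ 11 * (2 ^ 215) ^ 5 :=
          Nat.mul_le_mul (by norm_num) (Nat.pow_le_pow_left hvle 5)
      _ = 2 ^ 1086 := by rw [← pow_mul, ← pow_add]
  have hK : 2300 * (1296 * v ^ 5) * (36 * v) ≤ 2 ^ 1400 := by
    calc 2300 * (1296 * v ^ 5) * (36 * v) ≤ 2 ^ 12 * 2 ^ 1086 * (2 ^ 6 * 2 ^ 215) :=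
          Nat.mul_le_mul (Nat.mul_le_mul (by norm_num) hv5) (Nat.mul_le_mul (by norm_num) hvle)
      _ = 2 ^ (12 + 1086 + (6 + 215)) := by rw [← pow_add, ← pow_add, ← pow_add]
      _ ≤ 2 ^ 1400 := Nat.pow_le_pow_right two_pos (by norm_num)
  have hv2 : 6 * v ≤ 2 ^ 219 := by
    calc 6 * v ≤ 2 ^ 3 * 2 ^ 215 := Nat.mul_le_mul (by norm_num) hvle
      _ = 2 ^ (3 + 215) := by rw [← pow_add]
      _ ≤ 2 ^ 219 := Nat.pow_le_pow_right two_pos (by norm_num)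
  obtain ⟨z, hz1, hz2⟩ := exists_mul_pow_le_lt (K := 2300 * (1296 * v ^ 5) * (36 * v))
    (Nat.mul_pos (Nat.mul_pos (by norm_num) (Nat.mul_pos (by norm_num) (pow_pos hv 5)))
      (Nat.mul_pos (by norm_num) hv)) (k := 36) (by norm_num) N
  have hz := two_pow_le_of_lt_mul_pow hK hN hz2
  refine isRepr_of_minor_arcs hv hv2 ?_ hvp
    (fun q h1 h2 b h3 α h4 => norm_ySum_minor_le hv hv5 hz h1 h2 h3 h4)
    h9 hz1 hz2
  clear hz1 hz2 hN
  calc 10 ^ 30 * (1296 * v ^ 5) ≤ 2 ^ 100 * 2 ^ 1086 := Nat.mul_le_mul (by norm_num) hv5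
    _ = 2 ^ (100 + 1086) := by rw [← pow_add]
    _ ≤ 2 ^ 4300 := Nat.pow_le_pow_right two_pos (by norm_num)
    _ ≤ z := hz

theorem isRepr_large {N : ℕ} (hN : 2 ^ 158000 < N) : IsRepr N 79 6 :=
  isRepr_of_modulus V_pos V_le (fun _ => prime_dvd_V) nineSixthPowersMod_V hN

/-- for every `j ≥ 79` and every positive integer `m`, `m + j` is the
sum of exactly `j` positive sixth powers iff `m + 79` is the sum of exactly `79`
positive sixth powers. -/
theorem stmt_17 :
    ∀ j : ℕ, 79 ≤ j → ∀ m : ℕ, 0 < m →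
      (IsRepr (m + j) j 6 ↔ IsRepr (m + 79) 79 6) := by
  intro j hj m _
  refine ⟨fun h => ?_, fun h => h.mono hj⟩
  rcases lt_or_ge m 16500000 with hm | hm
  · exact isRepr_small hm h
  · rcases le_or_gt m (2 ^ 158000) with h2 | h2
    · exact isRepr_medium (lt_of_lt_of_le (by norm_num) hm) h2
    · exact isRepr_large (h2.trans_le (Nat.le_add_right m 79))
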